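/- Let c, d ≥ 5 be integers and let P = [0,c] × [0,d]. Then for a generic polynomial f ∈ ℂ^{P∩ℤ²} (i.e., a generic bihomogeneous polynomial of bidegree (c,d)): the number of inflection points of the curve {f=0} in the torus T equals 6cd − 3c − 3d, and the number of lines in T tangent to {f=0} at two distinct points of T equals 2c²d² − 10cd + 4c + 4d. -/

import Mathlib

open scoped Pointwise
open MvPolynomial

noncomputable section

/-- The torus `(ℂ ∖ {0})²`. -/
def Torus : Set (ℂ × ℂ) := {p | p.1 ≠ 0 ∧ p.2 ≠ 0}

/-- Evaluation of a bivariate polynomial at a point of `ℂ²`. -/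
def evalP (f : MvPolynomial (Fin 2) ℂ) (p : ℂ × ℂ) : ℂ :=
  MvPolynomial.eval (fun i => if i = 0 then p.1 else p.2) f

/-- The affine line through `p` with direction `w`, as a subset of `ℂ²`. -/
def lineThrough (p w : ℂ × ℂ) : Set (ℂ × ℂ) :=
  {q | ∃ t : ℂ, q = (p.1 + t * w.1, p.2 + t * w.2)}

/-- The univariate polynomial `t ↦ f (p + t • w)`. -/
def lineRestrict (f : MvPolynomial (Fin 2) ℂ) (p w : ℂ × ℂ) : Polynomial ℂ :=
  MvPolynomial.aeval
    (fun i => if i = 0 then Polynomial.C p.1 + Polynomial.C w.1 * Polynomial.X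
              else Polynomial.C p.2 + Polynomial.C w.2 * Polynomial.X) f

/-- Intersection multiplicity at `p` of the curve `{f = 0}` and the line through `p`
with direction `w` (as `ℕ∞`; it is `⊤` if the line lies inside the curve). -/
def interMult (f : MvPolynomial (Fin 2) ℂ) (p w : ℂ × ℂ) : ℕ∞ :=
  if lineRestrict f p w = 0 then ⊤
  else (Polynomial.rootMultiplicity 0 (lineRestrict f p w) : ℕ∞)

/-- The point of `ℝ²` corresponding to a lattice point. -/
def rpt (k : ℤ × ℤ) : ℝ × ℝ := ((k.1 : ℝ), (k.2 : ℝ))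

/-- The support of `f` is contained in `S ⊆ ℤ²`. -/
def SuppIn (f : MvPolynomial (Fin 2) ℂ) (S : Set (ℤ × ℤ)) : Prop :=
  ∀ m ∈ f.support, ((m 0 : ℤ), (m 1 : ℤ)) ∈ S

/-- The coefficient of `f` at the exponent `k ∈ ℤ²`. -/
def coeffAt (f : MvPolynomial (Fin 2) ℂ) (k : ℤ × ℤ) : ℂ :=
  if 0 ≤ k.1 ∧ 0 ≤ k.2 then
    f.coeff (Finsupp.single (0 : Fin 2) k.1.toNat + Finsupp.single (1 : Fin 2) k.2.toNat)
  else 0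

/-- A property `Q` holds for a generic polynomial supported in `S`: there is a nonzero
polynomial `D` in variables indexed by `S` such that `Q f` holds for every `f` with
support in `S` whose coefficient tuple is not annihilated by `D`. -/
def GenericOn (S : Set (ℤ × ℤ)) (Q : MvPolynomial (Fin 2) ℂ → Prop) : Prop :=
  ∃ D : MvPolynomial S ℂ, D ≠ 0 ∧
    ∀ f : MvPolynomial (Fin 2) ℂ, SuppIn f S →
      MvPolynomial.eval (fun k => coeffAt f k.1) D ≠ 0 → Q f

/-- `P` is a lattice polygon: the convex hull of finitely many lattice points. -/
def IsLatticePolygon (P : Set (ℝ × ℝ)) : Prop :=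
  ∃ V : Finset (ℤ × ℤ), V.Nonempty ∧ P = convexHull ℝ (rpt '' (V : Set (ℤ × ℤ)))

/-- The standard triangle `Δ = conv {(0,0), (1,0), (0,1)}`. -/
def stdTriangle : Set (ℝ × ℝ) := convexHull ℝ {(0, 0), (1, 0), (0, 1)}

/-- The lattice points of a subset of `ℝ²`. -/
def latticePts (P : Set (ℝ × ℝ)) : Set (ℤ × ℤ) := {k | rpt k ∈ P}

/-- The support set (face) of `P` in the direction of the covector `γ`. -/
def face (P : Set (ℝ × ℝ)) (γ : ℤ × ℤ) : Set (ℝ × ℝ) :=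
  {p ∈ P | ∀ q ∈ P, (γ.1 : ℝ) * q.1 + (γ.2 : ℝ) * q.2 ≤ (γ.1 : ℝ) * p.1 + (γ.2 : ℝ) * p.2}

/-- The lattice length of the face of `P` in direction `γ`. -/
def lenFace (P : Set (ℝ × ℝ)) (γ : ℤ × ℤ) : ℕ := (latticePts (face P γ)).ncard - 1

/-- The Euclidean area of a subset of `ℝ²`. -/
def areaOf (P : Set (ℝ × ℝ)) : ℝ := (MeasureTheory.volume P).toReal

/-- The set of inflection points of `{f = 0}` in the torus. -/
def inflPts (f : MvPolynomial (Fin 2) ℂ) : Set (ℂ × ℂ) :=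
  {p | p ∈ Torus ∧ evalP f p = 0 ∧ ∃ w : ℂ × ℂ, w ≠ 0 ∧ 3 ≤ interMult f p w}

/-- The set of lines (as subsets of `ℂ²`) tangent to `{f = 0}` at two distinct
points of the torus. -/
def bitangentLines (f : MvPolynomial (Fin 2) ℂ) : Set (Set (ℂ × ℂ)) :=
  {l | ∃ p w q₁ q₂ : ℂ × ℂ, w ≠ 0 ∧ l = lineThrough p w ∧
    q₁ ∈ lineThrough p w ∩ Torus ∧ q₂ ∈ lineThrough p w ∩ Torus ∧ q₁ ≠ q₂ ∧
    2 ≤ interMult f q₁ w ∧ 2 ≤ interMult f q₂ w}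

/-- `P` contains a lattice translate of `5Δ`. -/
def Contains5Delta (P : Set (ℝ × ℝ)) : Prop :=
  ∃ t : ℤ × ℤ, rpt t +ᵥ ((5 : ℝ) • stdTriangle) ⊆ P

noncomputable section

section Places

variable {L Γ : Type*} [Field L] [Algebra ℂ L] [LinearOrderedCommGroupWithZero Γ]

/-- A valuation on `L` that is trivial on `ℂ` and has residue field `ℂ`. -/
structure IsPlace (v : Valuation L Γ) : Prop where
  const : ∀ c : ℂ, c ≠ 0 → v (algebraMap ℂ L c) = 1
  residue : ∀ z : L, v z ≤ 1 → ∃ c : ℂ, v (z - algebraMap ℂ L c) < 1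

/-- `z` specializes to the complex number `c` at `v`. -/
def Near (v : Valuation L Γ) (z : L) (c : ℂ) : Prop := v (z - algebraMap ℂ L c) < 1

/-- Coefficientwise specialization. -/
def NearP (v : Valuation L Γ) (Φ : Polynomial L) (φ : Polynomial ℂ) : Prop :=
  ∀ n, Near v (Φ.coeff n) (φ.coeff n)

variable {v : Valuation L Γ}

lemma IsPlace.const_le (hv : IsPlace v) (c : ℂ) : v (algebraMap ℂ L c) ≤ 1 := by
  by_cases h : c = 0
  · simp [h]
  · exact (hv.const c h).le

lemma near_const (v : Valuation L Γ) (c : ℂ) : Near v (algebraMap ℂ L c) c := by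
  simp [Near]

lemma near_zero_iff {z : L} : Near v z 0 ↔ v z < 1 := by simp [Near]

lemma Near.le (hv : IsPlace v) {z : L} {c : ℂ} (h : Near v z c) : v z ≤ 1 := by
  have : z = (z - algebraMap ℂ L c) + algebraMap ℂ L c := by ring
  rw [this]
  exact (v.map_add _ _).trans (max_le (le_of_lt h) (hv.const_le c))

lemma Near.add {z w : L} {a b : ℂ} (h : Near v z a) (h' : Near v w b) :
    Near v (z + w) (a + b) := by
  have : z + w - algebraMap ℂ L (a + b)
      = (z - algebraMap ℂ L a) + (w - algebraMap ℂ L b) := by rw [map_add]; ring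
  unfold Near
  rw [this]
  exact (v.map_add _ _).trans_lt (max_lt h h')

lemma Near.mul (hv : IsPlace v) {z w : L} {a b : ℂ} (h : Near v z a) (h' : Near v w b) :
    Near v (z * w) (a * b) := by
  have : z * w - algebraMap ℂ L (a * b)
      = (z - algebraMap ℂ L a) * w + algebraMap ℂ L a * (w - algebraMap ℂ L b) := by
    rw [map_mul]; ring
  unfold Near
  rw [this]
  refine (v.map_add _ _).trans_lt (max_lt ?_ ?_)
  · rw [map_mul]
    exact mul_lt_one_of_lt_of_le h (h'.le hv)
  · rw [map_mul]
    exact mul_lt_one_of_nonneg_of_lt_one_right (hv.const_le a) zero_le h'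

lemma Near.neg {z : L} {a : ℂ} (h : Near v z a) : Near v (-z) (-a) := by
  unfold Near at *
  rwa [map_neg, ← neg_add', Valuation.map_neg, ← sub_eq_add_neg]

lemma Near.sub {z w : L} {a b : ℂ} (h : Near v z a) (h' : Near v w b) :
    Near v (z - w) (a - b) := by
  rw [sub_eq_add_neg, sub_eq_add_neg]; exact h.add h'.neg

lemma Near.pow (hv : IsPlace v) {z : L} {a : ℂ} (h : Near v z a) (n : ℕ) :
    Near v (z ^ n) (a ^ n) := by
  induction n with
  | zero => simpa using near_const v 1
  | succ n ih => rw [pow_succ, pow_succ]; exact ih.mul hv h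

lemma Near.sum {ι : Type*} (s : Finset ι) {z : ι → L} {a : ι → ℂ}
    (h : ∀ i ∈ s, Near v (z i) (a i)) : Near v (∑ i ∈ s, z i) (∑ i ∈ s, a i) := by
  classical
  induction s using Finset.induction_on with
  | empty => simpa using near_const v 0
  | insert i s hi ih =>
    rw [Finset.sum_insert hi, Finset.sum_insert hi]
    exact (h i (by simp)).add (ih fun j hj => h j (by simp [hj]))

lemma Near.unique (hv : IsPlace v) {z : L} {a b : ℂ} (h : Near v z a) (h' : Near v z b) :
    a = b := by
  by_contra hab
  have h1 := h'.sub h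
  rw [sub_self] at h1
  have : v (algebraMap ℂ L (b - a)) < 1 := by
    unfold Near at h1
    rwa [zero_sub, Valuation.map_neg] at h1
  rw [hv.const _ (sub_ne_zero.2 (Ne.symm hab))] at this
  exact lt_irrefl _ this

lemma Near.eq_one (hv : IsPlace v) {z : L} {a : ℂ} (h : Near v z a) (ha : a ≠ 0) : v z = 1 := by
  refine le_antisymm (h.le hv) (not_lt.1 fun hlt => ha ?_)
  exact h.unique hv (near_zero_iff.2 hlt)

lemma Near.lt_one_iff (hv : IsPlace v) {z : L} {a : ℂ} (h : Near v z a) : v z < 1 ↔ a = 0 := by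
  constructor
  · intro hlt; exact h.unique hv (near_zero_iff.2 hlt)
  · rintro rfl; exact near_zero_iff.1 h

/-- The residue of an integral element. -/
def resid (v : Valuation L Γ) (z : L) : ℂ :=
  open Classical in if h : ∃ c : ℂ, Near v z c then h.choose else 0

lemma near_resid (hv : IsPlace v) {z : L} (h : v z ≤ 1) : Near v z (resid v z) := by
  have : ∃ c, Near v z c := hv.residue z h
  unfold resid
  rw [dif_pos this]
  exact Exists.choose_spec this

lemma Near.resid_eq (hv : IsPlace v) {z : L} {c : ℂ} (h : Near v z c) : resid v z = c :=
  (near_resid hv (h.le hv)).unique hv h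

lemma Near.aeval (hv : IsPlace v) {x y : L} {a b : ℂ} (hx : Near v x a) (hy : Near v y b)
    (f : MvPolynomial (Fin 2) ℂ) :
    Near v (MvPolynomial.aeval ![x, y] f) (MvPolynomial.aeval ![a, b] f) := by
  induction f using MvPolynomial.induction_on with
  | C c => simpa [MvPolynomial.algebraMap_eq] using near_const v c
  | add p q hp hq => rw [map_add, map_add]; exact hp.add hq
  | mul_X p i hp =>
    rw [map_mul, map_mul]
    refine hp.mul hv ?_
    fin_cases i
    · simpa using hx
    · simpa using hy

lemma nearP_C {z : L} {c : ℂ} (h : Near v z c) : NearP v (Polynomial.C z) (Polynomial.C c) := by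
  intro n
  rw [Polynomial.coeff_C, Polynomial.coeff_C]
  split_ifs
  · exact h
  · simpa using near_const v 0

lemma nearP_X : NearP v Polynomial.X Polynomial.X := by
  intro n
  rw [Polynomial.coeff_X, Polynomial.coeff_X]
  split_ifs
  · simpa using near_const v 1
  · simpa using near_const v 0

lemma NearP.add {Φ Ψ : Polynomial L} {φ ψ : Polynomial ℂ} (h : NearP v Φ φ) (h' : NearP v Ψ ψ) :
    NearP v (Φ + Ψ) (φ + ψ) := by
  intro n
  rw [Polynomial.coeff_add, Polynomial.coeff_add]
  exact (h n).add (h' n)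

lemma NearP.sub {Φ Ψ : Polynomial L} {φ ψ : Polynomial ℂ} (h : NearP v Φ φ) (h' : NearP v Ψ ψ) :
    NearP v (Φ - Ψ) (φ - ψ) := by
  intro n
  rw [Polynomial.coeff_sub, Polynomial.coeff_sub]
  exact (h n).sub (h' n)

lemma NearP.mul (hv : IsPlace v) {Φ Ψ : Polynomial L} {φ ψ : Polynomial ℂ} (h : NearP v Φ φ)
    (h' : NearP v Ψ ψ) : NearP v (Φ * Ψ) (φ * ψ) := by
  intro n
  rw [Polynomial.coeff_mul, Polynomial.coeff_mul]
  exact Near.sum _ fun i _ => (h _).mul hv (h' _)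

lemma NearP.pow (hv : IsPlace v) {Φ : Polynomial L} {φ : Polynomial ℂ} (h : NearP v Φ φ) (n : ℕ) :
    NearP v (Φ ^ n) (φ ^ n) := by
  induction n with
  | zero => simpa using nearP_C (v := v) (by simpa using near_const v 1 : Near v 1 1)
  | succ n ih => rw [pow_succ, pow_succ]; exact ih.mul hv h

lemma NearP.sum {ι : Type*} (s : Finset ι) {Φ : ι → Polynomial L} {φ : ι → Polynomial ℂ}
    (h : ∀ i ∈ s, NearP v (Φ i) (φ i)) : NearP v (∑ i ∈ s, Φ i) (∑ i ∈ s, φ i) := by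
  intro n
  rw [Polynomial.finsetSum_coeff, Polynomial.finsetSum_coeff]
  exact Near.sum _ fun i hi => h i hi n

lemma NearP.divX {Φ : Polynomial L} {φ : Polynomial ℂ} (h : NearP v Φ φ) :
    NearP v Φ.divX φ.divX := by
  intro n
  rw [Polynomial.coeff_divX, Polynomial.coeff_divX]
  exact h _

lemma NearP.derivative (hv : IsPlace v) {Φ : Polynomial L} {φ : Polynomial ℂ} (h : NearP v Φ φ) :
    NearP v Φ.derivative φ.derivative := by
  intro n
  rw [Polynomial.coeff_derivative, Polynomial.coeff_derivative]
  refine (h _).mul hv ?_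
  simpa using near_const v ((n : ℂ) + 1)

lemma NearP.unique (hv : IsPlace v) {Φ : Polynomial L} {φ ψ : Polynomial ℂ} (h : NearP v Φ φ)
    (h' : NearP v Φ ψ) : φ = ψ := by
  ext n
  exact (h n).unique hv (h' n)

lemma NearP.eval (hv : IsPlace v) {Φ : Polynomial L} {φ : Polynomial ℂ} (h : NearP v Φ φ)
    {z : L} {c : ℂ} (hz : Near v z c) : Near v (Φ.eval z) (φ.eval c) := by
  have hN : ∃ N, Φ.natDegree < N ∧ φ.natDegree < N :=
    ⟨max Φ.natDegree φ.natDegree + 1, by omega, by omega⟩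
  obtain ⟨N, h1, h2⟩ := hN
  rw [Polynomial.eval_eq_sum_range' h1, Polynomial.eval_eq_sum_range' h2]
  exact Near.sum _ fun i _ => (h i).mul hv (hz.pow hv i)

lemma NearP.aeval (hv : IsPlace v) {P Q : Polynomial L} {p q : Polynomial ℂ} (hp : NearP v P p)
    (hq : NearP v Q q) (f : MvPolynomial (Fin 2) ℂ) :
    NearP v (MvPolynomial.aeval ![P, Q] f) (MvPolynomial.aeval ![p, q] f) := by
  induction f using MvPolynomial.induction_on with
  | C c =>
    simp only [MvPolynomial.algHom_C]
    have : algebraMap ℂ (Polynomial L) c = Polynomial.C (algebraMap ℂ L c) := rfl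
    rw [this]
    exact nearP_C (near_const v c)
  | add p q hp hq => rw [map_add, map_add]; exact hp.add hq
  | mul_X p i hp' =>
    rw [map_mul, map_mul]
    refine hp'.mul hv ?_
    fin_cases i
    · simpa using hp
    · simpa using hq

lemma exists_nearP (hv : IsPlace v) {Φ : Polynomial L} (h : ∀ n, v (Φ.coeff n) ≤ 1) :
    ∃ φ, NearP v Φ φ := by
  have h0 : resid v (0 : L) = 0 := Near.resid_eq hv (by simpa using near_const v 0)
  refine ⟨∑ n ∈ Finset.range (Φ.natDegree + 1), Polynomial.monomial n (resid v (Φ.coeff n)), ?_⟩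
  intro n
  have : (∑ k ∈ Finset.range (Φ.natDegree + 1),
      Polynomial.monomial k (resid v (Φ.coeff k))).coeff n = resid v (Φ.coeff n) := by
    rw [Polynomial.finsetSum_coeff]
    simp only [Polynomial.coeff_monomial]
    rw [Finset.sum_ite_eq']
    split_ifs with hn
    · rfl
    · rw [Polynomial.coeff_eq_zero_of_natDegree_lt (by simpa using hn), h0]
  rw [this]
  exact near_resid hv (h n)

/-- Splitting off an integral root. -/
lemma NearP.factor (hv : IsPlace v) {Φ Ψ : Polynomial L} {φ : Polynomial ℂ} (h : NearP v Φ φ)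
    {r : L} {ρ : ℂ} (hr : Near v r ρ) (hΦ : Φ = (Polynomial.X - Polynomial.C r) * Ψ) :
    ∃ ψ, NearP v Ψ ψ ∧ φ = (Polynomial.X - Polynomial.C ρ) * ψ := by
  have hco : ∀ n, Ψ.coeff n = Φ.coeff (n + 1) + r * Ψ.coeff (n + 1) := by
    intro n
    rw [hΦ, sub_mul, Polynomial.coeff_sub, Polynomial.coeff_X_mul, Polynomial.coeff_C_mul]
    ring
  have hbound : ∀ k n, Ψ.natDegree < n + k → v (Ψ.coeff n) ≤ 1 := by
    intro k
    induction k with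
    | zero =>
      intro n hn
      rw [Polynomial.coeff_eq_zero_of_natDegree_lt (by simpa using hn)]
      simp
    | succ k ih =>
      intro n hn
      rw [hco n]
      refine (v.map_add _ _).trans (max_le ((h _).le hv) ?_)
      rw [map_mul]
      exact mul_le_one' (hr.le hv) (ih _ (by omega))
  obtain ⟨ψ, hψ⟩ := exists_nearP hv (Φ := Ψ) fun n => hbound (Ψ.natDegree + 1) n (by omega)
  refine ⟨ψ, hψ, h.unique hv ?_⟩
  rw [hΦ]
  exact (nearP_X.sub (nearP_C hr)).mul hv hψ

/-- Splitting off a non-integral root. -/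
lemma NearP.factor_inv (hv : IsPlace v) {Φ Ψ : Polynomial L} {φ : Polynomial ℂ}
    (h : NearP v Φ φ) {s : L} (hs : v s < 1)
    (hΦ : Φ = (1 - Polynomial.C s * Polynomial.X) * Ψ) : NearP v Ψ φ := by
  have h0 : Ψ.coeff 0 = Φ.coeff 0 := by
    rw [hΦ, sub_mul, Polynomial.coeff_sub, mul_assoc, Polynomial.coeff_C_mul,
      Polynomial.coeff_X_mul_zero]
    simp
  have hco : ∀ n, Ψ.coeff (n + 1) = Φ.coeff (n + 1) + s * Ψ.coeff n := by
    intro n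
    rw [hΦ, sub_mul, Polynomial.coeff_sub, mul_assoc, Polynomial.coeff_C_mul,
      Polynomial.coeff_X_mul]
    simp
  intro n
  induction n with
  | zero => rw [h0]; exact h 0
  | succ n ih =>
    rw [hco, ← add_zero (φ.coeff (n + 1))]
    refine (h _).add (near_zero_iff.2 ?_)
    rw [map_mul]
    exact mul_lt_one_of_lt_of_le hs (ih.le hv)

open Classical in
/-- The roots of the specialization are the specializations of the integral roots. -/
lemma NearP.roots_eq [IsAlgClosed L] (hv : IsPlace v) {Φ : Polynomial L} {φ : Polynomial ℂ}
    (h : NearP v Φ φ) (hφ : φ ≠ 0) :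
    φ.roots = (Φ.roots.filter (fun z => v z ≤ 1)).map (resid v) ∧
    v Φ.leadingCoeff * ((Φ.roots.filter (fun z => ¬ v z ≤ 1)).map v).prod = 1 := by
  induction hn : Φ.natDegree generalizing Φ φ with
  | zero =>
    have hΦ := Polynomial.eq_C_of_natDegree_eq_zero hn
    have hφ' : φ = Polynomial.C (φ.coeff 0) := by
      refine h.unique hv ?_
      nth_rewrite 1 [hΦ]
      exact nearP_C (h 0)
    rw [hΦ, hφ']
    have h0 : φ.coeff 0 ≠ 0 := fun h0 => hφ (by rw [hφ', h0, map_zero])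
    simp [(h 0).eq_one hv h0]
  | succ n ih =>
    have hΦ0 : Φ ≠ 0 := by rintro rfl; simp at hn
    obtain ⟨r, hr⟩ := IsAlgClosed.exists_root Φ (by
      rw [Polynomial.degree_eq_natDegree hΦ0, hn]; exact_mod_cast Nat.succ_ne_zero n)
    obtain ⟨Ψ, hΨ⟩ := Polynomial.dvd_iff_isRoot.2 hr
    have hΨ0 : Ψ ≠ 0 := by rintro rfl; exact hΦ0 (by rw [hΨ, mul_zero])
    have hXr : Polynomial.X - Polynomial.C r ≠ 0 := Polynomial.X_sub_C_ne_zero r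
    have hdeg : Ψ.natDegree = n := by
      rw [hΨ, Polynomial.natDegree_mul hXr hΨ0, Polynomial.natDegree_X_sub_C] at hn
      omega
    have hroots : Φ.roots = r ::ₘ Ψ.roots := by
      rw [hΨ, Polynomial.roots_mul (hΨ ▸ hΦ0), Polynomial.roots_X_sub_C, Multiset.singleton_add]
    have hlc : Φ.leadingCoeff = Ψ.leadingCoeff := by
      rw [hΨ, Polynomial.leadingCoeff_mul, Polynomial.leadingCoeff_X_sub_C, one_mul]
    by_cases hvr : v r ≤ 1
    · obtain ⟨ψ, hψ, hφψ⟩ := h.factor hv (near_resid hv hvr) hΨ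
      have hψ0 : ψ ≠ 0 := by rintro rfl; exact hφ (by rw [hφψ, mul_zero])
      obtain ⟨i1, i2⟩ := ih hψ hψ0 hdeg
      rw [hroots, hlc, Multiset.filter_cons_of_pos (p := fun z => v z ≤ 1) _ hvr,
        Multiset.filter_cons_of_neg (p := fun z => ¬ v z ≤ 1) _ (not_not.2 hvr)]
      refine ⟨?_, i2⟩
      rw [hφψ, Polynomial.roots_mul (hφψ ▸ hφ), Polynomial.roots_X_sub_C, i1,
        Multiset.map_cons, Multiset.singleton_add]
    · have hr0 : r ≠ 0 := by rintro rfl; simp at hvr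
      have hvr' : v r⁻¹ < 1 := by
        rw [map_inv₀]
        exact inv_lt_one_of_one_lt₀ (not_le.1 hvr)
      have hfac : Φ = (1 - Polynomial.C r⁻¹ * Polynomial.X) * (Polynomial.C (-r) * Ψ) := by
        rw [hΨ, sub_mul, sub_mul, one_mul]
        have : Polynomial.C r⁻¹ * Polynomial.X * (Polynomial.C (-r) * Ψ)
          = - (Polynomial.C (r⁻¹ * r) * (Polynomial.X * Ψ)) := by
          rw [Polynomial.C_mul, Polynomial.C_neg]; ring
        rw [this, inv_mul_cancel₀ hr0, Polynomial.C_neg, Polynomial.C_1]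
        ring
      have hn1 := h.factor_inv hv hvr' hfac
      obtain ⟨i1, i2⟩ := ih hn1 hφ (by rw [Polynomial.natDegree_C_mul (neg_ne_zero.2 hr0), hdeg])
      rw [Polynomial.roots_C_mul _ (neg_ne_zero.2 hr0)] at i1 i2
      rw [hroots, Multiset.filter_cons_of_neg (p := fun z => v z ≤ 1) _ hvr,
        Multiset.filter_cons_of_pos (p := fun z => ¬ v z ≤ 1) _ hvr]
      refine ⟨i1, ?_⟩
      rw [Polynomial.leadingCoeff_mul, Polynomial.leadingCoeff_C, map_mul, Valuation.map_neg] at i2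
      rw [Multiset.map_cons, Multiset.prod_cons, hlc, ← mul_assoc,
        mul_comm (v Ψ.leadingCoeff)]
      exact i2

lemma multiset_eq_zero_of_prod_eq_one {α Γ : Type*} [LinearOrderedCommGroupWithZero Γ]
    (s : Multiset α) (g : α → Γ) (hs : ∀ a ∈ s, 1 < g a) (h : (s.map g).prod = 1) : s = 0 := by
  have key : ∀ t : Multiset α, (∀ a ∈ t, 1 < g a) → 1 ≤ (t.map g).prod := by
    intro t
    induction t using Multiset.induction_on with
    | empty => simp
    | cons a t ih =>
      intro ht
      rw [Multiset.map_cons, Multiset.prod_cons]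
      exact one_le_mul (ht a (by simp)).le (ih fun b hb => ht b (by simp [hb]))
  induction s using Multiset.induction_on with
  | empty => rfl
  | cons a t ih =>
    rw [Multiset.map_cons, Multiset.prod_cons] at h
    have h1 := hs a (by simp)
    have h2 := key t fun b hb => hs b (by simp [hb])
    exact absurd h (ne_of_gt (one_lt_mul_of_lt_of_le h1 h2))

open Classical in
lemma NearP.roots_eq_of_lc [IsAlgClosed L] (hv : IsPlace v) {Φ : Polynomial L} {φ : Polynomial ℂ}
    (h : NearP v Φ φ) (hφ : φ ≠ 0) (hlc : v Φ.leadingCoeff = 1) :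
    φ.roots = Φ.roots.map (resid v) ∧ ∀ z ∈ Φ.roots, v z ≤ 1 := by
  obtain ⟨h1, h2⟩ := h.roots_eq hv hφ
  rw [hlc, one_mul] at h2
  have h3 := multiset_eq_zero_of_prod_eq_one _ v
    (fun a ha => not_le.1 (Multiset.mem_filter.1 ha).2) h2
  rw [Multiset.filter_eq_nil] at h3
  have h4 : ∀ z ∈ Φ.roots, v z ≤ 1 := fun z hz => not_not.1 (h3 z hz)
  refine ⟨?_, h4⟩
  rw [h1, Multiset.filter_eq_self.2 h4]

/-- First order Taylor expansion. -/
lemma taylor_near (hv : IsPlace v) {x y : L} {a b : ℂ} (hx : Near v x a) (hy : Near v y b)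
    (g : MvPolynomial (Fin 2) ℂ) : ∃ α β : L,
      MvPolynomial.aeval ![x, y] g = algebraMap ℂ L (MvPolynomial.aeval ![a, b] g)
        + (x - algebraMap ℂ L a) * α + (y - algebraMap ℂ L b) * β ∧
      Near v α (MvPolynomial.aeval ![a, b] (MvPolynomial.pderiv 0 g)) ∧
      Near v β (MvPolynomial.aeval ![a, b] (MvPolynomial.pderiv 1 g)) := by
  induction g using MvPolynomial.induction_on with
  | C c => exact ⟨0, 0, by simp [MvPolynomial.algHom_C], by simpa using near_const v 0,
      by simpa using near_const v 0⟩
  | add p q hp hq =>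
    obtain ⟨α, β, h1, h2, h3⟩ := hp
    obtain ⟨α', β', h1', h2', h3'⟩ := hq
    refine ⟨α + α', β + β', ?_, ?_, ?_⟩
    · rw [map_add, map_add, map_add, h1, h1']; ring
    · rw [map_add, map_add]; exact h2.add h2'
    · rw [map_add, map_add]; exact h3.add h3'
  | mul_X p i hp =>
    obtain ⟨α, β, h1, h2, h3⟩ := hp
    have hpn := Near.aeval hv hx hy p
    set P := MvPolynomial.aeval ![x, y] p with hP
    fin_cases i
    · refine ⟨α * algebraMap ℂ L a + P, β * algebraMap ℂ L a, ?_, ?_, ?_⟩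
      · simp only [map_mul, Fin.zero_eta, MvPolynomial.aeval_X, Matrix.cons_val_zero, ← hP]
        linear_combination (algebraMap ℂ L a) * h1
      · simp only [Fin.zero_eta, Derivation.leibniz, MvPolynomial.pderiv_X_self, smul_eq_mul, mul_one, map_add, map_mul,
          MvPolynomial.aeval_X, Matrix.cons_val_zero]
        rw [add_comm, mul_comm a]
        exact hpn.add (h2.mul hv (near_const v a))
      · simp only [Fin.zero_eta, Derivation.leibniz, MvPolynomial.pderiv_X_of_ne (show (0 : Fin 2) ≠ 1 by decide), smul_eq_mul, mul_zero, map_add, map_mul,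
          MvPolynomial.aeval_X, Matrix.cons_val_zero, zero_add, map_zero]
        rw [mul_comm a]
        exact h3.mul hv (near_const v a)
    · refine ⟨α * algebraMap ℂ L b, β * algebraMap ℂ L b + P, ?_, ?_, ?_⟩
      · simp only [map_mul, Fin.mk_one, MvPolynomial.aeval_X, Matrix.cons_val_one, Matrix.cons_val_fin_one, ← hP]
        linear_combination (algebraMap ℂ L b) * h1
      · simp only [Fin.mk_one, Derivation.leibniz, MvPolynomial.pderiv_X_of_ne (show (1 : Fin 2) ≠ 0 by decide), smul_eq_mul, mul_zero, map_mul,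
          MvPolynomial.aeval_X, Matrix.cons_val_one, Matrix.cons_val_fin_one, zero_add]
        rw [mul_comm b]
        exact h2.mul hv (near_const v b)
      · simp only [Fin.mk_one, Derivation.leibniz, MvPolynomial.pderiv_X_self, smul_eq_mul, mul_one, map_add, map_mul,
          MvPolynomial.aeval_X, Matrix.cons_val_one, Matrix.cons_val_fin_one]
        rw [add_comm, mul_comm b]
        exact hpn.add (h3.mul hv (near_const v b))

/-- Order of vanishing along a smooth branch. -/
lemma firstOrder (hv : IsPlace v) {x y : L} {a b : ℂ} (hx : Near v x a) (hy : Near v y b)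
    {f g : MvPolynomial (Fin 2) ℂ} (hf : MvPolynomial.aeval ![x, y] f = 0)
    (hf0 : MvPolynomial.aeval ![a, b] f = 0) (hg0 : MvPolynomial.aeval ![a, b] g = 0)
    (hfy : MvPolynomial.aeval ![a, b] (MvPolynomial.pderiv 1 f) ≠ 0) :
    v (MvPolynomial.aeval ![x, y] g) ≤ v (x - algebraMap ℂ L a) ∧
    (MvPolynomial.aeval ![a, b] (MvPolynomial.pderiv 0 g) *
        MvPolynomial.aeval ![a, b] (MvPolynomial.pderiv 1 f) -
      MvPolynomial.aeval ![a, b] (MvPolynomial.pderiv 1 g) *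
        MvPolynomial.aeval ![a, b] (MvPolynomial.pderiv 0 f) ≠ 0 →
    v (MvPolynomial.aeval ![x, y] g) = v (x - algebraMap ℂ L a)) := by
  obtain ⟨α, β, h1, h2, h3⟩ := taylor_near hv hx hy f
  obtain ⟨α', β', h1', h2', h3'⟩ := taylor_near hv hx hy g
  rw [hf, hf0, map_zero, zero_add] at h1
  rw [hg0, map_zero, zero_add] at h1'
  have hβ := h3.eq_one hv hfy
  have key : β * MvPolynomial.aeval ![x, y] g
      = (x - algebraMap ℂ L a) * (α' * β - β' * α) := by
    linear_combination β * h1' + (-β') * h1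
  have key2 := congrArg v key
  rw [map_mul, map_mul, hβ, one_mul] at key2
  have hn := (h2'.mul hv h3).sub (h3'.mul hv h2)
  rw [key2]
  refine ⟨mul_le_of_le_one_right' (hn.le hv), fun hne => ?_⟩
  rw [hn.eq_one hv hne, mul_one]

end Places

end

noncomputable section

lemma mvPoly_split_first (P : MvPolynomial (Fin 2) ℂ) : ∃ (Q : MvPolynomial (Fin 2) ℂ)
    (q : Polynomial ℂ), P = MvPolynomial.X 0 * Q + Polynomial.aeval (MvPolynomial.X 1) q := by
  induction P using MvPolynomial.induction_on with
  | C c => exact ⟨0, Polynomial.C c, by simp [MvPolynomial.algebraMap_eq]⟩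
  | add p q hp hq =>
    obtain ⟨Q, r, h⟩ := hp
    obtain ⟨Q', r', h'⟩ := hq
    exact ⟨Q + Q', r + r', by rw [h, h', map_add]; ring⟩
  | mul_X p i hp =>
    obtain ⟨Q, r, h⟩ := hp
    fin_cases i
    · refine ⟨p, 0, ?_⟩
      simp [mul_comm]
    · refine ⟨Q * MvPolynomial.X 1, r * Polynomial.X, ?_⟩
      simp only [Fin.mk_one, map_mul, Polynomial.aeval_X]
      rw [h]; ring

section

variable {L : Type} [Field L] [Algebra ℂ L]

lemma exists_relation {s z : L} (hs : s ≠ 0) (h : ¬ AlgebraicIndependent ℂ ![s, z]) :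
    ∃ (Q : MvPolynomial (Fin 2) ℂ) (q : Polynomial ℂ), q ≠ 0 ∧
      s * MvPolynomial.aeval ![s, z] Q + Polynomial.aeval z q = 0 := by
  have h1 : ∃ P : MvPolynomial (Fin 2) ℂ, P ≠ 0 ∧ MvPolynomial.aeval ![s, z] P = 0 := by
    rw [algebraicIndependent_iff] at h
    push Not at h
    obtain ⟨P, h1, h2⟩ := h
    exact ⟨P, h2, h1⟩
  obtain ⟨P, hP0, hP⟩ := h1
  induction hn : P.totalDegree using Nat.strong_induction_on generalizing P with
  | _ n ih =>
    obtain ⟨Q, q, hPQ⟩ := mvPoly_split_first P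
    have he : s * MvPolynomial.aeval ![s, z] Q + Polynomial.aeval z q = 0 := by
      rw [← hP, hPQ, map_add, map_mul, MvPolynomial.aeval_X, ← Polynomial.aeval_algHom_apply]
      simp
    by_cases hq : q = 0
    · have hQ : P = MvPolynomial.X 0 * Q := by rw [hPQ, hq]; simp
      have hQ0 : Q ≠ 0 := by rintro rfl; exact hP0 (by rw [hQ, mul_zero])
      refine ih Q.totalDegree ?_ Q hQ0 ?_ rfl
      · rw [← hn, hQ, MvPolynomial.totalDegree_mul_of_isDomain (MvPolynomial.X_ne_zero _) hQ0,
          MvPolynomial.totalDegree_X]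
        omega
      · rw [hq, map_zero, add_zero] at he
        exact (mul_eq_zero.1 he).resolve_left hs
    · exact ⟨Q, q, hq, he⟩

lemma valuation_aeval_le {Γ : Type*} [LinearOrderedCommGroupWithZero Γ] {v : Valuation L Γ}
    (hc : ∀ c : ℂ, v (algebraMap ℂ L c) ≤ 1) {x y : L} (hx : v x ≤ 1) (hy : v y ≤ 1)
    (f : MvPolynomial (Fin 2) ℂ) : v (MvPolynomial.aeval ![x, y] f) ≤ 1 := by
  induction f using MvPolynomial.induction_on with
  | C c => rw [MvPolynomial.algHom_C]; exact hc c
  | add p q hp hq => rw [map_add]; exact (v.map_add _ _).trans (max_le hp hq)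
  | mul_X p i hp =>
    rw [map_mul, map_mul]
    refine mul_le_one' hp ?_
    fin_cases i
    · simpa using hx
    · simpa using hy

/-- Existence of places centered at `s = 0`. -/
lemma exists_isPlace (hdep : ∀ s z : L, ¬ AlgebraicIndependent ℂ ![s, z]) {s : L}
    (hs : Transcendental ℂ s) :
    ∃ B : ValuationSubring L, IsPlace B.valuation ∧ B.valuation s < 1 := by
  have hs0 : s ≠ 0 := by rintro rfl; exact hs isAlgebraic_zero
  let A : Subring L := (Polynomial.aeval (R := ℂ) s).range.toSubring
  let s' : A := ⟨s, ⟨Polynomial.X, Polynomial.aeval_X s⟩⟩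
  have hI : Ideal.span {s'} ≠ ⊤ := by
    intro htop
    have h1 : (1 : A) ∈ Ideal.span {s'} := by rw [htop]; trivial
    obtain ⟨a, ha⟩ := Ideal.mem_span_singleton'.1 h1
    obtain ⟨p, hp⟩ := a.2
    have h2 : (a : L) * s = 1 := congrArg Subtype.val ha
    refine hs ⟨p * Polynomial.X - 1, ?_, ?_⟩
    · intro h0
      have := congrArg (Polynomial.eval 0) h0
      simp at this
    · have hp' : Polynomial.aeval s p = (a : L) := hp
      rw [map_sub, map_mul, Polynomial.aeval_X, hp', h2, map_one, sub_self]
  obtain ⟨B, hB1, hB2⟩ := Ideal.image_subset_nonunits_valuationSubring _ hI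
  have hsB : B.valuation s < 1 := by
    rw [← ValuationSubring.mem_nonunits_iff]
    exact hB2 ⟨s', Ideal.mem_span_singleton_self s', rfl⟩
  have hcle : ∀ c : ℂ, B.valuation (algebraMap ℂ L c) ≤ 1 := by
    intro c
    rw [ValuationSubring.valuation_le_one_iff]
    exact hB1 ⟨Polynomial.C c, Polynomial.aeval_C s c⟩
  refine ⟨B, ⟨fun c hc => ?_, fun z hz => ?_⟩, hsB⟩
  · refine le_antisymm (hcle c) ?_
    have h1 := hcle c⁻¹
    rw [map_inv₀, map_inv₀] at h1
    have h0 : B.valuation (algebraMap ℂ L c) ≠ 0 := by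
      rw [Valuation.ne_zero_iff]
      exact (map_ne_zero _).2 hc
    exact (inv_le_one₀ (zero_lt_iff.2 h0)).1 h1
  · obtain ⟨Q, q, hq, hrel⟩ := exists_relation hs0 (hdep s z)
    have hQint : B.valuation (MvPolynomial.aeval ![s, z] Q) ≤ 1 :=
      valuation_aeval_le hcle hsB.le hz Q
    have hqz : B.valuation (Polynomial.aeval z q) < 1 := by
      have : Polynomial.aeval z q = - (s * MvPolynomial.aeval ![s, z] Q) := by
        linear_combination hrel
      rw [this, Valuation.map_neg, map_mul]
      exact mul_lt_one_of_lt_of_le hsB hQint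
    by_contra! hcon
    have hsplit := (IsAlgClosed.splits q).eq_prod_roots
    have hev : Polynomial.aeval z q = algebraMap ℂ L q.leadingCoeff *
        (q.roots.map fun a => z - algebraMap ℂ L a).prod := by
      conv_lhs => rw [hsplit]
      rw [map_mul, Polynomial.aeval_C, map_multiset_prod, Multiset.map_map]
      congr 2
      refine Multiset.map_congr rfl fun a _ => ?_
      simp
    have key : ∀ S : Multiset ℂ,
        1 ≤ B.valuation (S.map fun a => z - algebraMap ℂ L a).prod := by
      intro S
      induction S using Multiset.induction_on with
      | empty => simp
      | cons a S ih =>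
        rw [Multiset.map_cons, Multiset.prod_cons, map_mul]
        exact one_le_mul (hcon a) ih
    rw [hev, map_mul] at hqz
    have hlc : B.valuation (algebraMap ℂ L q.leadingCoeff) = 1 := by
      refine le_antisymm (hcle _) ?_
      have h1 := hcle q.leadingCoeff⁻¹
      rw [map_inv₀, map_inv₀] at h1
      have h0 : B.valuation (algebraMap ℂ L q.leadingCoeff) ≠ 0 := by
        rw [Valuation.ne_zero_iff]
        exact (map_ne_zero _).2 (Polynomial.leadingCoeff_ne_zero.2 hq)
      exact (inv_le_one₀ (zero_lt_iff.2 h0)).1 h1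
    rw [hlc, one_mul] at hqz
    exact absurd hqz (not_lt.2 (key _))

end

/-- The algebraic closure of the rational function field. -/
abbrev FunField : Type := AlgebraicClosure (RatFunc ℂ)

/-- The generator of the rational function field. -/
def genX : FunField := algebraMap (Polynomial ℂ) FunField Polynomial.X

lemma algebraMap_funField_injective :
    Function.Injective (algebraMap (Polynomial ℂ) FunField) := by
  rw [IsScalarTower.algebraMap_eq (Polynomial ℂ) (RatFunc ℂ) FunField]
  exact (algebraMap (RatFunc ℂ) FunField).injective.comp
    (IsFractionRing.injective (Polynomial ℂ) (RatFunc ℂ))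

lemma funField_dep (s z : FunField) : ¬ AlgebraicIndependent ℂ ![s, z] := by
  intro h
  have h1 := h.cardinalMk_le_trdeg
  have : Algebra.IsAlgebraic (Polynomial ℂ) FunField := by
    have : Algebra.IsAlgebraic (Polynomial ℂ) (RatFunc ℂ) := IsLocalization.isAlgebraic _ (nonZeroDivisors (Polynomial ℂ))
    exact Algebra.IsAlgebraic.trans (Polynomial ℂ) (RatFunc ℂ) FunField
  have : FaithfulSMul (Polynomial ℂ) FunField :=
    (faithfulSMul_iff_algebraMap_injective _ _).2 algebraMap_funField_injective
  have h2 := trdeg_add_eq ℂ (Polynomial ℂ) (A := FunField)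
  rw [Polynomial.trdeg_of_isDomain, trdeg_eq_zero, add_zero] at h2
  rw [← h2] at h1
  simp at h1

lemma aeval_genX_injective : Function.Injective (Polynomial.aeval (R := ℂ) genX) := by
  have : (Polynomial.aeval (R := ℂ) genX) = IsScalarTower.toAlgHom ℂ (Polynomial ℂ) FunField := by
    ext
    simp [genX]
  rw [this]
  exact algebraMap_funField_injective

lemma transcendental_genX_sub (a : ℂ) : Transcendental ℂ (genX - algebraMap ℂ FunField a) := by
  have h0 : Transcendental ℂ genX := transcendental_iff_injective.2 aeval_genX_injective
  intro h
  exact h0 (by simpa using h.add (isAlgebraic_algebraMap (A := FunField) a))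

lemma transcendental_genX_inv : Transcendental ℂ (genX⁻¹) := by
  have h0 : Transcendental ℂ genX := transcendental_iff_injective.2 aeval_genX_injective
  intro h
  exact h0 (by simpa using h.inv)

lemma exists_place_at (a : ℂ) : ∃ B : ValuationSubring FunField,
    IsPlace B.valuation ∧ Near B.valuation genX a :=
  exists_isPlace funField_dep (transcendental_genX_sub a)

lemma exists_place_infty : ∃ B : ValuationSubring FunField,
    IsPlace B.valuation ∧ 1 < B.valuation genX := by
  obtain ⟨B, h1, h2⟩ := exists_isPlace funField_dep transcendental_genX_inv
  refine ⟨B, h1, ?_⟩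
  have h0 : genX ≠ 0 := by
    intro h
    apply transcendental_genX_inv
    rw [h, inv_zero]; exact isAlgebraic_zero
  rw [map_inv₀] at h2
  exact (inv_lt_one₀ (zero_lt_iff.2 ((Valuation.ne_zero_iff _).2 h0))).1 h2

end

noncomputable section

/-- Evaluation of a bivariate polynomial over `ℂ` in a commutative `ℂ`-algebra. -/
notation "ev[" x "," y "]" => MvPolynomial.aeval (R := ℂ) ![x, y]

/-- The bivariate polynomial of bidegree `(c, d)` with coefficients `A`. -/
def bi (c d : ℕ) (A : ℕ → ℕ → ℂ) : MvPolynomial (Fin 2) ℂ :=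
  ∑ i ∈ Finset.range (c + 1), ∑ j ∈ Finset.range (d + 1),
    MvPolynomial.C (A i j) * MvPolynomial.X 0 ^ i * MvPolynomial.X 1 ^ j

/-- Restriction of `f` to the line through `(x, y)` with direction `(u, w)`. -/
def lineRes {R : Type*} [CommRing R] [Algebra ℂ R] (f : MvPolynomial (Fin 2) ℂ) (x y u w : R) :
    Polynomial R :=
  ev[Polynomial.C x + Polynomial.C u * Polynomial.X,
    Polynomial.C y + Polynomial.C w * Polynomial.X] f

/-- The numerator of the curvature of `{f = 0}`. -/
def hess (f : MvPolynomial (Fin 2) ℂ) : MvPolynomial (Fin 2) ℂ :=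
  pderiv 0 (pderiv 0 f) * pderiv 1 f ^ 2 - 2 * pderiv 1 (pderiv 0 f) * pderiv 0 f * pderiv 1 f
    + pderiv 1 (pderiv 1 f) * pderiv 0 f ^ 2

section

variable {R S : Type*} [CommRing R] [Algebra ℂ R] [CommRing S] [Algebra ℂ S]

lemma algHom_ev (φ : R →ₐ[ℂ] S) (x y : R) (f : MvPolynomial (Fin 2) ℂ) :
    φ (ev[x, y] f) = ev[φ x, φ y] f := by
  induction f using MvPolynomial.induction_on with
  | C c => simp [MvPolynomial.algHom_C]
  | add p q hp hq => simp only [map_add, hp, hq]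
  | mul_X p i hp =>
    rw [map_mul, map_mul, hp, map_mul]
    fin_cases i <;> simp

lemma ev_X (f : MvPolynomial (Fin 2) ℂ) :
    ev[(MvPolynomial.X 0 : MvPolynomial (Fin 2) ℂ), MvPolynomial.X 1] f = f := by
  have : (![MvPolynomial.X 0, MvPolynomial.X 1] : Fin 2 → MvPolynomial (Fin 2) ℂ)
    = MvPolynomial.X := by
    funext i; fin_cases i <;> rfl
  rw [this, MvPolynomial.aeval_X_left]; rfl

lemma ev_ev (x y : R) (P Q f : MvPolynomial (Fin 2) ℂ) :
    ev[x, y] (ev[P, Q] f) = ev[ev[x, y] P, ev[x, y] Q] f :=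
  algHom_ev _ _ _ _

lemma ev_bi (c d : ℕ) (A : ℕ → ℕ → ℂ) (x y : R) :
    ev[x, y] (bi c d A) = ∑ i ∈ Finset.range (c + 1), ∑ j ∈ Finset.range (d + 1),
      algebraMap ℂ R (A i j) * x ^ i * y ^ j := by
  simp [bi, map_sum, MvPolynomial.algHom_C]

lemma pderiv_bi_zero (c d : ℕ) (A : ℕ → ℕ → ℂ) :
    pderiv 0 (bi c d A) = ∑ i ∈ Finset.range (c + 1), ∑ j ∈ Finset.range (d + 1),
      MvPolynomial.C (A i j) * ((i : MvPolynomial (Fin 2) ℂ) * MvPolynomial.X 0 ^ (i - 1))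
        * MvPolynomial.X 1 ^ j := by
  rw [bi, map_sum]
  refine Finset.sum_congr rfl fun i _ => ?_
  rw [map_sum]
  refine Finset.sum_congr rfl fun j _ => ?_
  simp [Derivation.leibniz, Derivation.leibniz_pow, pderiv_X_of_ne (show (1 : Fin 2) ≠ 0 by decide)]
  ring

lemma pderiv_bi_one (c d : ℕ) (A : ℕ → ℕ → ℂ) :
    pderiv 1 (bi c d A) = ∑ i ∈ Finset.range (c + 1), ∑ j ∈ Finset.range (d + 1),
      MvPolynomial.C (A i j) * MvPolynomial.X 0 ^ i
        * ((j : MvPolynomial (Fin 2) ℂ) * MvPolynomial.X 1 ^ (j - 1)) := by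
  rw [bi, map_sum]
  refine Finset.sum_congr rfl fun i _ => ?_
  rw [map_sum]
  refine Finset.sum_congr rfl fun j _ => ?_
  simp [Derivation.leibniz, Derivation.leibniz_pow, pderiv_X_of_ne (show (0 : Fin 2) ≠ 1 by decide)]

lemma pderiv_comm (f : MvPolynomial (Fin 2) ℂ) :
    pderiv 0 (pderiv 1 f) = pderiv 1 (pderiv 0 f) := by
  have h : ⁅(pderiv 0 : Derivation ℂ (MvPolynomial (Fin 2) ℂ) (MvPolynomial (Fin 2) ℂ)),
      (pderiv 1 : Derivation ℂ (MvPolynomial (Fin 2) ℂ) (MvPolynomial (Fin 2) ℂ))⁆ = 0 := by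
    apply MvPolynomial.derivation_ext
    intro i
    rw [Derivation.commutator_apply]
    fin_cases i <;> simp [pderiv_X_of_ne (show (0 : Fin 2) ≠ 1 by decide),
      pderiv_X_of_ne (show (1 : Fin 2) ≠ 0 by decide)]
  have h2 := congrArg (fun D => D f) h
  simp only [Derivation.commutator_apply, Derivation.coe_zero, Pi.zero_apply] at h2
  exact sub_eq_zero.1 h2

/-- Chain rule for derivations. -/
lemma derivation_ev {R₀ : Type*} [CommRing R₀] [Algebra R₀ R] (D : Derivation R₀ R R)
    (hD : ∀ c : ℂ, D (algebraMap ℂ R c) = 0) (P Q : R)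
    (f : MvPolynomial (Fin 2) ℂ) :
    D (ev[P, Q] f) = ev[P, Q] (pderiv 0 f) * D P + ev[P, Q] (pderiv 1 f) * D Q := by
  induction f using MvPolynomial.induction_on with
  | C c => simp [MvPolynomial.algHom_C, hD]
  | add p q hp hq => simp only [map_add, hp, hq]; ring
  | mul_X p i hp =>
    fin_cases i
    · simp [Derivation.leibniz, hp, pderiv_X_of_ne (show (0 : Fin 2) ≠ 1 by decide)]
      ring
    · simp [Derivation.leibniz, hp, pderiv_X_of_ne (show (1 : Fin 2) ≠ 0 by decide)]
      ring

lemma derivative_ev (P Q : Polynomial R) (f : MvPolynomial (Fin 2) ℂ) :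
    Polynomial.derivative (ev[P, Q] f) = ev[P, Q] (pderiv 0 f) * Polynomial.derivative P
      + ev[P, Q] (pderiv 1 f) * Polynomial.derivative Q := by
  refine derivation_ev Polynomial.derivative' (fun c => ?_) P Q f
  exact Polynomial.derivative_C

lemma pderiv_ev (i : Fin 2) (P Q : MvPolynomial (Fin 2) ℂ) (f : MvPolynomial (Fin 2) ℂ) :
    pderiv i (ev[P, Q] f) = ev[P, Q] (pderiv 0 f) * pderiv i P
      + ev[P, Q] (pderiv 1 f) * pderiv i Q :=
  derivation_ev (pderiv i) (fun c => by simp [MvPolynomial.algebraMap_eq]) P Q f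

lemma lineRes_eval (f : MvPolynomial (Fin 2) ℂ) (x y u w t : R) :
    (lineRes f x y u w).eval t = ev[x + u * t, y + w * t] f := by
  have := algHom_ev ((Polynomial.aeval t : Polynomial R →ₐ[R] R).restrictScalars ℂ)
    (Polynomial.C x + Polynomial.C u * Polynomial.X)
    (Polynomial.C y + Polynomial.C w * Polynomial.X) f
  simpa [lineRes, Polynomial.aeval_def] using this

lemma lineRes_comp (f : MvPolynomial (Fin 2) ℂ) (x y u w r s : R) :
    (lineRes f x y u w).comp (Polynomial.C r + Polynomial.C s * Polynomial.X)
      = lineRes f (x + u * r) (y + w * r) (u * s) (w * s) := by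
  have := algHom_ev ((Polynomial.aeval (Polynomial.C r + Polynomial.C s * Polynomial.X) :
      Polynomial R →ₐ[R] Polynomial R).restrictScalars ℂ)
    (Polynomial.C x + Polynomial.C u * Polynomial.X)
    (Polynomial.C y + Polynomial.C w * Polynomial.X) f
  simp only [AlgHom.restrictScalars_apply, ← Polynomial.comp_eq_aeval] at this
  rw [lineRes, this, lineRes]
  congr 2
  funext i
  fin_cases i
  · simp; ring
  · simp; ring

lemma lineRes_map (φ : R →ₐ[ℂ] S) (f : MvPolynomial (Fin 2) ℂ) (x y u w : R) :
    (lineRes f x y u w).map (φ : R →+* S) = lineRes f (φ x) (φ y) (φ u) (φ w) := by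
  have := algHom_ev (Polynomial.mapAlgHom φ)
    (Polynomial.C x + Polynomial.C u * Polynomial.X)
    (Polynomial.C y + Polynomial.C w * Polynomial.X) f
  simpa [lineRes] using this

lemma lineRes_derivative (f : MvPolynomial (Fin 2) ℂ) (x y u w : R) :
    Polynomial.derivative (lineRes f x y u w) =
      lineRes (pderiv 0 f) x y u w * Polynomial.C u
        + lineRes (pderiv 1 f) x y u w * Polynomial.C w := by
  rw [lineRes, derivative_ev]
  simp [lineRes]

lemma lineRes_coeff_zero (f : MvPolynomial (Fin 2) ℂ) (x y u w : R) :
    (lineRes f x y u w).coeff 0 = ev[x, y] f := by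
  rw [Polynomial.coeff_zero_eq_eval_zero, lineRes_eval]
  simp

lemma lineRes_coeff_one (f : MvPolynomial (Fin 2) ℂ) (x y u w : R) :
    (lineRes f x y u w).coeff 1 = ev[x, y] (pderiv 0 f) * u + ev[x, y] (pderiv 1 f) * w := by
  have h := congrArg (fun P => Polynomial.coeff P 0) (lineRes_derivative f x y u w)
  simpa [Polynomial.coeff_derivative, lineRes_coeff_zero] using h

lemma lineRes_coeff_two (f : MvPolynomial (Fin 2) ℂ) (x y u w : R) :
    2 * (lineRes f x y u w).coeff 2 = ev[x, y] (pderiv 0 (pderiv 0 f)) * u ^ 2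
      + 2 * ev[x, y] (pderiv 1 (pderiv 0 f)) * u * w
      + ev[x, y] (pderiv 1 (pderiv 1 f)) * w ^ 2 := by
  have h := congrArg (fun P => Polynomial.coeff P 1) (lineRes_derivative f x y u w)
  simp only [Polynomial.coeff_derivative, Polynomial.coeff_add, Polynomial.coeff_mul_C,
    lineRes_coeff_one, pderiv_comm] at h
  norm_num at h
  linear_combination h

lemma lineRes_coeff_three (f : MvPolynomial (Fin 2) ℂ) (x y u w : R) :
    6 * (lineRes f x y u w).coeff 3 = ev[x, y] (pderiv 0 (pderiv 0 (pderiv 0 f))) * u ^ 3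
      + 3 * ev[x, y] (pderiv 1 (pderiv 0 (pderiv 0 f))) * u ^ 2 * w
      + 3 * ev[x, y] (pderiv 1 (pderiv 1 (pderiv 0 f))) * u * w ^ 2
      + ev[x, y] (pderiv 1 (pderiv 1 (pderiv 1 f))) * w ^ 3 := by
  have h := congrArg (fun P => Polynomial.coeff P 2) (lineRes_derivative f x y u w)
  have h1 := lineRes_coeff_two (pderiv 0 f) x y u w
  have h2 := lineRes_coeff_two (pderiv 1 f) x y u w
  simp only [Polynomial.coeff_derivative, Polynomial.coeff_add, Polynomial.coeff_mul_C,
    pderiv_comm] at h h2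
  norm_num at h
  linear_combination 2 * h + u * h1 + w * h2

/-- The derivative of the curvature along the tangent direction. -/
lemma hess_jacobian (f : MvPolynomial (Fin 2) ℂ) (x y : R) :
    ev[x, y] (pderiv 0 (hess f)) * ev[x, y] (pderiv 1 f)
      - ev[x, y] (pderiv 1 (hess f)) * ev[x, y] (pderiv 0 f)
    = 6 * (lineRes f x y (ev[x, y] (pderiv 1 f)) (- ev[x, y] (pderiv 0 f))).coeff 3 := by
  rw [lineRes_coeff_three, hess]
  simp only [map_add, map_sub, Derivation.leibniz, Derivation.leibniz_pow, smul_eq_mul, map_mul,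
    map_pow, pderiv_comm, nsmul_eq_mul]
  have h2 : ∀ i : Fin 2, pderiv i (2 : MvPolynomial (Fin 2) ℂ) = 0 := fun i => by
    exact_mod_cast Derivation.map_natCast (pderiv i) 2
  simp [h2, map_ofNat]
  ring

lemma ev_hess (f : MvPolynomial (Fin 2) ℂ) (x y : R) :
    ev[x, y] (hess f) =
      2 * (lineRes f x y (ev[x, y] (pderiv 1 f)) (- ev[x, y] (pderiv 0 f))).coeff 2 := by
  rw [lineRes_coeff_two, hess]
  simp only [map_add, map_sub, map_mul, map_pow, map_ofNat]
  ring

lemma lineRes_bi (c d : ℕ) (A : ℕ → ℕ → ℂ) (x y u w : R) :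
    lineRes (bi c d A) x y u w = ∑ i ∈ Finset.range (c + 1), ∑ j ∈ Finset.range (d + 1),
      Polynomial.C (algebraMap ℂ R (A i j)) * (Polynomial.C x + Polynomial.C u * Polynomial.X) ^ i
        * (Polynomial.C y + Polynomial.C w * Polynomial.X) ^ j := by
  rw [lineRes, ev_bi]
  rfl

omit [Algebra ℂ R] in
lemma natDegree_linear_pow_le (x u : R) (i : ℕ) :
    ((Polynomial.C x + Polynomial.C u * Polynomial.X) ^ i).natDegree ≤ i := by
  refine Polynomial.natDegree_pow_le.trans ?_
  have : (Polynomial.C x + Polynomial.C u * Polynomial.X).natDegree ≤ 1 := by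
    rw [add_comm]; exact Polynomial.natDegree_linear_le
  nlinarith

omit [Algebra ℂ R] in
lemma coeff_linear_pow (x u : R) (i : ℕ) :
    ((Polynomial.C x + Polynomial.C u * Polynomial.X) ^ i).coeff i = u ^ i := by
  have : (Polynomial.C x + Polynomial.C u * Polynomial.X).natDegree ≤ 1 := by
    rw [add_comm]; exact Polynomial.natDegree_linear_le
  have h := Polynomial.coeff_pow_of_natDegree_le (m := i) this
  rw [mul_one] at h
  rw [h]
  simp

lemma lineRes_bi_natDegree_le (c d : ℕ) (A : ℕ → ℕ → ℂ) (x y u w : R) :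
    (lineRes (bi c d A) x y u w).natDegree ≤ c + d := by
  rw [lineRes_bi]
  refine Polynomial.natDegree_sum_le_of_forall_le _ _ fun i hi => ?_
  refine Polynomial.natDegree_sum_le_of_forall_le _ _ fun j hj => ?_
  rw [Finset.mem_range] at hi hj
  refine (Polynomial.natDegree_mul_le).trans ?_
  have h1 := Polynomial.natDegree_C_mul_le (algebraMap ℂ R (A i j))
    ((Polynomial.C x + Polynomial.C u * Polynomial.X) ^ i)
  have h2 := natDegree_linear_pow_le x u i
  have h3 := natDegree_linear_pow_le y w j
  omega

lemma lineRes_bi_coeff_top (c d : ℕ) (A : ℕ → ℕ → ℂ) (x y u w : R) :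
    (lineRes (bi c d A) x y u w).coeff (c + d) = algebraMap ℂ R (A c d) * u ^ c * w ^ d := by
  rw [lineRes_bi, Polynomial.finsetSum_coeff, Finset.sum_eq_single c]
  · rw [Polynomial.finsetSum_coeff, Finset.sum_eq_single d]
    · rw [Polynomial.coeff_mul_add_eq_of_natDegree_le
        ((Polynomial.natDegree_C_mul_le _ _).trans (natDegree_linear_pow_le x u c))
        (natDegree_linear_pow_le y w d), Polynomial.coeff_C_mul, coeff_linear_pow,
        coeff_linear_pow]
    · intro j hj hne
      rw [Finset.mem_range] at hj
      refine Polynomial.coeff_eq_zero_of_natDegree_lt ?_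
      refine (Polynomial.natDegree_mul_le).trans_lt ?_
      have h1 := Polynomial.natDegree_C_mul_le (algebraMap ℂ R (A c j))
        ((Polynomial.C x + Polynomial.C u * Polynomial.X) ^ c)
      have h2 := natDegree_linear_pow_le x u c
      have h3 := natDegree_linear_pow_le y w j
      omega
    · simp
  · intro i hi hne
    rw [Finset.mem_range] at hi
    rw [Polynomial.finsetSum_coeff]
    refine Finset.sum_eq_zero fun j hj => ?_
    rw [Finset.mem_range] at hj
    refine Polynomial.coeff_eq_zero_of_natDegree_lt ?_
    refine (Polynomial.natDegree_mul_le).trans_lt ?_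
    have h1 := Polynomial.natDegree_C_mul_le (algebraMap ℂ R (A i j))
      ((Polynomial.C x + Polynomial.C u * Polynomial.X) ^ i)
    have h2 := natDegree_linear_pow_le x u i
    have h3 := natDegree_linear_pow_le y w j
    omega
  · simp

end

end

noncomputable section

/-- A product of powers of three linear factors. -/
def trip (r s t : ℂ) (i j k : ℕ) : Polynomial ℂ :=
  (Polynomial.X - Polynomial.C r) ^ i * (Polynomial.X - Polynomial.C s) ^ j *
    (Polynomial.X - Polynomial.C t) ^ k

/-- The genericity conditions attached to the lines `y = b + m x` and the point `x = ∞`. -/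
structure HalfGood (c d : ℕ) (A : ℕ → ℕ → ℂ) : Prop where
  top : A c d ≠ 0
  smooth : ∀ a b : ℂ, ev[a, b] (bi c d A) = 0 → ev[a, b] (pderiv 0 (bi c d A)) = 0 →
    ev[a, b] (pderiv 1 (bi c d A)) ≠ 0
  line4 : ∀ m b r : ℂ, ¬ trip r r r 4 0 0 ∣ lineRes (bi c d A) 0 b 1 m
  line32 : ∀ m b r s : ℂ, ¬ trip r s s 3 2 0 ∣ lineRes (bi c d A) 0 b 1 m
  line222 : ∀ m b r s t : ℂ, ¬ trip r s t 2 2 2 ∣ lineRes (bi c d A) 0 b 1 m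
  hor3 : ∀ b r : ℂ, ¬ trip r r r 3 0 0 ∣ lineRes (bi c d A) 0 b 1 0
  hor22 : ∀ b r s : ℂ, ¬ trip r s s 2 2 0 ∣ lineRes (bi c d A) 0 b 1 0
  axis3 : ∀ m b : ℂ, ¬ trip 0 0 0 3 0 0 ∣ lineRes (bi c d A) 0 b 1 m
  axis22 : ∀ m b r : ℂ, ¬ trip 0 r r 2 2 0 ∣ lineRes (bi c d A) 0 b 1 m
  edge_next : ∀ b : ℂ, ∑ j ∈ Finset.range (d + 1), A c j * b ^ j = 0 →
    ∑ j ∈ Finset.range (d + 1), A (c - 1) j * b ^ j ≠ 0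
  edge_simple : ∀ b : ℂ, ∑ j ∈ Finset.range (d + 1), A c j * b ^ j = 0 →
    ∑ j ∈ Finset.range (d + 1), A c j * (j * b ^ (j - 1)) ≠ 0
  edge_hor : ∀ a b : ℂ, ∑ j ∈ Finset.range (d + 1), A c j * b ^ j = 0 →
    ev[a, b] (bi c d A) = 0 → ev[a, b] (pderiv 0 (bi c d A)) ≠ 0

/-- The transposed coefficient array. -/
def tr (A : ℕ → ℕ → ℂ) : ℕ → ℕ → ℂ := fun i j => A j i

/-- Genericity conditions on a bivariate polynomial of bidegree `(c, d)`. -/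
structure Good (c d : ℕ) (A : ℕ → ℕ → ℂ) : Prop where
  left : HalfGood c d A
  right : HalfGood d c (tr A)

lemma Good.swap {c d : ℕ} {A : ℕ → ℕ → ℂ} (h : Good c d A) : Good d c (tr A) := ⟨h.right, h.left⟩

section

variable {R : Type*} [CommRing R] [Algebra ℂ R]

lemma bi_tr (c d : ℕ) (A : ℕ → ℕ → ℂ) (x y : R) :
    ev[x, y] (bi d c (tr A)) = ev[y, x] (bi c d A) := by
  rw [ev_bi, ev_bi, Finset.sum_comm]
  refine Finset.sum_congr rfl fun i _ => Finset.sum_congr rfl fun j _ => ?_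
  simp only [tr]; ring

lemma bi_tr_eq (c d : ℕ) (A : ℕ → ℕ → ℂ) :
    bi d c (tr A) = ev[(MvPolynomial.X 1 : MvPolynomial (Fin 2) ℂ), MvPolynomial.X 0] (bi c d A) := by
  rw [← bi_tr, ev_X]

lemma ev_swap_pderiv_zero (f : MvPolynomial (Fin 2) ℂ) :
    pderiv 0 (ev[(MvPolynomial.X 1 : MvPolynomial (Fin 2) ℂ), MvPolynomial.X 0] f)
      = ev[(MvPolynomial.X 1 : MvPolynomial (Fin 2) ℂ), MvPolynomial.X 0] (pderiv 1 f) := by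
  rw [pderiv_ev]
  simp [pderiv_X_of_ne (show (1 : Fin 2) ≠ 0 by decide)]

lemma ev_swap_pderiv_one (f : MvPolynomial (Fin 2) ℂ) :
    pderiv 1 (ev[(MvPolynomial.X 1 : MvPolynomial (Fin 2) ℂ), MvPolynomial.X 0] f)
      = ev[(MvPolynomial.X 1 : MvPolynomial (Fin 2) ℂ), MvPolynomial.X 0] (pderiv 0 f) := by
  rw [pderiv_ev]
  simp [pderiv_X_of_ne (show (0 : Fin 2) ≠ 1 by decide)]

lemma ev_ev_swap (f : MvPolynomial (Fin 2) ℂ) (x y : R) :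
    ev[x, y] (ev[(MvPolynomial.X 1 : MvPolynomial (Fin 2) ℂ), MvPolynomial.X 0] f)
      = ev[y, x] f := by
  rw [ev_ev]; simp

lemma bi_tr_pderiv_zero (c d : ℕ) (A : ℕ → ℕ → ℂ) (x y : R) :
    ev[x, y] (pderiv 0 (bi d c (tr A))) = ev[y, x] (pderiv 1 (bi c d A)) := by
  rw [bi_tr_eq, ev_swap_pderiv_zero, ev_ev_swap]

lemma bi_tr_pderiv_one (c d : ℕ) (A : ℕ → ℕ → ℂ) (x y : R) :
    ev[x, y] (pderiv 1 (bi d c (tr A))) = ev[y, x] (pderiv 0 (bi c d A)) := by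
  rw [bi_tr_eq, ev_swap_pderiv_one, ev_ev_swap]

lemma bi_tr_hess (c d : ℕ) (A : ℕ → ℕ → ℂ) (x y : R) :
    ev[x, y] (hess (bi d c (tr A))) = ev[y, x] (hess (bi c d A)) := by
  rw [bi_tr_eq]
  simp only [hess, ev_swap_pderiv_one, ev_swap_pderiv_zero, map_add, map_sub, map_mul, map_pow,
    ev_ev_swap, map_ofNat, pderiv_comm]
  ring

lemma lineRes_tr (c d : ℕ) (A : ℕ → ℕ → ℂ) (x y u w : R) :
    lineRes (bi d c (tr A)) x y u w = lineRes (bi c d A) y x w u :=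
  bi_tr c d A _ _

end

lemma dvd_lineRes_shift (f : MvPolynomial (Fin 2) ℂ) {a b u w r s t : ℂ} {i j k : ℕ} (hu : u ≠ 0)
    (h : trip r s t i j k ∣ lineRes f a b u w) :
    trip (a + u * r) (a + u * s) (a + u * t) i j k
      ∣ lineRes f 0 (b - a * (w / u)) 1 (w / u) := by
  have hcomp : (lineRes f a b u w).comp
      (Polynomial.C (-a / u) + Polynomial.C (1 / u) * Polynomial.X)
      = lineRes f 0 (b - a * (w / u)) 1 (w / u) := by
    rw [lineRes_comp]
    congr 1 <;> field_simp <;> ring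
  rw [← hcomp]
  have h1 := map_dvd (Polynomial.compRingHom
    (Polynomial.C (-a / u) + Polynomial.C (1 / u) * Polynomial.X)) h
  rw [Polynomial.coe_compRingHom_apply, Polynomial.coe_compRingHom_apply] at h1
  refine dvd_trans ?_ h1
  have hlin : ∀ z : ℂ, (Polynomial.X - Polynomial.C z).comp
      (Polynomial.C (-a / u) + Polynomial.C (1 / u) * Polynomial.X)
      = Polynomial.C (1 / u) * (Polynomial.X - Polynomial.C (a + u * z)) := by
    intro z
    rw [Polynomial.sub_comp, Polynomial.X_comp, Polynomial.C_comp, mul_sub, ← Polynomial.C_mul]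
    have : (1 / u) * (a + u * z) = z - (-a / u) := by field_simp; ring
    rw [this, Polynomial.C_sub]; ring
  have hlin' : ∀ z : ℂ, ∀ i : ℕ, (Polynomial.X - Polynomial.C (a + u * z)) ^ i ∣
      ((Polynomial.X - Polynomial.C z) ^ i).comp
      (Polynomial.C (-a / u) + Polynomial.C (1 / u) * Polynomial.X) := by
    intro z i
    rw [Polynomial.pow_comp, hlin]
    exact pow_dvd_pow_of_dvd (Dvd.intro_left _ rfl) _
  unfold trip
  rw [Polynomial.mul_comp, Polynomial.mul_comp]
  exact mul_dvd_mul (mul_dvd_mul (hlin' _ _) (hlin' _ _)) (hlin' _ _)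

namespace Good

variable {c d : ℕ} {A : ℕ → ℕ → ℂ}

/-- Lines which are not vertical or not horizontal reduce to the normal form after a swap. -/
lemma line_cases (h : Good c d A) {a b u w : ℂ}
    (huw : u ≠ 0 ∨ w ≠ 0) {r s t : ℂ} {i j k : ℕ}
    (hQ : ∀ c d A, HalfGood c d A → ∀ m b r' s' t',
      (r = s → r' = s') → (s = t → s' = t') →
      ¬ trip r' s' t' i j k ∣ lineRes (bi c d A) 0 b 1 m) :
    ¬ trip r s t i j k ∣ lineRes (bi c d A) a b u w := by
  intro hdvd
  by_cases hu : u = 0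
  · have hw := huw.resolve_left (not_not.2 hu)
    rw [← lineRes_tr] at hdvd
    exact hQ _ _ _ h.right _ _ _ _ _ (by rintro rfl; rfl) (by rintro rfl; rfl)
      (dvd_lineRes_shift _ hw hdvd)
  · exact hQ _ _ _ h.left _ _ _ _ _ (by rintro rfl; rfl) (by rintro rfl; rfl)
      (dvd_lineRes_shift _ hu hdvd)

lemma line4 (h : Good c d A) {a b u w : ℂ} (huw : u ≠ 0 ∨ w ≠ 0) (r : ℂ) :
    ¬ trip r r r 4 0 0 ∣ lineRes (bi c d A) a b u w :=
  h.line_cases huw fun c d A hA m b r' s' t' h1 h2 => by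
    rw [← h2 rfl, ← h1 rfl]; exact hA.line4 _ _ _

lemma line32 (h : Good c d A) {a b u w : ℂ} (huw : u ≠ 0 ∨ w ≠ 0) (r s : ℂ) :
    ¬ trip r s s 3 2 0 ∣ lineRes (bi c d A) a b u w :=
  h.line_cases huw fun c d A hA m b r' s' t' h1 h2 => by
    rw [← h2 rfl]; exact hA.line32 _ _ _ _

lemma line222 (h : Good c d A) {a b u w : ℂ} (huw : u ≠ 0 ∨ w ≠ 0) (r s t : ℂ) :
    ¬ trip r s t 2 2 2 ∣ lineRes (bi c d A) a b u w :=
  h.line_cases huw fun c d A hA m b r' s' t' h1 h2 =>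
    hA.line222 _ _ _ _ _

lemma hor3 (h : Good c d A) {a b u : ℂ} (hu : u ≠ 0) (r : ℂ) :
    ¬ trip r r r 3 0 0 ∣ lineRes (bi c d A) a b u 0 := by
  intro hd
  have := dvd_lineRes_shift _ hu hd
  rw [zero_div] at this
  exact h.left.hor3 _ _ this

lemma hor22 (h : Good c d A) {a b u : ℂ} (hu : u ≠ 0) (r s : ℂ) :
    ¬ trip r s s 2 2 0 ∣ lineRes (bi c d A) a b u 0 := by
  intro hd
  have := dvd_lineRes_shift _ hu hd
  rw [zero_div] at this
  exact h.left.hor22 _ _ _ this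

lemma vert3 (h : Good c d A) {a b w : ℂ} (hw : w ≠ 0) (r : ℂ) :
    ¬ trip r r r 3 0 0 ∣ lineRes (bi c d A) a b 0 w := by
  rw [← lineRes_tr]; exact h.swap.hor3 hw r

lemma vert22 (h : Good c d A) {a b w : ℂ} (hw : w ≠ 0) (r s : ℂ) :
    ¬ trip r s s 2 2 0 ∣ lineRes (bi c d A) a b 0 w := by
  rw [← lineRes_tr]; exact h.swap.hor22 hw r s

lemma axis3 (h : Good c d A) {b u w : ℂ} (hu : u ≠ 0) :
    ¬ trip 0 0 0 3 0 0 ∣ lineRes (bi c d A) 0 b u w := by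
  intro hd
  have := dvd_lineRes_shift _ hu hd
  rw [mul_zero, add_zero] at this
  exact h.left.axis3 _ _ this

lemma axis22 (h : Good c d A) {b u w : ℂ} (hu : u ≠ 0) (r : ℂ) :
    ¬ trip 0 r r 2 2 0 ∣ lineRes (bi c d A) 0 b u w := by
  intro hd
  have := dvd_lineRes_shift _ hu hd
  rw [mul_zero, add_zero] at this
  exact h.left.axis22 _ _ _ this

lemma grad_ne (h : Good c d A) {a b : ℂ} (hf : ev[a, b] (bi c d A) = 0) :
    ev[a, b] (pderiv 1 (bi c d A)) ≠ 0 ∨ - ev[a, b] (pderiv 0 (bi c d A)) ≠ 0 := by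
  by_cases h0 : ev[a, b] (pderiv 0 (bi c d A)) = 0
  · exact Or.inl (h.left.smooth a b hf h0)
  · exact Or.inr (neg_ne_zero.2 h0)

end Good

lemma X_pow_two_dvd_iff {K : Type*} [Field K] (P : Polynomial K) :
    Polynomial.X ^ 2 ∣ P ↔ P.coeff 0 = 0 ∧ P.coeff 1 = 0 := by
  rw [Polynomial.X_pow_dvd_iff]
  constructor
  · intro h; exact ⟨h 0 (by norm_num), h 1 (by norm_num)⟩
  · rintro ⟨h0, h1⟩ k hk
    interval_cases k <;> assumption

lemma X_pow_three_dvd_iff {K : Type*} [Field K] (P : Polynomial K) :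
    Polynomial.X ^ 3 ∣ P ↔ P.coeff 0 = 0 ∧ P.coeff 1 = 0 ∧ P.coeff 2 = 0 := by
  rw [Polynomial.X_pow_dvd_iff]
  constructor
  · intro h; exact ⟨h 0 (by norm_num), h 1 (by norm_num), h 2 (by norm_num)⟩
  · rintro ⟨h0, h1, h2⟩ k hk
    interval_cases k <;> assumption

lemma sq_dvd_of_roots {K : Type*} [Field K] [CharZero K] {P : Polynomial K} {t : K}
    (h0 : P.eval t = 0) (h1 : P.derivative.eval t = 0) :
    (Polynomial.X - Polynomial.C t) ^ 2 ∣ P := by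
  by_cases hP : P = 0
  · simp [hP]
  · rw [← Polynomial.le_rootMultiplicity_iff hP]
    exact (Polynomial.one_lt_rootMultiplicity_iff_isRoot hP).2 ⟨h0, h1⟩

lemma cube_dvd_of_roots {K : Type*} [Field K] [CharZero K] {P : Polynomial K} {t : K}
    (h0 : P.eval t = 0) (h1 : P.derivative.eval t = 0) (h2 : P.derivative.derivative.eval t = 0) :
    (Polynomial.X - Polynomial.C t) ^ 3 ∣ P := by
  by_cases hP : P = 0
  · simp [hP]
  · rw [← Polynomial.le_rootMultiplicity_iff hP]
    refine (Polynomial.lt_rootMultiplicity_iff_isRoot_iterate_derivative hP).2 fun m hm => ?_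
    interval_cases m
    · exact h0
    · exact h1
    · exact h2

/-- Restriction to the tangent line at `(x, y)`. -/
def tanRes {R : Type*} [CommRing R] [Algebra ℂ R] (f : MvPolynomial (Fin 2) ℂ) (x y : R) :
    Polynomial R :=
  lineRes f x y (ev[x, y] (pderiv 1 f)) (- ev[x, y] (pderiv 0 f))

/-- The residual polynomial on the tangent line. -/
def tanResid {R : Type*} [CommRing R] [Algebra ℂ R] (f : MvPolynomial (Fin 2) ℂ) (x y : R) :
    Polynomial R :=
  (tanRes f x y).divX.divX

/-- The discriminant of the residual polynomial on the tangent line. -/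
def bitDisc (n : ℕ) (f : MvPolynomial (Fin 2) ℂ) : MvPolynomial (Fin 2) ℂ :=
  Polynomial.resultant (tanResid f (MvPolynomial.X 0 : MvPolynomial (Fin 2) ℂ) (MvPolynomial.X 1))
    (tanResid f (MvPolynomial.X 0 : MvPolynomial (Fin 2) ℂ) (MvPolynomial.X 1)).derivative
    (n - 2) (n - 2 - 1)

section

variable {R : Type*} [CommRing R] [Algebra ℂ R]

omit [Algebra ℂ R] in
lemma divX_map {S : Type*} [CommRing S] (φ : R →+* S) (P : Polynomial R) :
    P.divX.map φ = (P.map φ).divX := by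
  ext n; simp [Polynomial.coeff_divX]

lemma tanResid_map (f : MvPolynomial (Fin 2) ℂ) (x y : R) :
    (tanResid f (MvPolynomial.X 0 : MvPolynomial (Fin 2) ℂ) (MvPolynomial.X 1)).map
      (ev[x, y] : MvPolynomial (Fin 2) ℂ →+* R) = tanResid f x y := by
  rw [tanResid, divX_map, divX_map, tanRes, lineRes_map, tanResid, tanRes, ev_X, ev_X]
  simp

lemma ev_bitDisc (n : ℕ) (f : MvPolynomial (Fin 2) ℂ) (x y : R) :
    ev[x, y] (bitDisc n f) = Polynomial.resultant (tanResid f x y) (tanResid f x y).derivative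
      (n - 2) (n - 2 - 1) := by
  have := Polynomial.resultant_map_map
    (tanResid f (MvPolynomial.X 0 : MvPolynomial (Fin 2) ℂ) (MvPolynomial.X 1))
    (tanResid f (MvPolynomial.X 0 : MvPolynomial (Fin 2) ℂ) (MvPolynomial.X 1)).derivative
    (n - 2) (n - 2 - 1) (ev[x, y] : MvPolynomial (Fin 2) ℂ →+* R)
  rw [bitDisc]
  rw [← Polynomial.derivative_map, tanResid_map] at this
  exact this.symm

lemma tanRes_coeff_zero (f : MvPolynomial (Fin 2) ℂ) (x y : R) :
    (tanRes f x y).coeff 0 = ev[x, y] f := lineRes_coeff_zero _ _ _ _ _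

lemma tanRes_coeff_one (f : MvPolynomial (Fin 2) ℂ) (x y : R) :
    (tanRes f x y).coeff 1 = 0 := by
  rw [tanRes, lineRes_coeff_one]; ring

lemma tanRes_eq (f : MvPolynomial (Fin 2) ℂ) {x y : R} (h : ev[x, y] f = 0) :
    tanRes f x y = Polynomial.X ^ 2 * tanResid f x y := by
  have h1 := Polynomial.divX_mul_X_add (tanRes f x y)
  have h2 := Polynomial.divX_mul_X_add (tanRes f x y).divX
  rw [tanRes_coeff_zero, h, map_zero, add_zero] at h1
  rw [Polynomial.coeff_divX, tanRes_coeff_one, map_zero, add_zero] at h2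
  rw [tanResid]
  conv_lhs => rw [← h1, ← h2]
  ring

lemma tanResid_natDegree_le (c d : ℕ) (A : ℕ → ℕ → ℂ) (x y : R) :
    (tanResid (bi c d A) x y).natDegree ≤ c + d - 2 := by
  rw [tanResid, Polynomial.natDegree_divX_eq_natDegree_tsub_one,
    Polynomial.natDegree_divX_eq_natDegree_tsub_one]
  have := lineRes_bi_natDegree_le c d A x y (ev[x, y] (pderiv 1 (bi c d A)))
    (- ev[x, y] (pderiv 0 (bi c d A)))
  rw [tanRes]
  omega

lemma tanResid_coeff_top {c d : ℕ} (hcd : 2 ≤ c + d) (A : ℕ → ℕ → ℂ) (x y : R) :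
    (tanResid (bi c d A) x y).coeff (c + d - 2) = algebraMap ℂ R (A c d) *
      ev[x, y] (pderiv 1 (bi c d A)) ^ c * (- ev[x, y] (pderiv 0 (bi c d A))) ^ d := by
  rw [tanResid, Polynomial.coeff_divX, Polynomial.coeff_divX, ← lineRes_bi_coeff_top]
  congr 1
  omega

end

end

noncomputable section

/-- Reversal of the first index. -/
def rev (c : ℕ) (A : ℕ → ℕ → ℂ) : ℕ → ℕ → ℂ := fun i j => A (c - i) j

/-- Coefficients of the derivative with respect to the second variable. -/
def dY (d : ℕ) (A : ℕ → ℕ → ℂ) : ℕ → ℕ → ℂ :=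
  fun i j => if j < d then A i (j + 1) * (j + 1) else 0

lemma pderiv_one_bi (c d : ℕ) (A : ℕ → ℕ → ℂ) : pderiv 1 (bi c d A) = bi c d (dY d A) := by
  rw [pderiv_bi_one, bi]
  refine Finset.sum_congr rfl fun i _ => ?_
  rw [Finset.sum_range_succ', Finset.sum_range_succ _ d]
  simp only [dY, lt_irrefl, if_false, map_zero, zero_mul, add_zero, Nat.cast_zero, mul_zero]
  refine Finset.sum_congr rfl fun j hj => ?_
  rw [if_pos (Finset.mem_range.1 hj)]
  simp; ring

lemma X_mul_pderiv_zero_bi (c d : ℕ) (A : ℕ → ℕ → ℂ) :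
    MvPolynomial.X 0 * pderiv 0 (bi c d A) = bi c d (fun i j => A i j * i) := by
  rw [pderiv_bi_zero, bi, Finset.mul_sum]
  refine Finset.sum_congr rfl fun i _ => ?_
  rw [Finset.mul_sum]
  refine Finset.sum_congr rfl fun j _ => ?_
  rcases i with _ | i
  · simp
  · simp; ring

lemma bi_add (c d : ℕ) (A B : ℕ → ℕ → ℂ) :
    bi c d (fun i j => A i j + B i j) = bi c d A + bi c d B := by
  simp only [bi, map_add, add_mul, Finset.sum_add_distrib]

lemma bi_congr {c d : ℕ} {A B : ℕ → ℕ → ℂ} (h : ∀ i ≤ c, ∀ j ≤ d, A i j = B i j) :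
    bi c d A = bi c d B := by
  refine Finset.sum_congr rfl fun i hi => Finset.sum_congr rfl fun j hj => ?_
  rw [h i (by simpa [Nat.lt_succ_iff] using hi) j (by simpa [Nat.lt_succ_iff] using hj)]

lemma bi_smul (c d : ℕ) (A : ℕ → ℕ → ℂ) (r : ℂ) :
    bi c d (fun i j => r * A i j) = MvPolynomial.C r * bi c d A := by
  simp only [bi, map_mul, Finset.mul_sum]
  refine Finset.sum_congr rfl fun i hi => Finset.sum_congr rfl fun j hj => ?_
  ring

lemma rev_euler (c d : ℕ) (A : ℕ → ℕ → ℂ) :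
    bi c d (rev c (fun i j => A i j * i))
      = (c : MvPolynomial (Fin 2) ℂ) * bi c d (rev c A)
        - MvPolynomial.X 0 * pderiv 0 (bi c d (rev c A)) := by
  rw [X_mul_pderiv_zero_bi, eq_sub_iff_add_eq, ← bi_add, ← map_natCast MvPolynomial.C, ← bi_smul]
  refine bi_congr fun i hi j _ => ?_
  simp only [rev]
  rw [Nat.cast_sub hi]; ring

section

variable {L : Type*} [Field L] [Algebra ℂ L]

lemma ev_rev (c d : ℕ) (A : ℕ → ℕ → ℂ) {x s : L} (y : L) (h : x * s = 1) :
    ev[x, y] (bi c d A) = x ^ c * ev[s, y] (bi c d (rev c A)) := by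
  rw [ev_bi, ev_bi, ← Finset.sum_range_reflect, Finset.mul_sum]
  refine Finset.sum_congr rfl fun i hi => ?_
  rw [Finset.mul_sum]
  refine Finset.sum_congr rfl fun j _ => ?_
  have hi : i ≤ c := by simpa [Nat.lt_succ_iff] using hi
  have : x ^ c * s ^ i = x ^ (c - i) := by
    conv_lhs => rw [← Nat.sub_add_cancel hi, pow_add, mul_assoc, ← mul_pow, h, one_pow, mul_one]
  rw [show c + 1 - 1 - i = c - i by omega, ← this]
  simp only [rev]; ring

lemma ev_rev_pderiv_one (c d : ℕ) (A : ℕ → ℕ → ℂ) {x s : L} (y : L) (h : x * s = 1) :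
    ev[x, y] (pderiv 1 (bi c d A)) = x ^ c * ev[s, y] (pderiv 1 (bi c d (rev c A))) := by
  rw [pderiv_one_bi, ev_rev c d _ y h, pderiv_one_bi]; rfl

lemma ev_rev_pderiv_zero (c d : ℕ) (A : ℕ → ℕ → ℂ) {x s : L} (y : L) (h : x * s = 1) :
    ev[x, y] (pderiv 0 (bi c d A)) = x ^ c * s * (c * ev[s, y] (bi c d (rev c A))
      - s * ev[s, y] (pderiv 0 (bi c d (rev c A)))) := by
  have h1 := congrArg (fun P => ev[x, y] P) (X_mul_pderiv_zero_bi c d A)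
  simp only [map_mul] at h1
  rw [ev_rev c d _ y h, rev_euler] at h1
  simp at h1
  have h2 : s * (x * ev[x, y] (pderiv 0 (bi c d A))) = ev[x, y] (pderiv 0 (bi c d A)) := by
    rw [← mul_assoc, mul_comm s, h, one_mul]
  rw [← h2, h1]; ring

lemma ev_rev_hess {c d : ℕ} {A : ℕ → ℕ → ℂ} {x s y : L} (h : x * s = 1)
    (hf : ev[x, y] (bi c d A) = 0) :
    ev[x, y] (hess (bi c d A)) = x ^ (3 * c) * s ^ 3 *
      ev[s, y] ((-2 * ((c : MvPolynomial (Fin 2) ℂ) - 1) * pderiv 0 (bi c d (rev c A))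
        + MvPolynomial.X 0 * pderiv 0 (pderiv 0 (bi c d (rev c A)))) *
          pderiv 1 (bi c d (rev c A)) ^ 2
        + 2 * ((c : MvPolynomial (Fin 2) ℂ) * pderiv 1 (bi c d (rev c A))
          - MvPolynomial.X 0 * pderiv 1 (pderiv 0 (bi c d (rev c A))))
          * pderiv 0 (bi c d (rev c A)) * pderiv 1 (bi c d (rev c A))
        + MvPolynomial.X 0 * pderiv 1 (pderiv 1 (bi c d (rev c A)))
          * pderiv 0 (bi c d (rev c A)) ^ 2) := by
  have hx : x ≠ 0 := left_ne_zero_of_mul_eq_one h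
  have hφ : ev[s, y] (bi c d (rev c A)) = 0 := by
    rw [ev_rev c d A y h] at hf
    exact (mul_eq_zero.1 hf).resolve_left (pow_ne_zero _ hx)
  have h1 := ev_rev_pderiv_zero c d A y h
  have h2 := ev_rev_pderiv_one c d A y h
  have h3 := ev_rev_pderiv_one c d (dY d A) y h
  have h4 := ev_rev_pderiv_zero c d (dY d A) y h
  have hr : bi c d (rev c (dY d A)) = pderiv 1 (bi c d (rev c A)) := by
    rw [pderiv_one_bi]; rfl
  rw [hr, ← pderiv_one_bi] at h3 h4
  rw [pderiv_comm, pderiv_comm] at h4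
  have h5 := ev_rev_pderiv_zero c d (fun i j => A i j * i) y h
  rw [rev_euler, ← X_mul_pderiv_zero_bi] at h5
  simp only [map_sub, map_mul, Derivation.leibniz, Derivation.map_natCast, smul_eq_mul,
    pderiv_X_self, map_add, map_natCast, aeval_X, Matrix.cons_val_zero, hφ, mul_zero, mul_one,
    zero_sub, add_zero, map_zero] at h1 h5
  have h6 : ev[x, y] (pderiv 0 (pderiv 0 (bi c d A))) = x ^ c * s ^ 3 *
      (-2 * (c - 1) * ev[s, y] (pderiv 0 (bi c d (rev c A)))
        + s * ev[s, y] (pderiv 0 (pderiv 0 (bi c d (rev c A))))) := by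
    have h7 : s * (x * ev[x, y] (pderiv 0 (pderiv 0 (bi c d A))))
        = ev[x, y] (pderiv 0 (pderiv 0 (bi c d A))) := by
      rw [← mul_assoc, mul_comm s, h, one_mul]
    rw [← h7, eq_sub_of_add_eq h5, h1]; ring
  simp only [hess, map_add, map_sub, map_mul, map_pow, map_neg, map_ofNat, map_natCast, map_one,
    aeval_X, Matrix.cons_val_zero]
  rw [h1, h2, h3, h4, h6]
  ring

end

end

noncomputable section

lemma ev_zero_bi (c d : ℕ) (A : ℕ → ℕ → ℂ) (b : ℂ) :
    ev[(0 : ℂ), b] (bi c d A) = ∑ j ∈ Finset.range (d + 1), A 0 j * b ^ j := by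
  rw [ev_bi, Finset.sum_range_succ']
  simp

lemma ev_zero_pderiv_zero_bi {c : ℕ} (hc : 1 ≤ c) (d : ℕ) (A : ℕ → ℕ → ℂ) (b : ℂ) :
    ev[(0 : ℂ), b] (pderiv 0 (bi c d A)) = ∑ j ∈ Finset.range (d + 1), A 1 j * b ^ j := by
  obtain ⟨c, rfl⟩ := Nat.exists_eq_add_of_le' hc
  rw [pderiv_bi_zero, map_sum, Finset.sum_range_succ', Finset.sum_range_succ']
  simp [map_sum]

lemma ev_zero_pderiv_one_bi (c d : ℕ) (A : ℕ → ℕ → ℂ) (b : ℂ) :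
    ev[(0 : ℂ), b] (pderiv 1 (bi c d A))
      = ∑ j ∈ Finset.range (d + 1), A 0 j * (j * b ^ (j - 1)) := by
  rw [pderiv_bi_one, map_sum, Finset.sum_range_succ']
  simp [map_sum]

section

variable {L Γ : Type*} [Field L] [Algebra ℂ L] [LinearOrderedCommGroupWithZero Γ]
  {v : Valuation L Γ} {c d : ℕ} {A : ℕ → ℕ → ℂ}

lemma near_inv_zero {x : L} (hx : 1 < v x) : Near v x⁻¹ 0 := by
  rw [near_zero_iff, map_inv₀]
  exact inv_lt_one_of_one_lt₀ hx

lemma ne_zero_of_one_lt {x : L} (hx : 1 < v x) : x ≠ 0 := by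
  rintro rfl
  rw [map_zero] at hx
  exact absurd hx (not_lt.2 zero_le_one)

lemma le_one_of_infty (hv : IsPlace v) (htop : A c d ≠ 0) {x y : L} (hx : 1 < v x)
    (hf : ev[x, y] (bi c d A) = 0) : v y ≤ 1 := by
  by_contra! hy
  have hx0 := ne_zero_of_one_lt hx
  have hy0 := ne_zero_of_one_lt hy
  rw [ev_rev c d A y (mul_inv_cancel₀ hx0), ← bi_tr,
    ev_rev d c _ _ (mul_inv_cancel₀ hy0)] at hf
  have h := (mul_eq_zero.1 ((mul_eq_zero.1 hf).resolve_left (pow_ne_zero _ hx0))).resolve_left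
    (pow_ne_zero _ hy0)
  have hn := (near_inv_zero hy).aeval hv (near_inv_zero hx) (bi d c (rev d (tr (rev c A))))
  rw [h, ev_zero_bi, Finset.sum_range_succ'] at hn
  simp [tr, rev] at hn
  exact htop ((hn.lt_one_iff hv).1 (by simp))

/-- The behaviour of the first derivatives at a point with `x = ∞`. -/
lemma Good.at_infty (h : Good c d A) (hc : 1 ≤ c) (hv : IsPlace v) {x y : L} (hx : 1 < v x)
    (hf : ev[x, y] (bi c d A) = 0) {b : ℂ} (hy : Near v y b) :
    (∑ j ∈ Finset.range (d + 1), A c j * b ^ j = 0) ∧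
    v (ev[x, y] (pderiv 1 (bi c d A))) = v x ^ c ∧
    v (ev[x, y] (pderiv 0 (bi c d A))) * v x ^ 2 = v x ^ c ∧
    v (ev[x, y] (hess (bi c d A))) * v x ^ 3 = v x ^ (3 * c) := by
  have hx0 := ne_zero_of_one_lt hx
  have hxs := mul_inv_cancel₀ hx0
  have hf' : ev[x⁻¹, y] (bi c d (rev c A)) = 0 := by
    rw [ev_rev c d A y hxs] at hf
    exact (mul_eq_zero.1 hf).resolve_left (pow_ne_zero _ hx0)
  have h0 : ∑ j ∈ Finset.range (d + 1), A c j * b ^ j = 0 := by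
    have hn := (near_inv_zero hx).aeval hv hy (bi c d (rev c A))
    rw [hf', ev_zero_bi] at hn
    exact (hn.lt_one_iff hv).1 (by simp)
  have h1 : ev[(0 : ℂ), b] (pderiv 0 (bi c d (rev c A))) ≠ 0 := by
    rw [ev_zero_pderiv_zero_bi hc]
    exact h.left.edge_next b h0
  have h2 : ev[(0 : ℂ), b] (pderiv 1 (bi c d (rev c A))) ≠ 0 := by
    rw [ev_zero_pderiv_one_bi]
    exact h.left.edge_simple b h0
  have n1 := ((near_inv_zero hx).aeval hv hy _).eq_one hv h1
  have n2 := ((near_inv_zero hx).aeval hv hy _).eq_one hv h2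
  have hvx : v x * (v x)⁻¹ = 1 := mul_inv_cancel₀ (by rwa [Valuation.ne_zero_iff])
  refine ⟨h0, ?_, ?_, ?_⟩
  · rw [ev_rev_pderiv_one c d A y hxs, map_mul, map_pow, n2, mul_one]
  · rw [ev_rev_pderiv_zero c d A y hxs, hf', mul_zero, zero_sub, map_mul, Valuation.map_neg,
      map_mul, map_mul, n1, mul_one, map_pow, map_inv₀, pow_two, mul_assoc, mul_assoc,
      ← mul_assoc _ (v x) (v x), mul_comm _ (v x), ← mul_assoc (v x)⁻¹, mul_comm _ (v x), hvx,
      one_mul, mul_one]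
  · rw [ev_rev_hess hxs hf, map_mul, map_mul, map_pow, map_pow, map_inv₀]
    rw [((near_inv_zero hx).aeval hv hy _).eq_one hv, mul_one, mul_assoc, ← mul_pow,
      mul_comm _ (v x), hvx, one_pow, mul_one]
    simp only [map_add, map_sub, map_mul, map_pow, map_neg, map_ofNat, map_natCast, map_one,
      aeval_X, Matrix.cons_val_zero, zero_mul, add_zero, sub_zero]
    have : -2 * ((c : ℂ) - 1) * ev[(0 : ℂ), b] (pderiv 0 (bi c d (rev c A))) *
        ev[(0 : ℂ), b] (pderiv 1 (bi c d (rev c A))) ^ 2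
        + 2 * (c * ev[(0 : ℂ), b] (pderiv 1 (bi c d (rev c A)))) *
        ev[(0 : ℂ), b] (pderiv 0 (bi c d (rev c A))) *
        ev[(0 : ℂ), b] (pderiv 1 (bi c d (rev c A)))
        = 2 * ev[(0 : ℂ), b] (pderiv 0 (bi c d (rev c A))) *
        ev[(0 : ℂ), b] (pderiv 1 (bi c d (rev c A))) ^ 2 := by ring
    rw [this]
    exact mul_ne_zero (mul_ne_zero two_ne_zero h1) (pow_ne_zero _ h2)

lemma Good.hess_infty (h : Good c d A) (hc : 1 ≤ c) (hv : IsPlace v) {x y : L} (hx : 1 < v x)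
    (hf : ev[x, y] (bi c d A) = 0) :
    v (ev[x, y] (hess (bi c d A))) = v x ^ (3 * c - 3) := by
  have hy := near_resid hv (le_one_of_infty hv h.left.top hx hf)
  have h4 := (h.at_infty hc hv hx hf hy).2.2.2
  have hvx : v x ^ 3 ≠ 0 := pow_ne_zero _ (by rw [Valuation.ne_zero_iff]; exact ne_zero_of_one_lt hx)
  refine mul_right_cancel₀ hvx ?_
  rw [h4, ← pow_add]
  congr 1; omega

lemma Good.hess_infty' (h : Good c d A) (hd : 1 ≤ d) (hv : IsPlace v) {x y : L} (hy : 1 < v y)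
    (hf : ev[x, y] (bi c d A) = 0) :
    v (ev[x, y] (hess (bi c d A))) = v y ^ (3 * d - 3) := by
  rw [← bi_tr_hess]
  exact h.swap.hess_infty hd hv hy (by rw [bi_tr]; exact hf)

lemma Good.flex_pderiv (h : Good c d A) {a b : ℂ} (hf : ev[a, b] (bi c d A) = 0)
    (hH : ev[a, b] (hess (bi c d A)) = 0) : ev[a, b] (pderiv 1 (bi c d A)) ≠ 0 := by
  intro hq
  have hp : - ev[a, b] (pderiv 0 (bi c d A)) ≠ 0 := (h.grad_ne hf).resolve_left (by simpa using hq)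
  refine h.vert3 (a := a) (b := b) hp 0 ?_
  simp only [trip, pow_zero, mul_one, map_zero, sub_zero]
  rw [X_pow_three_dvd_iff]
  rw [ev_hess, hq] at hH
  refine ⟨by rw [lineRes_coeff_zero, hf], by rw [lineRes_coeff_one, hq]; ring, ?_⟩
  simpa using hH

lemma Good.coeff_three_ne (h : Good c d A) {a b : ℂ} (hf : ev[a, b] (bi c d A) = 0)
    (hH : ev[a, b] (hess (bi c d A)) = 0) : (tanRes (bi c d A) a b).coeff 3 ≠ 0 := by
  intro h3
  refine h.line4 (a := a) (b := b) (h.grad_ne hf) 0 ?_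
  simp only [trip, pow_zero, mul_one, map_zero, sub_zero]
  rw [Polynomial.X_pow_dvd_iff]
  intro k hk
  rw [ev_hess] at hH
  interval_cases k
  · exact (tanRes_coeff_zero _ _ _).trans hf
  · exact tanRes_coeff_one _ _ _
  · simpa using hH
  · exact h3

lemma Good.hess_near (h : Good c d A) (hv : IsPlace v) {x y : L} {a b : ℂ} (hx : Near v x a)
    (hy : Near v y b) (hf : ev[x, y] (bi c d A) = 0) :
    (ev[a, b] (hess (bi c d A)) ≠ 0 → v (ev[x, y] (hess (bi c d A))) = 1) ∧
    (ev[a, b] (hess (bi c d A)) = 0 →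
      v (ev[x, y] (hess (bi c d A))) = v (x - algebraMap ℂ L a)) := by
  refine ⟨fun hH => (hx.aeval hv hy _).eq_one hv hH, fun hH => ?_⟩
  have hf0 : ev[a, b] (bi c d A) = 0 := by
    have := hx.aeval hv hy (bi c d A)
    rw [hf] at this
    exact (this.lt_one_iff hv).1 (by simp)
  refine (firstOrder hv hx hy hf hf0 hH (h.flex_pderiv hf0 hH)).2 ?_
  rw [hess_jacobian]
  exact mul_ne_zero (by norm_num) (h.coeff_three_ne hf0 hH)

end

end

noncomputable section

/-- `(a, b)` is a point of tangency of a bitangent line. -/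
structure IsBit (f : MvPolynomial (Fin 2) ℂ) (a b τ : ℂ) : Prop where
  mem : ev[a, b] f = 0
  dx : ev[a, b] (pderiv 0 f) ≠ 0
  dy : ev[a, b] (pderiv 1 f) ≠ 0
  ne : τ ≠ 0
  root : (tanRes f a b).eval τ = 0
  root' : (tanRes f a b).derivative.eval τ = 0

lemma resultant_derivative_eq {K : Type*} [Field K] [IsAlgClosed K] {P : Polynomial K} {m : ℕ}
    (hP : P.natDegree = m) :
    Polynomial.resultant P P.derivative m (m - 1)
      = P.leadingCoeff ^ (m - 1) * (P.roots.map P.derivative.eval).prod := by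
  have := Polynomial.resultant_eq_prod_eval P P.derivative (m - 1)
    (by rw [← hP]; exact Polynomial.natDegree_derivative_le P) (IsAlgClosed.splits P)
  rwa [hP] at this

lemma resultant_derivative_eq' {K : Type*} [Field K] [IsAlgClosed K] [CharZero K]
    {P : Polynomial K} {m : ℕ} (hP : P.natDegree = m) :
    Polynomial.resultant P P.derivative m (m - 1)
      = (-1) ^ (m * (m - 1)) * (P.derivative.leadingCoeff ^ m
        * (P.derivative.roots.map P.eval).prod) := by
  have := Polynomial.resultant_eq_prod_eval P.derivative P m hP.le (IsAlgClosed.splits _)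
  rw [Polynomial.natDegree_derivative, hP] at this
  rw [Polynomial.resultant_comm, this]

/-- A polynomial with vanishing discriminant has a double root. -/
lemma exists_double_root {K : Type*} [Field K] [IsAlgClosed K] {P : Polynomial K} {m : ℕ}
    (hP : P.natDegree = m) (h0 : P ≠ 0)
    (h : Polynomial.resultant P P.derivative m (m - 1) = 0) :
    ∃ t, P.eval t = 0 ∧ P.derivative.eval t = 0 := by
  rw [resultant_derivative_eq hP] at h
  have h1 := (mul_eq_zero.1 h).resolve_left (pow_ne_zero _ (Polynomial.leadingCoeff_ne_zero.2 h0))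
  rw [Multiset.prod_eq_zero_iff, Multiset.mem_map] at h1
  obtain ⟨t, ht, ht'⟩ := h1
  exact ⟨t, (Polynomial.mem_roots h0).1 ht, ht'⟩

lemma sq_mul_sq_dvd {K : Type*} [Field K] {P : Polynomial K} {r s : K} (hrs : r ≠ s) {i j : ℕ}
    (h1 : (Polynomial.X - Polynomial.C r) ^ i ∣ P) (h2 : (Polynomial.X - Polynomial.C s) ^ j ∣ P) :
    (Polynomial.X - Polynomial.C r) ^ i * (Polynomial.X - Polynomial.C s) ^ j ∣ P :=
  (Polynomial.isCoprime_X_sub_C_of_isUnit_sub (sub_ne_zero.2 hrs).isUnit).pow.mul_dvd h1 h2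

section

variable {L Γ : Type*} [Field L] [Algebra ℂ L] [LinearOrderedCommGroupWithZero Γ]
  {v : Valuation L Γ} {c d : ℕ} {A : ℕ → ℕ → ℂ}

lemma NearP.lineRes (hv : IsPlace v) (f : MvPolynomial (Fin 2) ℂ) {x y u w : L} {a b r s : ℂ}
    (hx : Near v x a) (hy : Near v y b) (hu : Near v u r) (hw : Near v w s) :
    NearP v (lineRes f x y u w) (lineRes f a b r s) :=
  NearP.aeval hv ((nearP_C hx).add ((nearP_C hu).mul hv nearP_X))
    ((nearP_C hy).add ((nearP_C hw).mul hv nearP_X)) f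

lemma NearP.tanRes (hv : IsPlace v) (f : MvPolynomial (Fin 2) ℂ) {x y : L} {a b : ℂ}
    (hx : Near v x a) (hy : Near v y b) : NearP v (tanRes f x y) (tanRes f a b) :=
  NearP.lineRes hv f hx hy (hx.aeval hv hy _) (hx.aeval hv hy _).neg

lemma NearP.tanResid (hv : IsPlace v) (f : MvPolynomial (Fin 2) ℂ) {x y : L} {a b : ℂ}
    (hx : Near v x a) (hy : Near v y b) : NearP v (tanResid f x y) (tanResid f a b) :=
  (NearP.tanRes hv f hx hy).divX.divX

lemma tanResid_natDegree {K : Type*} [Field K] [Algebra ℂ K] (hcd : 2 ≤ c + d) (htop : A c d ≠ 0)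
    {x y : K} (hp : ev[x, y] (pderiv 0 (bi c d A)) ≠ 0)
    (hq : ev[x, y] (pderiv 1 (bi c d A)) ≠ 0) :
    (tanResid (bi c d A) x y).natDegree = c + d - 2 := by
  refine le_antisymm (tanResid_natDegree_le _ _ _ _ _) (Polynomial.le_natDegree_of_ne_zero ?_)
  rw [tanResid_coeff_top hcd]
  refine mul_ne_zero (mul_ne_zero ?_ (pow_ne_zero _ hq)) (pow_ne_zero _ (neg_ne_zero.2 hp))
  rwa [Ne, FaithfulSMul.algebraMap_eq_zero_iff]

lemma tanResid_ne_zero {K : Type*} [Field K] [Algebra ℂ K] (hcd : 2 ≤ c + d) (htop : A c d ≠ 0)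
    {x y : K} (hp : ev[x, y] (pderiv 0 (bi c d A)) ≠ 0)
    (hq : ev[x, y] (pderiv 1 (bi c d A)) ≠ 0) :
    tanResid (bi c d A) x y ≠ 0 := by
  intro h0
  have := tanResid_coeff_top hcd A x y
  rw [h0, Polynomial.coeff_zero] at this
  refine mul_ne_zero (mul_ne_zero ?_ (pow_ne_zero _ hq)) (pow_ne_zero _ (neg_ne_zero.2 hp)) this.symm
  rwa [Ne, FaithfulSMul.algebraMap_eq_zero_iff]

lemma Good.bitDisc_near_ne (h : Good c d A) (hcd : 2 ≤ c + d) {a b : ℂ}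
    (hf : ev[a, b] (bi c d A) = 0) (hp : ev[a, b] (pderiv 0 (bi c d A)) ≠ 0)
    (hq : ev[a, b] (pderiv 1 (bi c d A)) ≠ 0) (hB : ∀ τ, ¬ IsBit (bi c d A) a b τ) :
    ev[a, b] (bitDisc (c + d) (bi c d A)) ≠ 0 := by
  rw [ev_bitDisc]
  intro h0
  obtain ⟨t, ht, ht'⟩ := exists_double_root (tanResid_natDegree hcd h.left.top hp hq)
    (tanResid_ne_zero hcd h.left.top hp hq) h0
  by_cases ht0 : t = 0
  · subst ht0
    refine h.line4 (a := a) (b := b) (h.grad_ne hf) 0 ?_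
    have h1 := sq_dvd_of_roots ht ht'
    rw [map_zero, sub_zero] at h1
    have h2 := mul_dvd_mul_left (Polynomial.X ^ 2) h1
    rw [← tanRes_eq _ hf] at h2
    rw [← pow_add] at h2
    simpa only [trip, map_zero, sub_zero, pow_zero, mul_one, _root_.tanRes, Nat.reduceAdd] using h2
  · refine hB t ⟨hf, hp, hq, ht0, ?_, ?_⟩
    · rw [tanRes_eq _ hf]; simp [ht]
    · rw [tanRes_eq _ hf]; simp [ht, ht', Polynomial.derivative_mul]

/-- The structure of the residual polynomial at a bitangency point. -/
lemma Good.bit_structure (h : Good c d A) {a b τ : ℂ} (hB : IsBit (bi c d A) a b τ) :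
    (tanResid (bi c d A) a b).eval τ = 0 ∧ (tanResid (bi c d A) a b).derivative.eval τ = 0 ∧
    (tanResid (bi c d A) a b).derivative.derivative.eval τ ≠ 0 ∧
    (∀ σ, σ ≠ τ → (tanResid (bi c d A) a b).derivative.eval σ = 0 →
      (tanResid (bi c d A) a b).eval σ ≠ 0) ∧
    ev[a, b] (hess (bi c d A)) ≠ 0 := by
  have hF := tanRes_eq (bi c d A) hB.mem
  have hR0 : (tanResid (bi c d A) a b).eval τ = 0 := by
    have := hB.root
    rw [hF] at this
    simpa [hB.ne] using this
  have hR1 : (tanResid (bi c d A) a b).derivative.eval τ = 0 := by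
    have := hB.root'
    rw [hF] at this
    simpa [hB.ne, Polynomial.derivative_mul, hR0] using this
  refine ⟨hR0, hR1, fun hR2 => ?_, fun σ hσ hσ1 hσ0 => ?_, fun hH => ?_⟩
  · refine h.line32 (a := a) (b := b) (h.grad_ne hB.mem) τ 0 ?_
    have h1 := mul_dvd_mul_left (Polynomial.X ^ 2) (cube_dvd_of_roots hR0 hR1 hR2)
    rw [← tanRes_eq _ hB.mem, mul_comm] at h1
    simpa only [trip, map_zero, sub_zero, pow_zero, mul_one, _root_.tanRes] using h1
  · refine h.line222 (a := a) (b := b) (h.grad_ne hB.mem) 0 τ σ ?_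
    have h1 := mul_dvd_mul_left (Polynomial.X ^ 2)
      (sq_mul_sq_dvd hσ.symm (sq_dvd_of_roots hR0 hR1) (sq_dvd_of_roots hσ0 hσ1))
    rw [← tanRes_eq _ hB.mem, ← mul_assoc] at h1
    simpa only [trip, map_zero, sub_zero, _root_.tanRes] using h1
  · refine h.line32 (a := a) (b := b) (h.grad_ne hB.mem) 0 τ ?_
    have h3 : (Polynomial.X - Polynomial.C (0 : ℂ)) ^ 3 ∣ tanRes (bi c d A) a b := by
      rw [map_zero, sub_zero, X_pow_three_dvd_iff]
      refine ⟨(tanRes_coeff_zero _ _ _).trans hB.mem, tanRes_coeff_one _ _ _, ?_⟩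
      rw [ev_hess] at hH
      simpa [_root_.tanRes] using hH
    have h1 := sq_mul_sq_dvd hB.ne.symm h3 (sq_dvd_of_roots hB.root hB.root')
    simpa only [trip, pow_zero, mul_one, _root_.tanRes] using h1

/-- Second order expansion near a multiple root. -/
lemma NearP.sub_critical (hv : IsPlace v) {R : Polynomial L} {r : Polynomial ℂ} (hR : NearP v R r)
    {s t : L} {σ : ℂ} (hs : Near v s σ) (ht : v t ≤ 1) (hs1 : R.derivative.eval s = 0) :
    v (R.eval t - R.eval s) ≤ v (t - s) ^ 2 := by
  have hdvd : (Polynomial.X - Polynomial.C s) ∣ R - Polynomial.C (R.eval s) := by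
    rw [Polynomial.dvd_iff_isRoot]; simp
  obtain ⟨P, hP⟩ := hdvd
  have hn : NearP v (R - Polynomial.C (R.eval s)) (r - Polynomial.C (r.eval σ)) :=
    hR.sub (nearP_C (hR.eval hv hs))
  obtain ⟨p, hp, -⟩ := hn.factor hv hs hP
  have hP0 : P.eval s = 0 := by
    have h1 := congrArg (fun Z => Polynomial.eval s (Polynomial.derivative Z)) hP
    simpa [hs1, Polynomial.derivative_mul] using h1.symm
  obtain ⟨Q, hQ⟩ := Polynomial.dvd_iff_isRoot.2 hP0
  obtain ⟨q, hq, -⟩ := hp.factor hv hs hQ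
  have h2 := congrArg (Polynomial.eval t) hP
  rw [hQ] at h2
  simp at h2
  rw [h2, ← mul_assoc, ← pow_two, map_mul, map_pow]
  have h3 := (hq.eval hv (near_resid hv ht)).le hv
  calc v (t - s) ^ 2 * v (Q.eval t) ≤ v (t - s) ^ 2 * 1 := by gcongr
    _ = _ := mul_one _

lemma NearP.sub_simple (hv : IsPlace v) {R : Polynomial L} {r : Polynomial ℂ} (hR : NearP v R r)
    {s t : L} {σ : ℂ} (hs : Near v s σ) (ht : Near v t σ) (hs0 : R.eval s = 0)
    (hr : r.derivative.eval σ ≠ 0) : v (R.eval t) = v (t - s) := by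
  obtain ⟨P, hP⟩ := Polynomial.dvd_iff_isRoot.2 hs0
  obtain ⟨p, hp, hrp⟩ := hR.factor hv hs hP
  have hP0 : p.eval σ ≠ 0 := by
    rw [hrp] at hr
    simpa [Polynomial.derivative_mul] using hr
  rw [hP, Polynomial.eval_mul, map_mul, (hp.eval hv ht).eq_one hv hP0]
  simp

/-- The polynomial whose value at `(x, y)` is `f` at the point of parameter `τ` on the tangent
line. -/
def tanPt (f : MvPolynomial (Fin 2) ℂ) (τ : ℂ) (g : MvPolynomial (Fin 2) ℂ) :
    MvPolynomial (Fin 2) ℂ :=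
  ev[(MvPolynomial.X 0 : MvPolynomial (Fin 2) ℂ) + MvPolynomial.C τ * pderiv 1 f,
    MvPolynomial.X 1 - MvPolynomial.C τ * pderiv 0 f] g

lemma ev_tanPt {K : Type*} [CommRing K] [Algebra ℂ K] (f g : MvPolynomial (Fin 2) ℂ) (τ : ℂ)
    (x y : K) : ev[x, y] (tanPt f τ g) = (lineRes g x y (ev[x, y] (pderiv 1 f))
      (- ev[x, y] (pderiv 0 f))).eval (algebraMap ℂ K τ) := by
  rw [tanPt, ev_ev, lineRes_eval]
  simp only [map_add, map_sub, map_mul, aeval_X, Matrix.cons_val_zero, Matrix.cons_val_one,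
    algHom_C]
  congr 2
  ring_nf

lemma tanPt_jacobian (f : MvPolynomial (Fin 2) ℂ) {a b τ l : ℂ}
    (h0 : ev[a, b] (tanPt f τ (pderiv 0 f)) = l * ev[a, b] (pderiv 0 f))
    (h1 : ev[a, b] (tanPt f τ (pderiv 1 f)) = l * ev[a, b] (pderiv 1 f)) :
    ev[a, b] (pderiv 0 (tanPt f τ f)) * ev[a, b] (pderiv 1 f)
      - ev[a, b] (pderiv 1 (tanPt f τ f)) * ev[a, b] (pderiv 0 f)
      = - l * τ * ev[a, b] (hess f) := by
  have e : ∀ i, pderiv i (tanPt f τ f) = tanPt f τ (pderiv 0 f) *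
      (pderiv i (MvPolynomial.X 0) + MvPolynomial.C τ * pderiv i (pderiv 1 f))
      + tanPt f τ (pderiv 1 f) *
      (pderiv i (MvPolynomial.X 1) - MvPolynomial.C τ * pderiv i (pderiv 0 f)) := by
    intro i
    conv_lhs => rw [tanPt, pderiv_ev]
    simp only [map_add, map_sub, pderiv_C_mul]
    rfl
  rw [e, e]
  simp only [map_add, map_sub, map_mul, h0, h1, hess, pderiv_X_self,
    pderiv_X_of_ne (show (1 : Fin 2) ≠ 0 by decide), pderiv_comm, map_pow, map_ofNat,
    pderiv_X_of_ne (show (0 : Fin 2) ≠ 1 by decide), map_one, map_zero, algHom_C,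
    Algebra.algebraMap_self, RingHom.id_apply]
  ring

end

end

noncomputable section

variable {L Γ : Type*} [Field L] [Algebra ℂ L] [LinearOrderedCommGroupWithZero Γ]
  {v : Valuation L Γ} {c d : ℕ} {A : ℕ → ℕ → ℂ}

/-- On the tangent lines near a bitangent, the value at the second tangency point. -/
lemma Good.tanRes_bit (h : Good c d A) (hv : IsPlace v) {x y : L} {a b τ : ℂ}
    (hx : Near v x a) (hy : Near v y b) (hf : ev[x, y] (bi c d A) = 0)
    (hB : IsBit (bi c d A) a b τ) :
    v ((tanRes (bi c d A) x y).eval (algebraMap ℂ L τ)) = v (x - algebraMap ℂ L a) ∧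
    v ((tanRes (bi c d A) x y).derivative.eval (algebraMap ℂ L τ)) ≤ v (x - algebraMap ℂ L a) := by
  set f := bi c d A
  set p := ev[a, b] (pderiv 0 f) with hp
  set q := ev[a, b] (pderiv 1 f) with hq
  have hr0 : ev[a, b] (tanPt f τ f) = 0 := by
    rw [ev_tanPt]; exact hB.root
  have hr1 : ev[a, b] (tanPt f τ (pderiv 0 f)) * q - ev[a, b] (tanPt f τ (pderiv 1 f)) * p = 0 := by
    have := hB.root'
    rw [tanRes, lineRes_derivative] at this
    rw [ev_tanPt, ev_tanPt]
    simp only [Polynomial.eval_add, Polynomial.eval_mul, Polynomial.eval_C] at this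
    simp only [Algebra.algebraMap_self, RingHom.id_apply]
    linear_combination this
  set l := ev[a, b] (tanPt f τ (pderiv 1 f)) / q with hl
  have h1 : ev[a, b] (tanPt f τ (pderiv 1 f)) = l * q := by
    rw [hl, div_mul_cancel₀]; exact hB.dy
  have h0 : ev[a, b] (tanPt f τ (pderiv 0 f)) = l * p := by
    refine mul_right_cancel₀ hB.dy ?_
    rw [h1] at hr1
    linear_combination hr1
  have hl0 : l ≠ 0 := by
    intro hl0
    rw [hl0, zero_mul] at h0 h1
    rw [ev_tanPt, lineRes_eval] at h0 h1 hr0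
    exact h.left.smooth _ _ hr0 h0 h1
  constructor
  · have := (firstOrder hv hx hy hf hB.mem hr0 hB.dy).2 (by
      rw [tanPt_jacobian f h0 h1]
      exact mul_ne_zero (mul_ne_zero (neg_ne_zero.2 hl0) hB.ne) (h.bit_structure hB).2.2.2.2)
    rw [ev_tanPt] at this
    exact this
  · have := (firstOrder hv hx hy hf hB.mem (g := tanPt f τ (pderiv 0 f) * pderiv 1 f
      - tanPt f τ (pderiv 1 f) * pderiv 0 f) (by rw [map_sub, map_mul, map_mul]; exact hr1) hB.dy).1
    refine le_trans (le_of_eq ?_) this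
    congr 1
    rw [tanRes, lineRes_derivative]
    simp only [map_sub, map_mul, ev_tanPt, Polynomial.eval_add, Polynomial.eval_mul,
      Polynomial.eval_C]
    ring

lemma algebraMap_nat_val (hv : IsPlace v) {n : ℕ} (hn : n ≠ 0) : v (n : L) = 1 := by
  have := hv.const n (by exact_mod_cast hn)
  rwa [map_natCast] at this

lemma Good.bitDisc_near_bit [IsAlgClosed L] [CharZero L] (h : Good c d A) (hcd : 4 ≤ c + d)
    (hv : IsPlace v) {x y : L} {a b τ : ℂ}
    (hx : Near v x a) (hy : Near v y b) (hf : ev[x, y] (bi c d A) = 0)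
    (hB : IsBit (bi c d A) a b τ) (hxa : x ≠ algebraMap ℂ L a) :
    v (ev[x, y] (bitDisc (c + d) (bi c d A))) = v (x - algebraMap ℂ L a) := by
  have hpL := (hx.aeval hv hy _).eq_one hv hB.dx
  have hqL := (hx.aeval hv hy _).eq_one hv hB.dy
  have hpL0 : ev[x, y] (pderiv 0 (bi c d A)) ≠ 0 := by
    rw [← v.ne_zero_iff, hpL]; exact one_ne_zero
  have hqL0 : ev[x, y] (pderiv 1 (bi c d A)) ≠ 0 := by
    rw [← v.ne_zero_iff, hqL]; exact one_ne_zero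
  obtain ⟨hτ1, hτ2⟩ := h.tanRes_bit hv hx hy hf hB
  obtain ⟨e0, e1, e2, e3, -⟩ := h.bit_structure hB
  have hn := NearP.tanResid hv (bi c d A) hx hy
  have hdeg := tanResid_natDegree (by omega) h.left.top hpL0 hqL0
  have hdeg' := tanResid_natDegree (by omega) h.left.top hB.dx hB.dy
  have hF := tanRes_eq (bi c d A) hf
  have hlc : v (tanResid (bi c d A) x y).leadingCoeff = 1 := by
    rw [Polynomial.leadingCoeff, hdeg, tanResid_coeff_top (by omega), map_mul, map_mul, map_pow,
      map_pow, Valuation.map_neg, hpL, hqL, hv.const _ h.left.top]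
    simp
  rw [ev_bitDisc, resultant_derivative_eq' hdeg]
  set R := tanResid (bi c d A) x y
  set r := tanResid (bi c d A) a b
  set T := algebraMap ℂ L τ
  have hlc' : v R.derivative.leadingCoeff = 1 := by
    rw [Polynomial.leadingCoeff, Polynomial.natDegree_derivative, Polynomial.coeff_derivative,
      hdeg, show c + d - 2 - 1 + 1 = R.natDegree by omega, map_mul]
    rw [Polynomial.leadingCoeff] at hlc
    rw [hlc, one_mul, ← Nat.cast_add_one]
    exact algebraMap_nat_val hv (by omega)
  have hr' : r.derivative ≠ 0 := by
    intro h0; rw [h0] at e2; simp at e2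
  have hn' := hn.derivative hv
  obtain ⟨hroots, hbound⟩ := hn'.roots_eq_of_lc hv hr' hlc'
  have hmem : τ ∈ r.derivative.roots := (Polynomial.mem_roots hr').2 e1
  rw [hroots, Multiset.mem_map] at hmem
  obtain ⟨s, hs, hsτ⟩ := hmem
  have hsn : Near v s τ := hsτ ▸ near_resid hv (hbound s hs)
  have hs0 : R.derivative.eval s = 0 := Polynomial.isRoot_of_mem_roots hs
  obtain ⟨M, hM⟩ := Multiset.exists_cons_of_mem hs
  have hcount : r.derivative.roots.count τ = 1 := by
    rw [Polynomial.count_roots]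
    refine le_antisymm ?_ ((Polynomial.rootMultiplicity_pos hr').2 e1)
    by_contra! hlt
    exact e2 ((Polynomial.one_lt_rootMultiplicity_iff_isRoot hr').1 hlt).2
  have hM1 : ∀ z ∈ M, v (R.eval z) = 1 := by
    intro z hz
    have hzR : z ∈ R.derivative.roots := by rw [hM]; exact Multiset.mem_cons_of_mem hz
    have hzn := near_resid hv (hbound z hzR)
    have hne : resid v z ≠ τ := by
      intro hzτ
      rw [hroots, hM, Multiset.map_cons, hsτ, Multiset.count_cons_self] at hcount
      have : 0 < Multiset.count τ (M.map (resid v)) :=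
        Multiset.count_pos.2 (Multiset.mem_map.2 ⟨z, hz, hzτ⟩)
      omega
    refine (hn.eval hv hzn).eq_one hv (e3 _ hne ?_)
    have := hn'.eval hv hzn
    rw [show R.derivative.eval z = 0 from Polynomial.isRoot_of_mem_roots hzR] at this
    exact (this.lt_one_iff hv).1 (by simp)
  have hprod : v ((R.derivative.roots.map R.eval).prod) = v (R.eval s) := by
    rw [hM, Multiset.map_cons, Multiset.prod_cons, map_mul, map_multiset_prod, Multiset.map_map]
    rw [Multiset.prod_eq_one, mul_one]
    intro z hz
    obtain ⟨z', hz', rfl⟩ := Multiset.mem_map.1 hz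
    exact hM1 z' hz'
  rw [map_mul, map_mul, map_pow, map_pow, hlc', hprod, one_pow, one_mul, Valuation.map_neg,
    map_one, one_pow, one_mul]
  -- compare `R s` with `R τ`
  have hTv : v T = 1 := hv.const _ hB.ne
  have hRT : v (R.eval T) = v (x - algebraMap ℂ L a) := by
    rw [← hτ1, hF]
    simp [hTv]
  have hR'T : v (R.derivative.eval T) ≤ v (x - algebraMap ℂ L a) := by
    have h1 : T ^ 2 * R.derivative.eval T = (tanRes (bi c d A) x y).derivative.eval T
        - 2 * T * R.eval T := by
      rw [hF]; simp [Polynomial.derivative_mul]; ring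
    have h2 : v (T ^ 2 * R.derivative.eval T) = v (R.derivative.eval T) := by simp [hTv]
    rw [← h2, h1]
    refine (v.map_sub _ _).trans (max_le hτ2 ?_)
    rw [map_mul, map_mul, hTv, hRT, mul_one]
    have : v (2 : L) = 1 := by exact_mod_cast algebraMap_nat_val hv (n := 2) two_ne_zero
    rw [this, one_mul]
  have hTs : v (T - s) ≤ v (x - algebraMap ℂ L a) := by
    rw [← hn'.sub_simple hv hsn (near_const v τ) hs0 e2]; exact hR'T
  have hcrit := hn.sub_critical hv hsn (hv.const_le τ) hs0
  have hlt : v (R.eval s - R.eval T) < v (R.eval T) := by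
    rw [Valuation.map_sub_swap, hRT]
    refine hcrit.trans_lt ?_
    have hpos : 0 < v (x - algebraMap ℂ L a) := by
      rw [zero_lt_iff, v.ne_zero_iff]; exact sub_ne_zero.2 hxa
    calc v (T - s) ^ 2 ≤ v (x - algebraMap ℂ L a) ^ 2 := by gcongr
      _ < v (x - algebraMap ℂ L a) := by
        rw [pow_two]
        calc _ < 1 * v (x - algebraMap ℂ L a) := by
              gcongr
              exact hx
          _ = _ := one_mul _
  rw [← hRT]
  have h9 : R.eval s = R.eval T + (R.eval s - R.eval T) := by ring
  rw [h9]
  exact v.map_add_eq_of_lt_left hlt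

end

noncomputable section

variable {L Γ : Type*} [Field L] [Algebra ℂ L] [LinearOrderedCommGroupWithZero Γ]
  {v : Valuation L Γ} {c d : ℕ} {A : ℕ → ℕ → ℂ}

omit [Algebra ℂ L] in
/-- The valuation of a discriminant in terms of the differences of the roots. -/
lemma val_resultant_derivative [IsAlgClosed L] (v : Valuation L Γ) {R : Polynomial L} {m : ℕ}
    (hm : R.natDegree = m) (h0 : R ≠ 0) (S : Finset L) (hS : R.roots = S.val) :
    v (Polynomial.resultant R R.derivative m (m - 1)) =
      v R.leadingCoeff ^ (m - 1 + m) * open Classical in ∏ z ∈ S.offDiag, v (z.1 - z.2) := by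
  classical
  have hcard : S.card = m := by
    rw [← hm, ← IsAlgClosed.card_roots_eq_natDegree, hS]; rfl
  have hR : R = Polynomial.C R.leadingCoeff * ∏ t ∈ S, (Polynomial.X - Polynomial.C t) := by
    conv_lhs => rw [(IsAlgClosed.splits R).eq_prod_roots, hS]
    rfl
  have hroots : (∏ t ∈ S, (Polynomial.X - Polynomial.C t)).roots = S.val :=
    Polynomial.roots_prod_X_sub_C S
  have hder : ∀ t ∈ S, R.derivative.eval t = R.leadingCoeff * ∏ s ∈ S.erase t, (t - s) := by
    intro t ht
    have := (IsAlgClosed.splits (∏ t ∈ S, (Polynomial.X - Polynomial.C t))).eval_root_derivative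
      (Polynomial.monic_prod_of_monic _ _ fun t _ => Polynomial.monic_X_sub_C t) (x := t)
      (by rw [hroots]; exact ht)
    rw [hroots] at this
    conv_lhs => rw [hR]
    rw [Polynomial.derivative_C_mul, Polynomial.eval_mul, Polynomial.eval_C, this]
    rfl
  rw [resultant_derivative_eq hm, hS]
  have : (S.val.map R.derivative.eval).prod = ∏ t ∈ S, R.derivative.eval t := rfl
  rw [this, Finset.prod_congr rfl hder, Finset.prod_mul_distrib, Finset.prod_const, hcard,
    ← mul_assoc, ← pow_add, map_mul, map_pow, map_prod]
  congr 1
  rw [Finset.prod_congr rfl fun t _ => map_prod v _ _]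
  rw [Finset.prod_sigma']
  refine Finset.prod_bij' (fun z _ => (z.1, z.2)) (fun z _ => ⟨z.1, z.2⟩) ?_ ?_ ?_ ?_ ?_
  · rintro ⟨z, w⟩ h
    simp at h ⊢
    exact ⟨h.1, h.2.2, fun h' => h.2.1 h'.symm⟩
  · rintro ⟨z, w⟩ h
    simp at h ⊢
    exact ⟨h.1, fun h' => h.2.2 h'.symm, h.2.1⟩
  · intros; rfl
  · intros; rfl
  · intros; rfl

lemma prod_offDiag_two_values {α Γ : Type*} [DecidableEq α] [CommMonoid Γ] (S : Finset α)
    (P : α → Prop) [DecidablePred P] (w : α → α → Γ) (a b : Γ)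
    (h1 : ∀ s ∈ S, ∀ t ∈ S, s ≠ t → P s → P t → w s t * a = 1)
    (h2 : ∀ s ∈ S, ∀ t ∈ S, s ≠ t → ¬ (P s ∧ P t) → w s t * b = 1) {m k : ℕ} (hm : S.card = m)
    (hk : (S.filter P).card = k) :
    (∏ z ∈ S.offDiag, w z.1 z.2) * a ^ (k * (k - 1)) * b ^ (m * (m - 1) - k * (k - 1)) = 1 := by
  have hf : (S.offDiag.filter (fun z => P z.1 ∧ P z.2)) = (S.filter P).offDiag := by
    ext ⟨s, t⟩
    simp only [Finset.mem_filter, Finset.mem_offDiag]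
    tauto
  have hc1 : (S.offDiag.filter (fun z => P z.1 ∧ P z.2)).card = k * (k - 1) := by
    rw [hf, Finset.offDiag_card, hk, Nat.mul_sub_one]
  have hc2 : (S.offDiag.filter (fun z => ¬ (P z.1 ∧ P z.2))).card
      = m * (m - 1) - k * (k - 1) := by
    have h3 := Finset.card_filter_add_card_filter_not (s := S.offDiag)
      (fun z : α × α => P z.1 ∧ P z.2)
    rw [hc1, Finset.offDiag_card, hm, ← Nat.mul_sub_one] at h3
    omega
  rw [mul_assoc, ← hc2, ← hc1, ← Finset.prod_const, ← Finset.prod_const,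
    ← Finset.prod_filter_mul_prod_filter_not S.offDiag (fun z => P z.1 ∧ P z.2) (fun z => w z.1 z.2),
    mul_mul_mul_comm, ← Finset.prod_mul_distrib, ← Finset.prod_mul_distrib]
  rw [Finset.prod_eq_one, Finset.prod_eq_one, one_mul]
  · rintro ⟨s, t⟩ h
    simp only [Finset.mem_filter, Finset.mem_offDiag] at h
    exact h2 s h.1.1 t h.1.2.1 h.1.2.2 h.2
  · rintro ⟨s, t⟩ h
    simp only [Finset.mem_filter, Finset.mem_offDiag] at h
    exact h1 s h.1.1 t h.1.2.1 h.1.2.2 h.2.1 h.2.2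

/-- The rescaled equation of the intersection with the line `Y = β + μ X`, in terms of `Y`. -/
def lineY (c d : ℕ) (A : ℕ → ℕ → ℂ) (β μ : L) : Polynomial L :=
  ∑ i ∈ Finset.range (c + 1), ∑ j ∈ Finset.range (d + 1),
    Polynomial.C (algebraMap ℂ L (A i j)) * Polynomial.C μ ^ (c - i)
      * (Polynomial.X - Polynomial.C β) ^ i * Polynomial.X ^ j

lemma lineY_comp (c d : ℕ) (A : ℕ → ℕ → ℂ) (β μ : L) :
    (lineY c d A β μ).comp (Polynomial.C μ * Polynomial.X + Polynomial.C β)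
      = Polynomial.C (μ ^ c) * lineRes (bi c d A) 0 β 1 μ := by
  rw [lineY, lineRes_bi, Polynomial.sum_comp, Finset.mul_sum]
  refine Finset.sum_congr rfl fun i hi => ?_
  rw [Polynomial.sum_comp, Finset.mul_sum]
  refine Finset.sum_congr rfl fun j _ => ?_
  have hi : i ≤ c := by simpa [Nat.lt_succ_iff] using hi
  have : Polynomial.C μ ^ c = Polynomial.C μ ^ (c - i) * Polynomial.C μ ^ i := by
    rw [← pow_add, Nat.sub_add_cancel hi]
  simp only [Polynomial.mul_comp, Polynomial.pow_comp, Polynomial.sub_comp, Polynomial.X_comp,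
    Polynomial.C_comp, map_pow, this, map_zero, map_one, zero_add, one_mul]
  simp only [add_sub_cancel_right, mul_pow]
  ring

/-- The polynomial restricted to the line at infinity. -/
def edgeP (c d : ℕ) (A : ℕ → ℕ → ℂ) : Polynomial ℂ :=
  ∑ j ∈ Finset.range (d + 1), Polynomial.C (A c j) * Polynomial.X ^ j

lemma edgeP_eval (c d : ℕ) (A : ℕ → ℕ → ℂ) (b : ℂ) :
    (edgeP c d A).eval b = ∑ j ∈ Finset.range (d + 1), A c j * b ^ j := by
  simp [edgeP, Polynomial.eval_finsetSum]

lemma edgeP_derivative_eval (c d : ℕ) (A : ℕ → ℕ → ℂ) (b : ℂ) :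
    (edgeP c d A).derivative.eval b
      = ∑ j ∈ Finset.range (d + 1), A c j * (j * b ^ (j - 1)) := by
  simp [edgeP, Polynomial.eval_finsetSum, Polynomial.derivative_sum, Polynomial.derivative_X_pow]

lemma lineY_near (hv : IsPlace v) (c d : ℕ) (A : ℕ → ℕ → ℂ) {β μ : L} {b : ℂ}
    (hβ : Near v β b) (hμ : Near v μ 0) :
    NearP v (lineY c d A β μ) ((Polynomial.X - Polynomial.C b) ^ c * edgeP c d A) := by
  have : (Polynomial.X - Polynomial.C b) ^ c * edgeP c d A
      = ∑ i ∈ Finset.range (c + 1), ∑ j ∈ Finset.range (d + 1),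
      Polynomial.C (A i j) * Polynomial.C 0 ^ (c - i)
      * (Polynomial.X - Polynomial.C b) ^ i * Polynomial.X ^ j := by
    rw [Finset.sum_range_succ, Finset.sum_eq_zero, zero_add, edgeP, Finset.mul_sum]
    · refine Finset.sum_congr rfl fun j _ => ?_
      simp; ring
    · intro i hi
      refine Finset.sum_eq_zero fun j _ => ?_
      have : c - i ≠ 0 := by have := Finset.mem_range.1 hi; omega
      simp [this]
  rw [this]
  exact NearP.sum _ fun i _ => NearP.sum _ fun j _ => (((nearP_C (near_const v _)).mul hv
    ((nearP_C hμ).pow hv _)).mul hv ((nearP_X.sub (nearP_C hβ)).pow hv _)).mul hv (nearP_X.pow hv _)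

lemma HalfGood.edge_roots_nodup (h : HalfGood c d A) :
    (edgeP c d A).roots.Nodup := by
  rw [Multiset.nodup_iff_count_le_one]
  intro b
  rw [Polynomial.count_roots]
  by_contra! hlt
  have h0 : edgeP c d A ≠ 0 := by
    intro h0; rw [h0] at hlt; simp at hlt
  obtain ⟨h1, h2⟩ := (Polynomial.one_lt_rootMultiplicity_iff_isRoot h0).1 hlt
  refine h.edge_simple b ?_ ?_
  · rw [← edgeP_eval]; exact h1
  · rw [← edgeP_derivative_eval]; exact h2

lemma edgeP_ne_zero (htop : A c d ≠ 0) : edgeP c d A ≠ 0 := by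
  intro h0
  have := congrArg (fun P => Polynomial.coeff P d) h0
  rw [edgeP] at this
  simp [Polynomial.finsetSum_coeff, Polynomial.coeff_X_pow] at this
  exact htop this

end

noncomputable section

section

variable {L : Type*} [Field L] [Algebra ℂ L] {c d : ℕ} {A : ℕ → ℕ → ℂ}

lemma lineY_natDegree (htop : A c d ≠ 0) {β μ : L} (hμ : μ ≠ 0) :
    (lineY c d A β μ).natDegree = c + d := by
  have h1 := congrArg Polynomial.natDegree (lineY_comp c d A β μ)
  rw [Polynomial.natDegree_comp, Polynomial.natDegree_linear hμ, mul_one,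
    Polynomial.natDegree_C_mul (pow_ne_zero _ hμ)] at h1
  rw [h1]
  refine le_antisymm (lineRes_bi_natDegree_le _ _ _ _ _ _ _)
    (Polynomial.le_natDegree_of_ne_zero ?_)
  rw [lineRes_bi_coeff_top]
  refine mul_ne_zero (mul_ne_zero ?_ (pow_ne_zero _ one_ne_zero)) (pow_ne_zero _ hμ)
  simpa using htop

lemma lineY_leadingCoeff (htop : A c d ≠ 0) {β μ : L} (hμ : μ ≠ 0) :
    (lineY c d A β μ).leadingCoeff = algebraMap ℂ L (A c d) := by
  have h1 := congrArg (fun P => Polynomial.coeff P (c + d)) (lineY_comp c d A β μ)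
  simp only [Polynomial.coeff_C_mul] at h1
  rw [lineRes_bi_coeff_top] at h1
  have h2 := Polynomial.leadingCoeff_comp (p := lineY c d A β μ)
    (q := Polynomial.C μ * Polynomial.X + Polynomial.C β)
    (by rw [Polynomial.natDegree_linear hμ]; exact one_ne_zero)
  rw [Polynomial.leadingCoeff, Polynomial.natDegree_comp, Polynomial.natDegree_linear hμ, mul_one,
    lineY_natDegree htop hμ, h1, Polynomial.leadingCoeff_linear hμ] at h2
  have h3 : μ ^ (c + d) ≠ 0 := pow_ne_zero _ hμ
  refine mul_right_cancel₀ h3 ?_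
  rw [← h2, pow_add]; ring

lemma lineY_roots {β μ : L} (hμ : μ ≠ 0) :
    (lineY c d A β μ).roots = (lineRes (bi c d A) 0 β 1 μ).roots.map (fun z => μ * z + β) := by
  rw [← Polynomial.map_roots_comp_C_mul_X_add_C _ μ β hμ.isUnit, lineY_comp,
    Polynomial.roots_C_mul _ (pow_ne_zero _ hμ)]

lemma lineRes_roots {x y p q : L} (htop : A c d ≠ 0) (hcd : 2 ≤ c + d)
    (hf : ev[x, y] (bi c d A) = 0)
    (hp : ev[x, y] (pderiv 0 (bi c d A)) = p) (hq : ev[x, y] (pderiv 1 (bi c d A)) = q)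
    (hp0 : p ≠ 0) (hq0 : q ≠ 0) :
    (lineRes (bi c d A) 0 (y - -p / q * x) 1 (-p / q)).roots
      = x ::ₘ x ::ₘ (tanResid (bi c d A) x y).roots.map (fun t => q * t + x) := by
  rw [← Polynomial.map_roots_comp_C_mul_X_add_C _ q x hq0.isUnit]
  have : (Polynomial.C q * Polynomial.X + Polynomial.C x)
    = Polynomial.C x + Polynomial.C q * Polynomial.X := add_comm _ _
  rw [this, lineRes_comp]
  have h2 : lineRes (bi c d A) (0 + 1 * x) (y - -p / q * x + -p / q * x) (1 * q) (-p / q * q)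
      = tanRes (bi c d A) x y := by
    rw [tanRes, hp, hq]
    congr 1 <;> field_simp <;> ring
  rw [h2, tanRes_eq _ hf, Polynomial.roots_mul, Polynomial.roots_pow, Polynomial.roots_X]
  · rw [two_nsmul, Multiset.map_add, Multiset.map_add, Multiset.map_singleton, mul_zero, zero_add,
      add_assoc, Multiset.singleton_add, Multiset.singleton_add]
  · refine mul_ne_zero (pow_ne_zero _ Polynomial.X_ne_zero) (tanResid_ne_zero hcd htop ?_ ?_)
    · rwa [hp]
    · rwa [hq]

end

variable {L Γ : Type*} [Field L] [Algebra ℂ L] [LinearOrderedCommGroupWithZero Γ]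
  {v : Valuation L Γ} {c d : ℕ} {A : ℕ → ℕ → ℂ}

/-- The valuation of a discriminant whose roots are separated by two families of residues. -/
lemma val_discr_two_scales [IsAlgClosed L] (hv : IsPlace v) {R : Polynomial L}
    {m k : ℕ}
    (hm : R.natDegree = m) (h0 : R ≠ 0) (P : L → Prop) [DecidablePred P] {p q x y : L} {b : ℂ}
    (hk : (R.roots.filter P).card = k)
    (hbound : ∀ t ∈ R.roots, P t → v (q * t + x) ≤ 1)
    (hbound' : ∀ t ∈ R.roots, v (y - p * t) ≤ 1)
    (hb : ∀ t ∈ R.roots, P t → resid v (y - p * t) = b)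
    (H1 : ((R.roots.filter P).map (fun t => resid v (q * t + x))).Nodup)
    (H2 : (b ::ₘ (R.roots.filter (fun t => ¬ P t)).map (fun t => resid v (y - p * t))).Nodup) :
    v (Polynomial.resultant R R.derivative m (m - 1)) * v q ^ (k * (k - 1))
      * v p ^ (m * (m - 1) - k * (k - 1)) = v R.leadingCoeff ^ (m - 1 + m) := by
  classical
  rw [Multiset.nodup_cons] at H2
  have hbn : ∀ t ∈ R.roots, ¬ P t → resid v (y - p * t) ≠ b := by
    intro t ht hP h
    exact H2.1 (Multiset.mem_map.2 ⟨t, Multiset.mem_filter.2 ⟨ht, hP⟩, h⟩)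
  have hnd : R.roots.Nodup := by
    rw [← Multiset.filter_add_not P R.roots, Multiset.nodup_add]
    refine ⟨H1.of_map, H2.2.of_map, ?_⟩
    rw [Multiset.disjoint_left]
    intro t h1 h2
    exact (Multiset.mem_filter.1 h2).2 (Multiset.mem_filter.1 h1).2
  have sep : ∀ z w : L, v z ≤ 1 → v w ≤ 1 → resid v z ≠ resid v w → v (z - w) = 1 := by
    intro z w hz hw hne
    exact ((near_resid hv hz).sub (near_resid hv hw)).eq_one hv (sub_ne_zero.2 hne)
  let S : Finset L := ⟨R.roots, hnd⟩
  rw [val_resultant_derivative v hm h0 S rfl]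
  have := prod_offDiag_two_values S P (fun s t => v (s - t)) (v q) (v p) ?_ ?_ (m := m) (k := k)
    ?_ ?_
  · rw [mul_assoc, mul_assoc, ← mul_assoc (∏ z ∈ S.offDiag, v (z.1 - z.2)), this, mul_one]
  · intro s hs t ht hne h1 h2
    have h3 := sep _ _ (hbound s hs h1) (hbound t ht h2) fun he =>
      hne (Multiset.inj_on_of_nodup_map H1 s (Multiset.mem_filter.2 ⟨hs, h1⟩) t
        (Multiset.mem_filter.2 ⟨ht, h2⟩) he)
    rw [← map_mul, ← h3]
    congr 1; ring
  · intro s hs t ht hne hst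
    have h3 := sep _ _ (hbound' t ht) (hbound' s hs) ?_
    · rw [← map_mul, ← h3]
      congr 1; ring
    · by_cases h1 : P s
      · have h2 : ¬ P t := fun h2 => hst ⟨h1, h2⟩
        rw [hb s hs h1]
        exact hbn t ht h2
      · by_cases h2 : P t
        · rw [hb t ht h2]
          exact (hbn s hs h1).symm
        · intro he
          exact hne (Multiset.inj_on_of_nodup_map H2.2 t (Multiset.mem_filter.2 ⟨ht, h2⟩) s
            (Multiset.mem_filter.2 ⟨hs, h1⟩) he).symm
  · rw [← hm, ← IsAlgClosed.card_roots_eq_natDegree]; rfl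
  · rw [← hk]; rfl

end

noncomputable section

lemma lineRes_hor_natDegree_le (c d : ℕ) (A : ℕ → ℕ → ℂ) (b : ℂ) :
    (lineRes (bi c d A) 0 b 1 0).natDegree ≤ c := by
  rw [lineRes_bi]
  refine Polynomial.natDegree_sum_le_of_forall_le _ _ fun i hi => ?_
  refine Polynomial.natDegree_sum_le_of_forall_le _ _ fun j _ => ?_
  have hi : i ≤ c := by simpa [Nat.lt_succ_iff] using hi
  simp only [map_zero, zero_mul, add_zero, zero_add, map_one, one_mul, ← map_pow]
  refine (Polynomial.natDegree_mul_C_le _ _).trans ((Polynomial.natDegree_C_mul_X_pow_le _ _).trans hi)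

lemma lineRes_hor_coeff (c d : ℕ) (A : ℕ → ℕ → ℂ) (b : ℂ) {k : ℕ} (hk : k ≤ c) :
    (lineRes (bi c d A) 0 b 1 0).coeff k = ∑ j ∈ Finset.range (d + 1), A k j * b ^ j := by
  rw [lineRes_bi, Polynomial.finsetSum_coeff, Finset.sum_eq_single k]
  · rw [Polynomial.finsetSum_coeff]
    refine Finset.sum_congr rfl fun j _ => ?_
    simp only [map_zero, zero_mul, add_zero, zero_add, map_one, one_mul, ← map_pow,
      Polynomial.coeff_mul_C, Polynomial.coeff_C_mul, Polynomial.coeff_X_pow_self, mul_one]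
    rfl
  · intro i _ hne
    rw [Polynomial.finsetSum_coeff]
    refine Finset.sum_eq_zero fun j _ => ?_
    simp only [map_zero, zero_mul, add_zero, zero_add, map_one, one_mul, ← map_pow,
      Polynomial.coeff_mul_C, Polynomial.coeff_C_mul, Polynomial.coeff_X_pow]
    rw [if_neg hne.symm]; simp
  · intro h
    exact absurd (Finset.mem_range.2 (Nat.lt_succ_of_le hk)) h

lemma HalfGood.lineRes_hor_natDegree (h : HalfGood c d A) (hc : 1 ≤ c) (b : ℂ) :
    (lineRes (bi c d A) 0 b 1 0).natDegree
      = if (edgeP c d A).eval b = 0 then c - 1 else c := by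
  split_ifs with he
  · refine le_antisymm ?_ (Polynomial.le_natDegree_of_ne_zero ?_)
    · rw [Polynomial.natDegree_le_iff_coeff_eq_zero]
      intro N hN
      by_cases hNc : N = c
      · rw [hNc, lineRes_hor_coeff _ _ _ _ le_rfl, ← edgeP_eval, he]
      · exact Polynomial.coeff_eq_zero_of_natDegree_lt
          ((lineRes_hor_natDegree_le c d A b).trans_lt (by omega))
    · rw [lineRes_hor_coeff _ _ _ _ (Nat.sub_le _ _)]
      rw [edgeP_eval] at he
      exact h.edge_next b he
  · refine le_antisymm (lineRes_hor_natDegree_le _ _ _ _) (Polynomial.le_natDegree_of_ne_zero ?_)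
    rwa [lineRes_hor_coeff _ _ _ _ le_rfl, ← edgeP_eval]

lemma HalfGood.lineRes_hor_ne_zero (h : HalfGood c d A) (b : ℂ) :
    lineRes (bi c d A) 0 b 1 0 ≠ 0 := by
  intro h0
  exact h.hor3 b 0 (h0 ▸ dvd_zero _)

variable {L Γ : Type*} [Field L] [Algebra ℂ L] [LinearOrderedCommGroupWithZero Γ]
  {v : Valuation L Γ} {c d : ℕ} {A : ℕ → ℕ → ℂ}

/-- The valuation of the discriminant on nearly horizontal tangent lines. -/
lemma HalfGood.near_horizontal [IsAlgClosed L] (h : HalfGood c d A) (hcd : 2 ≤ c + d) (hc : 1 ≤ c)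
    (hv : IsPlace v) {x y p q : L} {b : ℂ} (hf : ev[x, y] (bi c d A) = 0)
    (hp : ev[x, y] (pderiv 0 (bi c d A)) = p) (hq : ev[x, y] (pderiv 1 (bi c d A)) = q)
    (hp0 : p ≠ 0) (hq0 : q ≠ 0) (hy : Near v y b) (hμ : v (p / q) < 1) (hμx : v (p / q * x) < 1)
    (hdeg : (v x ≤ 1 ∧ (edgeP c d A).eval b ≠ 0) ∨ (¬ v x ≤ 1 ∧ (edgeP c d A).eval b = 0)) :
    let k := if (edgeP c d A).eval b = 0 then c - 1 else c - 2
    v (ev[x, y] (bitDisc (c + d) (bi c d A))) * v q ^ (k * (k - 1))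
      * v p ^ ((c + d - 2) * (c + d - 2 - 1) - k * (k - 1))
      = (v q ^ c * v p ^ d) ^ (c + d - 2 - 1 + (c + d - 2)) := by
  intro k
  classical
  have hpx : ev[x, y] (pderiv 0 (bi c d A)) ≠ 0 := by rwa [hp]
  have hqx : ev[x, y] (pderiv 1 (bi c d A)) ≠ 0 := by rwa [hq]
  set R := tanResid (bi c d A) x y with hRdef
  have hm := tanResid_natDegree hcd h.top hpx hqx
  have h0 := tanResid_ne_zero hcd h.top hpx hqx
  have hlc : v R.leadingCoeff = v q ^ c * v p ^ d := by
    rw [Polynomial.leadingCoeff, hm, tanResid_coeff_top hcd, hp, hq, map_mul, map_mul, map_pow,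
      map_pow, Valuation.map_neg, (near_const v (A c d)).eq_one hv h.top, one_mul]
  rw [← hlc, ev_bitDisc]
  have hμ0 : -p / q ≠ 0 := div_ne_zero (neg_ne_zero.2 hp0) hq0
  have hμn : Near v (-p / q) 0 := by
    rw [near_zero_iff, neg_div, Valuation.map_neg]; exact hμ
  have hβ : Near v (y - -p / q * x) b := by
    have h1 : Near v (-p / q * x) 0 := by
      rw [near_zero_iff, neg_div, neg_mul, Valuation.map_neg]; exact hμx
    simpa only [sub_zero] using hy.sub h1
  have hx1 := lineRes_roots h.top hcd hf hp hq hp0 hq0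
  have hy1 := lineY_roots (c := c) (d := d) (A := A) (β := y - -p / q * x) hμ0
  rw [hx1, Multiset.map_cons, Multiset.map_cons, Multiset.map_map] at hy1
  have e1 : -p / q * x + (y - -p / q * x) = y := by ring
  have e2 : (fun z => -p / q * z + (y - -p / q * x)) ∘ (fun t => q * t + x)
      = fun t => y - p * t := by
    funext t
    simp only [Function.comp]
    field_simp
    ring
  rw [e1, e2] at hy1
  obtain ⟨hY, hYint⟩ := (lineY_near hv c d A hβ hμn).roots_eq_of_lc hv
    (mul_ne_zero (pow_ne_zero _ (Polynomial.X_sub_C_ne_zero b)) (edgeP_ne_zero h.top))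
    (by rw [lineY_leadingCoeff h.top hμ0, (near_const v (A c d)).eq_one hv h.top])
  rw [hy1] at hY hYint
  rw [Polynomial.roots_mul (mul_ne_zero (pow_ne_zero _ (Polynomial.X_sub_C_ne_zero b))
    (edgeP_ne_zero h.top)), Polynomial.roots_pow, Polynomial.roots_X_sub_C, Multiset.map_cons,
    Multiset.map_cons, Multiset.map_map, hy.resid_eq hv] at hY
  have hφ := h.lineRes_hor_ne_zero b
  obtain ⟨hX, -⟩ := (NearP.lineRes hv (bi c d A) (near_zero_iff.2 (by simp) : Near v (0 : L) 0) hβ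
    (by simpa using near_const v 1 : Near v (1 : L) 1) hμn).roots_eq hv hφ
  have hcard : (lineRes (bi c d A) 0 b 1 0).roots.card
      = if (edgeP c d A).eval b = 0 then c - 1 else c := by
    rw [IsAlgClosed.card_roots_eq_natDegree, h.lineRes_hor_natDegree hc]
  rw [hx1] at hX
  set P : L → Prop := fun t => v (q * t + x) ≤ 1 with hP
  have hfm : ((R.roots.map (fun t => q * t + x)).filter (fun z => v z ≤ 1)).map (resid v)
      = (R.roots.filter P).map (fun t => resid v (q * t + x)) := by
    rw [Multiset.filter_map, Multiset.map_map]; rfl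
  have hbound' : ∀ t ∈ R.roots, v (y - p * t) ≤ 1 := fun t ht =>
    hYint _ (Multiset.mem_cons_of_mem (Multiset.mem_cons_of_mem
      (Multiset.mem_map_of_mem _ ht)))
  have hb : ∀ t ∈ R.roots, P t → resid v (y - p * t) = b := by
    intro t _ hPt
    refine Near.resid_eq hv ?_
    have : y - p * t = -p / q * (q * t + x) + (y - -p / q * x) := by field_simp; ring
    rw [this]
    have h1 : Near v (-p / q * (q * t + x)) 0 := by
      have := hμn.mul hv (near_resid hv hPt)
      rwa [zero_mul] at this
    simpa only [zero_add] using h1.add hβ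
  have key : ∀ k' : ℕ, (R.roots.filter P).card = k' →
      c • {b} + (edgeP c d A).roots = b ::ₘ b ::ₘ (Multiset.replicate k' b
        + (R.roots.filter (fun t => ¬ P t)).map (fun t => resid v (y - p * t))) := by
    intro k' hk'
    rw [hY]
    congr 2
    conv_lhs => rw [← Multiset.filter_add_not P R.roots, Multiset.map_add]
    congr 1
    rw [Multiset.eq_replicate]
    refine ⟨by rw [Multiset.card_map, hk'], ?_⟩
    intro z hz
    obtain ⟨t, ht, rfl⟩ := Multiset.mem_map.1 hz
    exact hb t (Multiset.mem_filter.1 ht).1 (Multiset.mem_filter.1 ht).2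
  rcases hdeg with ⟨hxi, he⟩ | ⟨hxi, he⟩
  · rw [if_neg he] at hcard
    have hk : k = c - 2 := if_neg he
    rw [Multiset.filter_cons_of_pos (p := fun z => v z ≤ 1) _ hxi,
      Multiset.filter_cons_of_pos (p := fun z => v z ≤ 1) _ hxi, Multiset.map_cons,
      Multiset.map_cons, hfm] at hX
    rw [hX, Multiset.card_cons, Multiset.card_cons, Multiset.card_map] at hcard
    have hkc : (R.roots.filter P).card = k := by omega
    have hc2 : c = k + 2 := by omega
    refine val_discr_two_scales hv hm h0 P hkc (fun t _ h => h) hbound' hb ?_ ?_ (b := b)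
    · rw [Multiset.nodup_iff_count_le_one]
      intro s
      by_contra! hlt
      have h1 : (resid v x ::ₘ resid v x ::ₘ s ::ₘ s ::ₘ 0)
          ≤ (lineRes (bi c d A) 0 b 1 0).roots := by
        rw [hX]
        refine Multiset.cons_le_cons _ (Multiset.cons_le_cons _ ?_)
        have := Multiset.le_count_iff_replicate_le.1 hlt
        simpa using this
      rw [← Multiset.prod_X_sub_C_dvd_iff_le_roots hφ] at h1
      refine h.hor22 b (resid v x) s ((Eq.dvd ?_).trans h1)
      simp [trip]
      ring
    · have h2 := key k hkc
      have h3 : c • ({b} : Multiset ℂ) = b ::ₘ b ::ₘ Multiset.replicate k b := by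
        rw [Multiset.nsmul_singleton, hc2, Multiset.replicate_succ, Multiset.replicate_succ]
      rw [h3, Multiset.cons_add, Multiset.cons_add, Multiset.cons_inj_right,
        Multiset.cons_inj_right, add_right_inj] at h2
      rw [← h2, Multiset.nodup_cons]
      refine ⟨fun hb' => he ?_, h.edge_roots_nodup⟩
      exact (Polynomial.mem_roots (edgeP_ne_zero h.top)).1 hb'
  · rw [if_pos he] at hcard
    have hk : k = c - 1 := if_pos he
    rw [Multiset.filter_cons_of_neg (p := fun z => v z ≤ 1) _ hxi,
      Multiset.filter_cons_of_neg (p := fun z => v z ≤ 1) _ hxi, hfm] at hX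
    rw [hX, Multiset.card_map] at hcard
    have hkc : (R.roots.filter P).card = k := by omega
    have hc2 : c = k + 1 := by omega
    refine val_discr_two_scales hv hm h0 P hkc (fun t _ h => h) hbound' hb ?_ ?_ (b := b)
    · rw [← hX, Multiset.nodup_iff_count_le_one]
      intro s
      rw [Polynomial.count_roots]
      by_contra! hlt
      obtain ⟨h1, h2⟩ := (Polynomial.one_lt_rootMultiplicity_iff_isRoot hφ).1 hlt
      rw [Polynomial.IsRoot, lineRes_eval] at h1
      rw [Polynomial.IsRoot, lineRes_derivative] at h2
      simp only [Polynomial.eval_add, Polynomial.eval_mul, Polynomial.eval_C, mul_one,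
        mul_zero, add_zero, lineRes_eval] at h2
      simp only [zero_add, one_mul, zero_mul, add_zero] at h1 h2
      rw [edgeP_eval] at he
      exact h.edge_hor s b he h1 h2
    · have h2 := key k hkc
      have h3 : c • ({b} : Multiset ℂ) = b ::ₘ Multiset.replicate k b := by
        rw [Multiset.nsmul_singleton, hc2, Multiset.replicate_succ]
      rw [h3, Multiset.cons_add, Multiset.cons_inj_right, ← Multiset.add_cons, add_right_inj] at h2
      rw [← h2]
      exact h.edge_roots_nodup

end

noncomputable section

/-- The monomial in the partial derivatives measuring the degeneration of the discriminant. -/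
def gradU (c d : ℕ) (f : MvPolynomial (Fin 2) ℂ) : MvPolynomial (Fin 2) ℂ :=
  pderiv 0 f ^ d ^ 2 * pderiv 1 f ^ c ^ 2

lemma tanResid_tr {L : Type*} [Field L] [Algebra ℂ L] {c d : ℕ} {A : ℕ → ℕ → ℂ} {x y : L}
    (hf : ev[x, y] (bi c d A) = 0) :
    tanResid (bi d c (tr A)) y x = (tanResid (bi c d A) x y).comp (-Polynomial.X) := by
  have h1 : tanRes (bi d c (tr A)) y x = (tanRes (bi c d A) x y).comp (-Polynomial.X) := by
    have : (-Polynomial.X : Polynomial L) = Polynomial.C 0 + Polynomial.C (-1) * Polynomial.X := by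
      simp
    rw [tanRes, tanRes, this, lineRes_comp, lineRes_tr, bi_tr_pderiv_one, bi_tr_pderiv_zero]
    congr 1 <;> ring
  rw [tanRes_eq _ hf, tanRes_eq _ (by rw [bi_tr]; exact hf), Polynomial.mul_comp,
    Polynomial.pow_comp, Polynomial.X_comp, neg_sq] at h1
  exact mul_left_cancel₀ (pow_ne_zero _ Polynomial.X_ne_zero) h1

variable {L Γ : Type*} [Field L] [Algebra ℂ L] [LinearOrderedCommGroupWithZero Γ]
  {v : Valuation L Γ} {c d : ℕ} {A : ℕ → ℕ → ℂ}

lemma val_bitDisc_tr [IsAlgClosed L] (hcd : 2 ≤ c + d) (htop : A c d ≠ 0) (v : Valuation L Γ)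
    {x y : L} (hf : ev[x, y] (bi c d A) = 0)
    (hp : ev[x, y] (pderiv 0 (bi c d A)) ≠ 0) (hq : ev[x, y] (pderiv 1 (bi c d A)) ≠ 0) :
    v (ev[y, x] (bitDisc (d + c) (bi d c (tr A)))) = v (ev[x, y] (bitDisc (c + d) (bi c d A))) := by
  have hm := tanResid_natDegree hcd htop hp hq
  rw [ev_bitDisc, ev_bitDisc, tanResid_tr hf, add_comm d c]
  set R := tanResid (bi c d A) x y
  have hX : (-Polynomial.X : Polynomial L).natDegree = 1 := by simp
  have hm' : (R.comp (-Polynomial.X)).natDegree = c + d - 2 := by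
    rw [Polynomial.natDegree_comp, hX, mul_one, hm]
  rw [resultant_derivative_eq hm, resultant_derivative_eq hm', Polynomial.leadingCoeff_comp (by simp),
    Polynomial.roots_comp_neg_X, Multiset.map_map, map_mul, map_mul, map_pow, map_pow, map_mul,
    map_pow, Polynomial.leadingCoeff_neg, Polynomial.leadingCoeff_X, Valuation.map_neg, map_one,
    one_pow, mul_one, map_multiset_prod, map_multiset_prod, Multiset.map_map, Multiset.map_map]
  congr 2
  refine Multiset.map_congr rfl fun t _ => ?_
  simp only [Function.comp, Polynomial.derivative_comp, Polynomial.eval_mul, Polynomial.eval_comp,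
    Polynomial.eval_neg, Polynomial.eval_X, neg_neg, Polynomial.derivative_neg,
    Polynomial.derivative_X, Polynomial.eval_one, neg_one_mul, Valuation.map_neg]

lemma val_gradU_tr (v : Valuation L Γ) {x y : L} :
    v (ev[y, x] (gradU d c (bi d c (tr A)))) = v (ev[x, y] (gradU c d (bi c d A))) := by
  simp only [gradU, map_mul, map_pow, bi_tr_pderiv_zero, bi_tr_pderiv_one]
  exact mul_comm _ _

lemma Good.bitDisc_horizontal [IsAlgClosed L] (h : Good c d A) (hc : 5 ≤ c) (hd : 5 ≤ d)
    (hv : IsPlace v) {x y : L} {a b : ℂ} (hx : Near v x a) (hy : Near v y b)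
    (hf : ev[x, y] (bi c d A) = 0)
    (hp : ev[x, y] (pderiv 0 (bi c d A)) ≠ 0) (hp0 : ev[a, b] (pderiv 0 (bi c d A)) = 0) :
    v (ev[x, y] (bitDisc (c + d) (bi c d A))) = v (ev[x, y] (gradU c d (bi c d A))) := by
  have hf0 : ev[a, b] (bi c d A) = 0 := by
    have := hx.aeval hv hy (bi c d A)
    rw [hf] at this
    exact (this.lt_one_iff hv).1 (by simp)
  have hq0 := h.left.smooth a b hf0 hp0
  have hvq := (hx.aeval hv hy (pderiv 1 (bi c d A))).eq_one hv hq0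
  have hvp : v (ev[x, y] (pderiv 0 (bi c d A))) < 1 :=
    ((hx.aeval hv hy (pderiv 0 (bi c d A))).lt_one_iff hv).2 hp0
  have hq : ev[x, y] (pderiv 1 (bi c d A)) ≠ 0 := by
    intro h0; rw [h0] at hvq; simp at hvq
  have he : (edgeP c d A).eval b ≠ 0 := by
    intro he
    rw [edgeP_eval] at he
    exact h.left.edge_hor a b he hf0 hp0
  have hvx := hx.le hv
  have key := h.left.near_horizontal (by omega) (by omega) hv hf rfl rfl hp hq hy
    (by rw [map_div₀, hvq, div_one]; exact hvp)
    (by rw [map_mul, map_div₀, hvq, div_one]; exact mul_lt_one_of_lt_of_le hvp hvx)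
    (Or.inl ⟨hvx, he⟩)
  simp only [if_neg he, hvq, one_pow, mul_one, one_mul] at key
  rw [gradU, map_mul, map_mul, map_pow, map_pow, map_pow, map_pow, hvq, one_pow, mul_one]
  have hvp0 := (Valuation.ne_zero_iff v).2 hp
  refine mul_right_cancel₀ (pow_ne_zero _ hvp0) (key.trans ?_)
  rw [← pow_mul, ← pow_add]
  congr 1
  obtain ⟨l, rfl⟩ := Nat.exists_eq_add_of_le' hc
  obtain ⟨e, rfl⟩ := Nat.exists_eq_add_of_le' hd
  have e1 : l + 5 + (e + 5) - 2 = l + e + 8 := by omega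
  have e2 : l + 5 - 2 = l + 3 := by omega
  rw [e1, e2]
  simp only [Nat.add_sub_cancel, show l + e + 8 - 1 = l + e + 7 by omega,
    show l + 3 - 1 = l + 2 by omega]
  have e3 : (l + e + 8) * (l + e + 7) - (l + 3) * (l + 2)
    = (e + 5) * (2 * l + e + 10) := by
    refine Nat.sub_eq_of_eq_add ?_
    ring
  rw [e3]
  ring

lemma Good.bitDisc_near [IsAlgClosed L] [CharZero L] (h : Good c d A) (hc : 5 ≤ c) (hd : 5 ≤ d)
    (hv : IsPlace v) {x y : L} {a b : ℂ} (hx : Near v x a) (hy : Near v y b)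
    (hf : ev[x, y] (bi c d A) = 0)
    (hp : ev[x, y] (pderiv 0 (bi c d A)) ≠ 0) (hq : ev[x, y] (pderiv 1 (bi c d A)) ≠ 0)
    (hxa : x ≠ algebraMap ℂ L a) :
    ((∃ τ, IsBit (bi c d A) a b τ) → v (ev[x, y] (bitDisc (c + d) (bi c d A)))
      = v (ev[x, y] (gradU c d (bi c d A))) * v (x - algebraMap ℂ L a)) ∧
    ((¬ ∃ τ, IsBit (bi c d A) a b τ) → v (ev[x, y] (bitDisc (c + d) (bi c d A)))
      = v (ev[x, y] (gradU c d (bi c d A)))) := by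
  have hf0 : ev[a, b] (bi c d A) = 0 := by
    have := hx.aeval hv hy (bi c d A)
    rw [hf] at this
    exact (this.lt_one_iff hv).1 (by simp)
  have hU : ev[a, b] (pderiv 0 (bi c d A)) ≠ 0 → ev[a, b] (pderiv 1 (bi c d A)) ≠ 0 →
      v (ev[x, y] (gradU c d (bi c d A))) = 1 := by
    intro hp0 hq0
    rw [gradU, map_mul, map_mul, map_pow, map_pow, map_pow, map_pow,
      (hx.aeval hv hy (pderiv 1 (bi c d A))).eq_one hv hq0,
      (hx.aeval hv hy (pderiv 0 (bi c d A))).eq_one hv hp0, one_pow, one_pow, mul_one]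
  constructor
  · rintro ⟨τ, hB⟩
    rw [h.bitDisc_near_bit (by omega) hv hx hy hf hB hxa, hU hB.dx hB.dy, one_mul]
  · intro hB
    by_cases hp0 : ev[a, b] (pderiv 0 (bi c d A)) = 0
    · exact h.bitDisc_horizontal hc hd hv hx hy hf hp hp0
    · by_cases hq0 : ev[a, b] (pderiv 1 (bi c d A)) = 0
      · rw [← val_bitDisc_tr (by omega) h.left.top v hf hp hq, ← val_gradU_tr]
        refine h.swap.bitDisc_horizontal hd hc hv hy hx ?_ ?_ ?_
        · rw [bi_tr]; exact hf
        · rw [bi_tr_pderiv_zero]; exact hq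
        · rw [bi_tr_pderiv_zero]; exact hq0
      · rw [hU hp0 hq0]
        exact (hx.aeval hv hy _).eq_one hv
          (h.bitDisc_near_ne (by omega) hf0 hp0 hq0 fun τ hτ => hB ⟨τ, hτ⟩)

lemma Good.bitDisc_infty [IsAlgClosed L] (h : Good c d A) (hc : 5 ≤ c) (hd : 5 ≤ d)
    (hv : IsPlace v) {x y : L} (hx : 1 < v x) (hf : ev[x, y] (bi c d A) = 0) :
    (ev[x, y] (pderiv 0 (bi c d A)) ≠ 0 ∧ ev[x, y] (pderiv 1 (bi c d A)) ≠ 0) ∧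
    v (ev[x, y] (bitDisc (c + d) (bi c d A)))
      = v (ev[x, y] (gradU c d (bi c d A))) * v x ^ (2 * c ^ 2 * d + 8 - 10 * c) := by
  have hy := near_resid hv (le_one_of_infty hv h.left.top hx hf)
  obtain ⟨h1, h2, h3, -⟩ := h.at_infty (by omega) hv hx hf hy
  have hx0 := ne_zero_of_one_lt hx
  have hV0 : v x ≠ 0 := (Valuation.ne_zero_iff v).2 hx0
  have hq : ev[x, y] (pderiv 1 (bi c d A)) ≠ 0 := by
    rw [← Valuation.ne_zero_iff v, h2]; exact pow_ne_zero _ hV0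
  have hvp : v (ev[x, y] (pderiv 0 (bi c d A))) = v x ^ (c - 2) := by
    refine mul_right_cancel₀ (pow_ne_zero 2 hV0) (h3.trans ?_)
    rw [← pow_add]; congr 1; omega
  have hp : ev[x, y] (pderiv 0 (bi c d A)) ≠ 0 := by
    rw [← Valuation.ne_zero_iff v, hvp]; exact pow_ne_zero _ hV0
  refine ⟨⟨hp, hq⟩, ?_⟩
  have he : (edgeP c d A).eval (resid v y) = 0 := by rw [edgeP_eval]; exact h1
  have hpq : v (ev[x, y] (pderiv 0 (bi c d A)) / ev[x, y] (pderiv 1 (bi c d A)) * x)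
      = (v x)⁻¹ := by
    rw [map_mul, map_div₀, h2]
    refine eq_inv_of_mul_eq_one_left ?_
    rw [div_mul_eq_mul_div, div_mul_eq_mul_div, mul_assoc, ← sq, h3,
      div_self (pow_ne_zero _ hV0)]
  have hinv : (v x)⁻¹ < 1 := inv_lt_one_of_one_lt₀ hx
  have key := h.left.near_horizontal (by omega) (by omega) hv hf rfl rfl hp hq hy
    (by
      refine lt_of_le_of_lt ?_ (hpq.trans_lt hinv)
      rw [map_mul]
      exact le_mul_of_one_le_right' hx.le)
    (hpq.trans_lt hinv) (Or.inr ⟨not_le.2 hx, he⟩)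
  simp only [if_pos he, h2, hvp] at key
  rw [gradU, map_mul, map_mul, map_pow, map_pow, map_pow, map_pow, h2, hvp]
  refine mul_right_cancel₀ (pow_ne_zero ((c - 1) * (c - 1 - 1)) (pow_ne_zero c hV0))
    (mul_right_cancel₀ (pow_ne_zero ((c + d - 2) * (c + d - 2 - 1) - (c - 1) * (c - 1 - 1))
    (pow_ne_zero (c - 2) hV0)) (key.trans ?_))
  simp only [← pow_mul, ← pow_add]
  congr 1
  have hle : 10 * c ≤ 2 * c ^ 2 * d + 8 := by nlinarith [Nat.mul_le_mul hc hd]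
  obtain ⟨E, hE⟩ := Nat.exists_eq_add_of_le' hle
  rw [hE, Nat.add_sub_cancel]
  obtain ⟨l, rfl⟩ := Nat.exists_eq_add_of_le' hc
  obtain ⟨e, rfl⟩ := Nat.exists_eq_add_of_le' hd
  simp only [show l + 5 + (e + 5) - 2 = l + e + 8 by omega, show l + 5 - 2 = l + 3 by omega,
    show l + 5 - 1 = l + 4 by omega,
    show l + e + 8 - 1 = l + e + 7 by omega, show l + 4 - 1 = l + 3 by omega]
  have e3 : (l + e + 8) * (l + e + 7) - (l + 4) * (l + 3)
    = (e + 4) * (2 * l + e + 11) := by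
    refine Nat.sub_eq_of_eq_add ?_
    ring
  rw [e3]
  zify at hE ⊢
  linear_combination hE

lemma Good.bitDisc_infty' [IsAlgClosed L] (h : Good c d A) (hc : 5 ≤ c) (hd : 5 ≤ d)
    (hv : IsPlace v) {x y : L} (hy : 1 < v y) (hf : ev[x, y] (bi c d A) = 0) :
    v (ev[x, y] (bitDisc (c + d) (bi c d A)))
      = v (ev[x, y] (gradU c d (bi c d A))) * v y ^ (2 * d ^ 2 * c + 8 - 10 * d) := by
  obtain ⟨⟨hq, hp⟩, h1⟩ := h.swap.bitDisc_infty hd hc hv hy (by rw [bi_tr]; exact hf)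
  rw [bi_tr_pderiv_zero] at hq
  rw [bi_tr_pderiv_one] at hp
  rw [← val_bitDisc_tr (by omega) h.left.top v hf hp hq, h1, val_gradU_tr]

end

noncomputable section

section
variable {R : Type*} [CommRing R] [Algebra ℂ R]

lemma lineRes_vert_natDegree_le (c d : ℕ) (A : ℕ → ℕ → ℂ) (x : R) :
    (lineRes (bi c d A) x 0 0 1).natDegree ≤ d := by
  rw [lineRes_bi]
  refine Polynomial.natDegree_sum_le_of_forall_le _ _ fun i _ => ?_
  refine Polynomial.natDegree_sum_le_of_forall_le _ _ fun j hj => ?_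
  have hj : j ≤ d := by simpa [Nat.lt_succ_iff] using hj
  simp only [map_zero, zero_mul, add_zero, zero_add, map_one, one_mul, ← map_pow, ← map_mul]
  exact (Polynomial.natDegree_C_mul_X_pow_le _ _).trans hj

lemma lineRes_vert_coeff (c d : ℕ) (A : ℕ → ℕ → ℂ) (x : R) :
    (lineRes (bi c d A) x 0 0 1).coeff d = Polynomial.aeval x (edgeP d c (tr A)) := by
  rw [lineRes_bi, Polynomial.finsetSum_coeff, edgeP, map_sum]
  refine Finset.sum_congr rfl fun i _ => ?_
  rw [Polynomial.finsetSum_coeff, Finset.sum_eq_single d]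
  · simp only [map_zero, zero_mul, add_zero, zero_add, map_one, one_mul, ← map_pow, ← map_mul,
      Polynomial.coeff_C_mul, Polynomial.coeff_X_pow_self, mul_one]
    simp [tr]
  · intro j _ hne
    simp only [map_zero, zero_mul, add_zero, zero_add, map_one, one_mul, ← map_pow, ← map_mul,
      Polynomial.coeff_C_mul, Polynomial.coeff_X_pow]
    rw [if_neg hne.symm, mul_zero]
  · intro h
    exact absurd (Finset.mem_range.2 (Nat.lt_succ_self d)) h

end

lemma edgeP_natDegree {c d : ℕ} {A : ℕ → ℕ → ℂ} (htop : A c d ≠ 0) :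
    (edgeP c d A).natDegree = d := by
  refine le_antisymm ?_ (Polynomial.le_natDegree_of_ne_zero ?_)
  · rw [edgeP]
    refine Polynomial.natDegree_sum_le_of_forall_le _ _ fun j hj => ?_
    exact (Polynomial.natDegree_C_mul_X_pow_le _ _).trans (Nat.lt_succ_iff.1 (Finset.mem_range.1 hj))
  · rw [edgeP]
    simpa [Polynomial.finsetSum_coeff, Polynomial.coeff_X_pow] using htop

section
variable {L Γ : Type*} [Field L] [Algebra ℂ L] [LinearOrderedCommGroupWithZero Γ]
  {v : Valuation L Γ}

lemma Near.eval (hv : IsPlace v) {z : L} {a : ℂ} (hz : Near v z a) (P : Polynomial ℂ) :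
    Near v (Polynomial.aeval z P) (P.eval a) := by
  have h : NearP v (P.map (algebraMap ℂ L)) P := by
    intro n; rw [Polynomial.coeff_map]; exact near_const v _
  have := h.eval hv hz
  rwa [Polynomial.eval_map_algebraMap] at this

lemma val_aeval_at (hv : IsPlace v) {z : L} {a : ℂ} (hz : Near v z a) {P : Polynomial ℂ}
    (hP : P ≠ 0) :
    v (Polynomial.aeval z P) = v (z - algebraMap ℂ L a) ^ P.rootMultiplicity a := by
  obtain ⟨Q, hQ, hQ'⟩ := Polynomial.exists_eq_pow_rootMultiplicity_mul_and_not_dvd P hP a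
  conv_lhs => rw [hQ]
  rw [Polynomial.dvd_iff_isRoot] at hQ'
  rw [map_mul, map_mul, (hz.eval hv Q).eq_one hv hQ', mul_one, map_pow, map_pow]
  simp

lemma val_aeval_infty (hv : IsPlace v) {z : L} (hz : 1 < v z) {P : Polynomial ℂ}
    (hP : P ≠ 0) :
    v (Polynomial.aeval z P) = v z ^ P.natDegree := by
  have hz0 := ne_zero_of_one_lt hz
  have : Invertible z := invertibleOfNonzero hz0
  have h1 := Polynomial.eval₂_reverse_mul_pow (algebraMap ℂ L) z P
  rw [Polynomial.aeval_def, ← h1, map_mul, map_pow, invOf_eq_inv, ← Polynomial.aeval_def,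
    ((near_inv_zero hz).eval hv _).eq_one hv, one_mul]
  rw [← Polynomial.coeff_zero_eq_eval_zero, Polynomial.coeff_zero_reverse]
  exact Polynomial.leadingCoeff_ne_zero.2 hP

end

/-- The norm of a bivariate polynomial, computed on the curve `f = 0`. -/
lemma exists_norm {c d : ℕ} {A : ℕ → ℕ → ℂ} (htop : A c d ≠ 0) (G : MvPolynomial (Fin 2) ℂ) {n : ℕ}
    (hn : (lineRes G (Polynomial.X : Polynomial ℂ) 0 0 1).natDegree ≤ n) :
    ∃ P : Polynomial ℂ, Polynomial.aeval genX P
      = Polynomial.aeval genX (edgeP d c (tr A)) ^ n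
        * ((lineRes (bi c d A) genX 0 0 1).roots.map (fun y => ev[genX, y] G)).prod := by
  let φ : Polynomial ℂ →ₐ[ℂ] FunField := Polynomial.aeval genX
  have hmap : ∀ g : MvPolynomial (Fin 2) ℂ,
      (lineRes g (Polynomial.X : Polynomial ℂ) 0 0 1).map (φ : Polynomial ℂ →+* FunField)
        = lineRes g genX 0 0 1 := by
    intro g
    rw [lineRes_map, map_zero, map_one]
    congr 1
    exact Polynomial.aeval_X _
  have h1 := Polynomial.resultant_map_map (lineRes (bi c d A) (Polynomial.X : Polynomial ℂ) 0 0 1)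
    (lineRes G (Polynomial.X : Polynomial ℂ) 0 0 1) d n (φ : Polynomial ℂ →+* FunField)
  rw [hmap, hmap] at h1
  have hdeg : (lineRes (bi c d A) genX 0 0 1).natDegree = d := by
    refine le_antisymm (lineRes_vert_natDegree_le _ _ _ _)
      (Polynomial.le_natDegree_of_ne_zero ?_)
    rw [lineRes_vert_coeff]
    exact (map_ne_zero_iff _ aeval_genX_injective).2 (edgeP_ne_zero htop)
  have h2 := Polynomial.resultant_eq_prod_eval (lineRes (bi c d A) genX 0 0 1)
    (lineRes G genX 0 0 1) n (by rw [← hmap]; exact Polynomial.natDegree_map_le.trans hn)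
    (IsAlgClosed.splits _)
  rw [hdeg, h1, Polynomial.leadingCoeff, hdeg, lineRes_vert_coeff] at h2
  refine ⟨_, h2.trans ?_⟩
  congr 3
  funext y
  rw [lineRes_eval]
  congr 2 <;> simp

end

noncomputable section

lemma multiset_prod_compare {α Γ : Type*} [CommMonoid Γ] (M : Multiset α) (g u w : α → Γ) (t : Γ)
    (e : ℕ) (P Q : α → Prop) [DecidablePred P] [DecidablePred Q]
    (h1 : ∀ y ∈ M, P y → Q y → g y = u y * t) (h2 : ∀ y ∈ M, P y → ¬ Q y → g y = u y)
    (h3 : ∀ y ∈ M, ¬ P y → g y = u y * w y ^ e) :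
    (M.map g).prod = (M.map u).prod * t ^ ((M.filter P).filter Q).card
      * ((M.filter (fun y => ¬ P y)).map w).prod ^ e := by
  induction M using Multiset.induction_on with
  | empty => simp
  | cons y M ih =>
    have ih := ih (fun z hz => h1 z (Multiset.mem_cons_of_mem hz))
      (fun z hz => h2 z (Multiset.mem_cons_of_mem hz))
      (fun z hz => h3 z (Multiset.mem_cons_of_mem hz))
    have hy := Multiset.mem_cons_self y M
    rw [Multiset.map_cons, Multiset.prod_cons, ih, Multiset.map_cons, Multiset.prod_cons]
    by_cases hP : P y
    · rw [Multiset.filter_cons_of_pos _ hP, Multiset.filter_cons_of_neg (p := fun y => ¬ P y) _ (not_not.2 hP)]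
      by_cases hQ : Q y
      · rw [Multiset.filter_cons_of_pos _ hQ, Multiset.card_cons, pow_succ, h1 y hy hP hQ]
        ac_rfl
      · rw [Multiset.filter_cons_of_neg _ hQ, h2 y hy hP hQ]
        ac_rfl
    · rw [Multiset.filter_cons_of_neg _ hP, Multiset.filter_cons_of_pos (p := fun y => ¬ P y) _ hP, h3 y hy hP,
        Multiset.map_cons, Multiset.prod_cons, mul_pow]
      ac_rfl

lemma mul_mul_eq_of_mul_eq_one {Γ : Type*} [CommMonoid Γ] {k p t w h : Γ} (hw : h * w = 1) :
    k * (p * t * w) * h = k * p * t := by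
  have : k * (p * t * w) * h = k * p * t * (h * w) := by ac_rfl
  rw [this, hw, mul_one]

/-- Local conditions on a polynomial `G` guaranteeing that, compared with `U`, it vanishes on the
curve exactly (and simply) along `Z`. -/
structure LocalData (c d : ℕ) (A : ℕ → ℕ → ℂ) (Z : Set (ℂ × ℂ)) (G U : MvPolynomial (Fin 2) ℂ)
    (e₁ e₂ : ℕ) : Prop where
  top : A c d ≠ 0
  vert : ∀ a : ℂ, lineRes (bi c d A) a 0 0 1 ≠ 0
  mem : ∀ a b : ℂ, (a, b) ∈ Z → ev[a, b] (bi c d A) = 0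
  simple : ∀ a b : ℂ, (a, b) ∈ Z → ev[a, b] (pderiv 1 (bi c d A)) ≠ 0
  ne_zero : ∀ y : FunField, ev[genX, y] (bi c d A) = 0 → ev[genX, y] U ≠ 0
  fin : ∀ (B : ValuationSubring FunField), IsPlace B.valuation → ∀ (y : FunField) (a b : ℂ),
    Near B.valuation genX a → Near B.valuation y b → ev[genX, y] (bi c d A) = 0 →
    ((a, b) ∈ Z → B.valuation (ev[genX, y] G)
      = B.valuation (ev[genX, y] U) * B.valuation (genX - algebraMap ℂ FunField a)) ∧
    ((a, b) ∉ Z → B.valuation (ev[genX, y] G) = B.valuation (ev[genX, y] U))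
  infX : ∀ (B : ValuationSubring FunField), IsPlace B.valuation → ∀ (y : FunField),
    1 < B.valuation genX → ev[genX, y] (bi c d A) = 0 →
    B.valuation (ev[genX, y] G) = B.valuation (ev[genX, y] U) * B.valuation genX ^ e₁
  infY : ∀ (B : ValuationSubring FunField), IsPlace B.valuation → ∀ (y : FunField),
    1 < B.valuation y → ev[genX, y] (bi c d A) = 0 →
    B.valuation (ev[genX, y] G) = B.valuation (ev[genX, y] U) * B.valuation y ^ e₂

lemma genX_sub_ne_zero (a : ℂ) : genX - algebraMap ℂ FunField a ≠ 0 := by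
  intro h
  exact transcendental_genX_sub a (h ▸ isAlgebraic_zero)

lemma mem_roots_vert {c d : ℕ} {A : ℕ → ℕ → ℂ} {K : Type*} [Field K] [Algebra ℂ K] {x y : K}
    (h : y ∈ (lineRes (bi c d A) x 0 0 1).roots) : ev[x, y] (bi c d A) = 0 := by
  have := Polynomial.isRoot_of_mem_roots h
  rw [Polynomial.IsRoot, lineRes_eval] at this
  simpa only [zero_mul, add_zero, zero_add, one_mul] using this

lemma LocalData.filter_roots {c d : ℕ} {A : ℕ → ℕ → ℂ} {Z : Set (ℂ × ℂ)}
    {G U : MvPolynomial (Fin 2) ℂ} {e₁ e₂ : ℕ} (h : LocalData c d A Z G U e₁ e₂) (hZ : Z.Finite)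
    (a : ℂ) : open Classical in
    (((lineRes (bi c d A) a 0 0 1).roots.filter (fun b => (a, b) ∈ Z)).card)
      = (hZ.toFinset.filter (fun z => a = z.1)).card := by
  classical
  have hmem : ∀ b, b ∈ (lineRes (bi c d A) a 0 0 1).roots ↔ ev[a, b] (bi c d A) = 0 := by
    intro b
    refine ⟨mem_roots_vert, fun hb => (Polynomial.mem_roots (h.vert a)).2 ?_⟩
    rw [Polynomial.IsRoot, lineRes_eval]
    simpa only [zero_mul, add_zero, zero_add, one_mul] using hb
  have hnd : ((lineRes (bi c d A) a 0 0 1).roots.filter (fun b => (a, b) ∈ Z)).Nodup := by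
    rw [Multiset.nodup_iff_count_le_one]
    intro b
    by_cases hb : (a, b) ∈ Z
    · rw [Multiset.count_filter_of_pos (p := fun b => (a, b) ∈ Z) hb, Polynomial.count_roots]
      by_contra! hlt
      have h2 := ((Polynomial.one_lt_rootMultiplicity_iff_isRoot (h.vert a)).1 hlt).2
      rw [Polynomial.IsRoot, lineRes_derivative] at h2
      simp only [Polynomial.eval_add, Polynomial.eval_mul, Polynomial.eval_C, mul_one,
        mul_zero, zero_add, lineRes_eval] at h2
      simp only [zero_add, one_mul, zero_mul, add_zero] at h2
      exact h.simple a b hb h2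
    · rw [Multiset.count_filter_of_neg (p := fun b => (a, b) ∈ Z) hb]
      exact zero_le_one
  refine Finset.card_bij (s := ⟨_, hnd⟩) (fun b _ => (a, b)) ?_ ?_ ?_
  · intro b hb
    have hb : b ∈ (lineRes (bi c d A) a 0 0 1).roots.filter (fun b => (a, b) ∈ Z) := hb
    rw [Multiset.mem_filter] at hb
    simp [hb.2]
  · intro b _ b' _ he
    exact (Prod.mk.inj he).2
  · rintro ⟨a', b⟩ hz
    simp only [Finset.mem_filter, Set.Finite.mem_toFinset] at hz
    obtain ⟨hz, rfl⟩ := hz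
    exact ⟨b, Multiset.mem_filter.2 ⟨(hmem b).2 (h.mem a b hz), hz⟩, rfl⟩

theorem LocalData.count {c d : ℕ} {A : ℕ → ℕ → ℂ} {Z : Set (ℂ × ℂ)}
    {G U : MvPolynomial (Fin 2) ℂ} {e₁ e₂ : ℕ} (h : LocalData c d A Z G U e₁ e₂) :
    Z.Finite ∧ Z.ncard = d * e₁ + c * e₂ := by
  classical
  obtain ⟨n, hnG, hnU⟩ : ∃ n, (lineRes G (Polynomial.X : Polynomial ℂ) 0 0 1).natDegree ≤ n ∧
      (lineRes U (Polynomial.X : Polynomial ℂ) 0 0 1).natDegree ≤ n :=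
    ⟨_, le_max_left _ _, le_max_right _ _⟩
  obtain ⟨a, ha⟩ := exists_norm h.top G hnG
  obtain ⟨u, hu⟩ := exists_norm h.top U hnU
  set M := (lineRes (bi c d A) genX 0 0 1).roots with hM
  set H := edgeP d c (tr A) with hH
  have hH0 : H ≠ 0 := edgeP_ne_zero h.top
  have hHd : H.natDegree = c := edgeP_natDegree h.top
  have hHL : Polynomial.aeval genX H ≠ 0 := (map_ne_zero_iff _ aeval_genX_injective).2 hH0
  have hdeg : (lineRes (bi c d A) genX 0 0 1).natDegree = d := by
    refine le_antisymm (lineRes_vert_natDegree_le _ _ _ _)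
      (Polynomial.le_natDegree_of_ne_zero ?_)
    rwa [lineRes_vert_coeff]
  have hMcard : M.card = d := by rw [hM, IsAlgClosed.card_roots_eq_natDegree, hdeg]
  have hMf : ∀ y ∈ M, ev[genX, y] (bi c d A) = 0 := fun y hy => mem_roots_vert hy
  have hu0 : u ≠ 0 := by
    rintro rfl
    rw [map_zero] at hu
    refine mul_ne_zero (pow_ne_zero _ hHL) (Multiset.prod_ne_zero ?_) hu.symm
    intro h0
    obtain ⟨y, hy, hy'⟩ := Multiset.mem_map.1 h0
    exact h.ne_zero y (hMf y hy) hy'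
  have hinf : Polynomial.natDegree a = u.natDegree + d * e₁ ∧ a ≠ 0 := by
    obtain ⟨B, hB, hBX⟩ := exists_place_infty
    have h1 : B.valuation (Polynomial.aeval genX a)
        = B.valuation (Polynomial.aeval genX u) * B.valuation genX ^ (d * e₁) := by
      rw [ha, hu, map_mul, map_mul, map_multiset_prod, map_multiset_prod, Multiset.map_map,
        Multiset.map_map]
      have := multiset_prod_compare M (fun y => B.valuation (ev[genX, y] G))
        (fun y => B.valuation (ev[genX, y] U)) (fun _ => 1) (B.valuation genX ^ e₁) 0
        (fun _ => True) (fun _ => True) (fun y hy _ _ => h.infX B hB y hBX (hMf y hy))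
        (by simp) (by simp)
      simp only [Multiset.filter_true, hMcard, ← pow_mul, pow_zero, mul_one] at this
      rw [mul_comm d e₁, mul_assoc]
      congr 1
    have hX0 : B.valuation genX ≠ 0 :=
      (Valuation.ne_zero_iff _).2 (ne_zero_of_one_lt hBX)
    have ha0 : a ≠ 0 := by
      rintro rfl
      rw [map_zero, map_zero, val_aeval_infty hB hBX hu0, ← pow_add] at h1
      exact pow_ne_zero _ hX0 h1.symm
    rw [val_aeval_infty hB hBX hu0, val_aeval_infty hB hBX ha0, ← pow_add] at h1
    exact ⟨(pow_right_strictMono₀ hBX).injective h1, ha0⟩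
  obtain ⟨hinf, ha0⟩ := hinf
  have haH : a * H ^ e₂ ≠ 0 := mul_ne_zero ha0 (pow_ne_zero _ hH0)
  have hfin : ∀ x₀ : ℂ, (a * H ^ e₂).rootMultiplicity x₀ = u.rootMultiplicity x₀
      + ((lineRes (bi c d A) x₀ 0 0 1).roots.filter (fun b => (x₀, b) ∈ Z)).card := by
    intro x₀
    obtain ⟨B, hB, hBX⟩ := exists_place_at x₀
    obtain ⟨hr1, hr2⟩ := (NearP.lineRes hB (bi c d A) hBX
      (near_zero_iff.2 (by simp) : Near B.valuation (0 : FunField) 0)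
      (near_zero_iff.2 (by simp) : Near B.valuation (0 : FunField) 0)
      (by simpa using near_const B.valuation 1 : Near B.valuation (1 : FunField) 1)).roots_eq hB
      (h.vert x₀)
    rw [Polynomial.leadingCoeff, hdeg, lineRes_vert_coeff] at hr2
    have h1 : B.valuation (Polynomial.aeval genX (a * H ^ e₂))
        = B.valuation (Polynomial.aeval genX u)
        * B.valuation (genX - algebraMap ℂ FunField x₀) ^
          ((lineRes (bi c d A) x₀ 0 0 1).roots.filter (fun b => (x₀, b) ∈ Z)).card := by
      have := multiset_prod_compare M (fun y => B.valuation (ev[genX, y] G))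
        (fun y => B.valuation (ev[genX, y] U)) B.valuation
        (B.valuation (genX - algebraMap ℂ FunField x₀)) e₂
        (fun y => B.valuation y ≤ 1) (fun y => (x₀, resid B.valuation y) ∈ Z)
        (fun y hy hP hQ => (h.fin B hB y x₀ _ hBX (near_resid hB hP) (hMf y hy)).1 hQ)
        (fun y hy hP hQ => (h.fin B hB y x₀ _ hBX (near_resid hB hP) (hMf y hy)).2 hQ)
        (fun y hy hP => h.infY B hB y (not_le.1 hP) (hMf y hy))
      rw [map_mul, map_mul, map_pow, map_pow, ha, hu, map_mul, map_mul, map_multiset_prod,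
        map_multiset_prod, Multiset.map_map, Multiset.map_map]
      simp only [Function.comp_def]
      rw [this, hr1, Multiset.filter_map, Multiset.card_map]
      simp only [Function.comp_def]
      have h3 : B.valuation (Polynomial.aeval genX H) ^ e₂ * ((M.filter
        (fun y => ¬ B.valuation y ≤ 1)).map B.valuation).prod ^ e₂ = 1 := by
        rw [← mul_pow, hr2, one_pow]
      exact mul_mul_eq_of_mul_eq_one h3
    have hlt : B.valuation (genX - algebraMap ℂ FunField x₀) < 1 := hBX
    have hpos : 0 < B.valuation (genX - algebraMap ℂ FunField x₀) :=
      zero_lt_iff.2 ((Valuation.ne_zero_iff _).2 (genX_sub_ne_zero x₀))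
    rw [val_aeval_at hB hBX haH, val_aeval_at hB hBX hu0, ← pow_add] at h1
    exact (pow_right_strictAnti₀ hpos hlt).injective h1
  have hZ : Z.Finite := by
    refine Set.Finite.subset (s := ((a * H ^ e₂).roots.toFinset.biUnion fun x₀ =>
      (lineRes (bi c d A) x₀ 0 0 1).roots.toFinset.image fun b => (x₀, b) : Finset (ℂ × ℂ)))
      (Finset.finite_toSet _) ?_
    rintro ⟨x₀, b⟩ hz
    have hb : b ∈ (lineRes (bi c d A) x₀ 0 0 1).roots := by
      refine (Polynomial.mem_roots (h.vert x₀)).2 ?_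
      rw [Polynomial.IsRoot, lineRes_eval]
      simpa only [zero_mul, add_zero, zero_add, one_mul] using h.mem x₀ b hz
    simp only [Finset.coe_biUnion, Set.mem_iUnion, Finset.mem_coe, Finset.mem_image,
      Multiset.mem_toFinset]
    refine ⟨x₀, ?_, b, hb, rfl⟩
    rw [← Multiset.count_pos, Polynomial.count_roots, hfin]
    refine Nat.add_pos_right _ (Multiset.card_pos_iff_exists_mem.2 ⟨b, ?_⟩)
    exact Multiset.mem_filter.2 ⟨hb, hz⟩
  refine ⟨hZ, ?_⟩
  have hroots : (a * H ^ e₂).roots = u.roots + hZ.toFinset.val.map Prod.fst := by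
    ext x₀
    rw [Multiset.count_add, Polynomial.count_roots, Polynomial.count_roots, hfin,
      h.filter_roots hZ, Multiset.count_map]
    rfl
  have hcard := congrArg Multiset.card hroots
  rw [Multiset.card_add, Multiset.card_map, IsAlgClosed.card_roots_eq_natDegree,
    IsAlgClosed.card_roots_eq_natDegree, Polynomial.natDegree_mul ha0 (pow_ne_zero _ hH0),
    Polynomial.natDegree_pow, hHd, hinf] at hcard
  rw [Set.ncard_eq_toFinset_card Z hZ]
  have : hZ.toFinset.card = Multiset.card hZ.toFinset.val := rfl
  rw [this]
  have h5 := mul_comm c e₂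
  omega

end

noncomputable section

variable {c d : ℕ} {A : ℕ → ℕ → ℂ}

lemma Good.lineRes_vert_ne_zero (h : Good c d A) (a : ℂ) :
    lineRes (bi c d A) a 0 0 1 ≠ 0 := by
  rw [← lineRes_tr]
  exact h.right.lineRes_hor_ne_zero a

lemma ev_eq_zero_of_near {B : ValuationSubring FunField} (hB : IsPlace B.valuation)
    {x y : FunField} {a b : ℂ} (hx : Near B.valuation x a) (hy : Near B.valuation y b)
    {f : MvPolynomial (Fin 2) ℂ} (hf : ev[x, y] f = 0) : ev[a, b] f = 0 := by
  have := hx.aeval hB hy f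
  rw [hf] at this
  exact (this.lt_one_iff hB).1 (by simp)

lemma Good.flexData (h : Good c d A) (hc : 1 ≤ c) (hd : 1 ≤ d) :
    LocalData c d A {z | ev[z.1, z.2] (bi c d A) = 0 ∧ ev[z.1, z.2] (hess (bi c d A)) = 0}
      (hess (bi c d A)) 1 (3 * c - 3) (3 * d - 3) where
  top := h.left.top
  vert := h.lineRes_vert_ne_zero
  mem _ _ hz := hz.1
  simple _ _ hz := h.flex_pderiv hz.1 hz.2
  ne_zero _ _ := by simp only [map_one]; exact one_ne_zero
  fin B hB y a b hx hy hf := by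
    have h1 := h.hess_near hB hx hy hf
    simp only [map_one, one_mul]
    exact ⟨fun hz => h1.2 hz.2,
      fun hz => h1.1 fun h0 => hz ⟨ev_eq_zero_of_near hB hx hy hf, h0⟩⟩
  infX B hB y hx hf := by
    simp only [map_one, one_mul]; exact h.hess_infty hc hB hx hf
  infY B hB y hy hf := by
    simp only [map_one, one_mul]; exact h.hess_infty' hd hB hy hf

lemma Good.pderiv_genX_ne_zero (h : Good c d A) (hc : 5 ≤ c) (hd : 5 ≤ d) {y : FunField}
    (hf : ev[genX, y] (bi c d A) = 0) :
    ev[genX, y] (pderiv 0 (bi c d A)) ≠ 0 ∧ ev[genX, y] (pderiv 1 (bi c d A)) ≠ 0 := by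
  have : IsAlgClosed FunField := inferInstanceAs (IsAlgClosed (AlgebraicClosure (RatFunc ℂ)))
  obtain ⟨B, hB, hx⟩ := exists_place_infty
  exact (h.bitDisc_infty hc hd hB hx hf).1

lemma Good.bitData (h : Good c d A) (hc : 5 ≤ c) (hd : 5 ≤ d) :
    LocalData c d A {z | ∃ τ, IsBit (bi c d A) z.1 z.2 τ}
      (bitDisc (c + d) (bi c d A)) (gradU c d (bi c d A))
      (2 * c ^ 2 * d + 8 - 10 * c) (2 * d ^ 2 * c + 8 - 10 * d) := by
  have : IsAlgClosed FunField := inferInstanceAs (IsAlgClosed (AlgebraicClosure (RatFunc ℂ)))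
  have : CharZero FunField := algebraRat.charZero _
  exact
  { top := h.left.top
    vert := h.lineRes_vert_ne_zero
    mem := fun _ _ ⟨_, hz⟩ => hz.mem
    simple := fun _ _ ⟨_, hz⟩ => hz.dy
    ne_zero := fun y hf => by
      have h1 := h.pderiv_genX_ne_zero hc hd hf
      simp only [gradU, map_mul, map_pow]
      exact mul_ne_zero (pow_ne_zero _ h1.1) (pow_ne_zero _ h1.2)
    fin := fun B hB y a b hx hy hf => by
      have h1 := h.pderiv_genX_ne_zero hc hd hf
      exact h.bitDisc_near hc hd hB hx hy hf h1.1 h1.2 (sub_ne_zero.1 (genX_sub_ne_zero a))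
    infX := fun B hB y hx hf => (h.bitDisc_infty hc hd hB hx hf).2
    infY := fun B hB y hy hf => h.bitDisc_infty' hc hd hB hy hf }

lemma Good.flex_count (h : Good c d A) (hc : 1 ≤ c) (hd : 1 ≤ d) :
    let Z := {z : ℂ × ℂ | ev[z.1, z.2] (bi c d A) = 0 ∧ ev[z.1, z.2] (hess (bi c d A)) = 0}
    Z.Finite ∧ (Z.ncard : ℤ) = 6 * c * d - 3 * c - 3 * d := by
  obtain ⟨h1, h2⟩ := (h.flexData hc hd).count
  refine ⟨h1, ?_⟩
  rw [h2]
  push_cast [Nat.cast_sub (show 3 ≤ 3 * c by omega), Nat.cast_sub (show 3 ≤ 3 * d by omega)]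
  ring

lemma Good.bit_count (h : Good c d A) (hc : 5 ≤ c) (hd : 5 ≤ d) :
    let Z := {z : ℂ × ℂ | ∃ τ, IsBit (bi c d A) z.1 z.2 τ}
    Z.Finite ∧ (Z.ncard : ℤ) = 2 * (2 * c ^ 2 * d ^ 2 - 10 * c * d + 4 * c + 4 * d) := by
  obtain ⟨h1, h2⟩ := (h.bitData hc hd).count
  refine ⟨h1, ?_⟩
  have e1 : 10 * c ≤ 2 * c ^ 2 * d + 8 := by nlinarith [Nat.mul_le_mul hc hd]
  have e2 : 10 * d ≤ 2 * d ^ 2 * c + 8 := by nlinarith [Nat.mul_le_mul hc hd]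
  rw [h2]
  push_cast [Nat.cast_sub e1, Nat.cast_sub e2]
  ring

end

noncomputable section

lemma evalP_eq (f : MvPolynomial (Fin 2) ℂ) (p : ℂ × ℂ) : evalP f p = ev[p.1, p.2] f := by
  rw [evalP, MvPolynomial.aeval_eq_eval]
  congr 2
  funext i
  fin_cases i <;> rfl

lemma lineRestrict_eq (f : MvPolynomial (Fin 2) ℂ) (p w : ℂ × ℂ) :
    lineRestrict f p w = lineRes f p.1 p.2 w.1 w.2 := by
  rw [lineRestrict, lineRes]
  congr 2
  funext i
  fin_cases i <;> rfl

lemma le_interMult_iff (f : MvPolynomial (Fin 2) ℂ) (p w : ℂ × ℂ) (k : ℕ) :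
    (k : ℕ∞) ≤ interMult f p w ↔ Polynomial.X ^ k ∣ lineRes f p.1 p.2 w.1 w.2 := by
  rw [interMult, lineRestrict_eq]
  split_ifs with h
  · simp [h]
  · rw [Nat.cast_le, Polynomial.le_rootMultiplicity_iff h, map_zero, sub_zero]

/-- The curve `{f = 0}` passes through `(a, b)` and is tangent there to the direction `(u, w)`. -/
def TanAt (f : MvPolynomial (Fin 2) ℂ) (a b u w : ℂ) : Prop :=
  ev[a, b] f = 0 ∧ ev[a, b] (pderiv 0 f) * u + ev[a, b] (pderiv 1 f) * w = 0

lemma tanAt_iff (f : MvPolynomial (Fin 2) ℂ) (a b u w : ℂ) :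
    TanAt f a b u w ↔ Polynomial.X ^ 2 ∣ lineRes f a b u w := by
  rw [X_pow_two_dvd_iff, lineRes_coeff_zero, lineRes_coeff_one, TanAt]

lemma lineRes_derivative_eval (f : MvPolynomial (Fin 2) ℂ) (a b u w t : ℂ) :
    (Polynomial.derivative (lineRes f a b u w)).eval t =
      ev[a + u * t, b + w * t] (pderiv 0 f) * u + ev[a + u * t, b + w * t] (pderiv 1 f) * w := by
  rw [lineRes_derivative, Polynomial.eval_add, Polynomial.eval_mul, Polynomial.eval_mul,
    lineRes_eval, lineRes_eval, Polynomial.eval_C, Polynomial.eval_C]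

lemma TanAt.dvd {f : MvPolynomial (Fin 2) ℂ} {a b u w t : ℂ}
    (h : TanAt f (a + u * t) (b + w * t) u w) :
    (Polynomial.X - Polynomial.C t) ^ 2 ∣ lineRes f a b u w :=
  sq_dvd_of_roots ((lineRes_eval _ _ _ _ _ _).trans h.1)
    ((lineRes_derivative_eval _ _ _ _ _ _).trans h.2)

lemma TanAt.dvd_zero {f : MvPolynomial (Fin 2) ℂ} {a b u w : ℂ} (h : TanAt f a b u w) :
    (Polynomial.X - Polynomial.C 0) ^ 2 ∣ lineRes f a b u w :=
  TanAt.dvd (by rwa [mul_zero, mul_zero, add_zero, add_zero])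

lemma TanAt.smul {f : MvPolynomial (Fin 2) ℂ} {a b u w : ℂ} (s : ℂ) (h : TanAt f a b u w) :
    TanAt f a b (s * u) (s * w) :=
  ⟨h.1, by linear_combination s * h.2⟩

lemma tanAt_grad {f : MvPolynomial (Fin 2) ℂ} {a b : ℂ} (h : ev[a, b] f = 0) :
    TanAt f a b (ev[a, b] (pderiv 1 f)) (-ev[a, b] (pderiv 0 f)) :=
  ⟨h, by ring⟩

lemma isBit_iff (f : MvPolynomial (Fin 2) ℂ) (a b τ : ℂ) :
    IsBit f a b τ ↔ ev[a, b] f = 0 ∧ ev[a, b] (pderiv 0 f) ≠ 0 ∧ ev[a, b] (pderiv 1 f) ≠ 0 ∧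
      τ ≠ 0 ∧ TanAt f (a + ev[a, b] (pderiv 1 f) * τ) (b + -ev[a, b] (pderiv 0 f) * τ)
        (ev[a, b] (pderiv 1 f)) (-ev[a, b] (pderiv 0 f)) := by
  rw [TanAt, ← lineRes_derivative_eval, ← lineRes_eval]
  exact ⟨fun h => ⟨h.mem, h.dx, h.dy, h.ne, h.root, h.root'⟩,
    fun ⟨h1, h2, h3, h4, h5, h6⟩ => ⟨h1, h2, h3, h4, h5, h6⟩⟩

lemma lineThrough_add_smul (p w : ℂ × ℂ) (t : ℂ) {s : ℂ} (hs : s ≠ 0) :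
    lineThrough (p.1 + w.1 * t, p.2 + w.2 * t) (s * w.1, s * w.2) = lineThrough p w := by
  ext q
  constructor
  · rintro ⟨r, rfl⟩
    exact ⟨t + r * s, by ext <;> simp <;> ring⟩
  · rintro ⟨r, rfl⟩
    refine ⟨(r - t) * s⁻¹, ?_⟩
    ext <;> simp <;> field_simp <;> ring

variable {c d : ℕ} {A : ℕ → ℕ → ℂ}

lemma Good.exists_scale (h : Good c d A) {a b u w : ℂ} (huw : u ≠ 0 ∨ w ≠ 0)
    (ht : TanAt (bi c d A) a b u w) :
    ∃ s, s ≠ 0 ∧ u = s * ev[a, b] (pderiv 1 (bi c d A)) ∧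
      w = s * -ev[a, b] (pderiv 0 (bi c d A)) := by
  obtain ⟨hf, h1⟩ := ht
  generalize hp : ev[a, b] (pderiv 0 (bi c d A)) = p at *
  generalize hq : ev[a, b] (pderiv 1 (bi c d A)) = q at *
  have hg : q ≠ 0 ∨ -p ≠ 0 := by
    have := h.grad_ne hf
    rwa [hp, hq] at this
  by_cases hq0 : q = 0
  · subst hq0
    have hp0 : p ≠ 0 := by simpa using hg
    have hu : u = 0 := by simpa [hp0] using h1
    subst hu
    have hw : w ≠ 0 := by simpa using huw
    exact ⟨w / -p, div_ne_zero hw (neg_ne_zero.2 hp0), by ring, by field_simp⟩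
  · have hu : u ≠ 0 := by
      rintro rfl
      simp [hq0] at h1
      simp [h1] at huw
    refine ⟨u / q, div_ne_zero hu hq0, by field_simp, ?_⟩
    field_simp
    linear_combination h1

lemma Good.isBit_of_tanAt (h : Good c d A) {a b u w t : ℂ} (huw : u ≠ 0 ∨ w ≠ 0) (ht : t ≠ 0)
    (h1 : TanAt (bi c d A) a b u w) (h2 : TanAt (bi c d A) (a + u * t) (b + w * t) u w) :
    ∃ s, s ≠ 0 ∧ u = s * ev[a, b] (pderiv 1 (bi c d A)) ∧
      w = s * -ev[a, b] (pderiv 0 (bi c d A)) ∧ IsBit (bi c d A) a b (s * t) := by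
  obtain ⟨s, hs, hu, hw⟩ := h.exists_scale huw h1
  refine ⟨s, hs, hu, hw, ?_⟩
  have hd := sq_mul_sq_dvd ht.symm h1.dvd_zero h2.dvd
  have hu0 : u ≠ 0 := by
    rintro rfl
    refine h.vert22 (huw.resolve_left (by simp)) 0 t (a := a) (b := b) ?_
    simpa only [trip, pow_zero, mul_one] using hd
  have hw0 : w ≠ 0 := by
    rintro rfl
    refine h.hor22 (huw.resolve_right (by simp)) 0 t (a := a) (b := b) ?_
    simpa only [trip, pow_zero, mul_one] using hd
  rw [isBit_iff]
  refine ⟨h1.1, ?_, ?_, mul_ne_zero hs ht, ?_⟩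
  · intro h0; rw [hw, h0] at hw0; simp at hw0
  · intro h0; rw [hu, h0] at hu0; simp at hu0
  · have e1 : ev[a, b] (pderiv 1 (bi c d A)) = s⁻¹ * u := by rw [hu]; field_simp
    have e2 : -ev[a, b] (pderiv 0 (bi c d A)) = s⁻¹ * w := by rw [hw]; field_simp
    rw [e1, e2, show s⁻¹ * u * (s * t) = u * t by field_simp,
      show s⁻¹ * w * (s * t) = w * t by field_simp]
    exact h2.smul _

/-- The tangent line at `z`. -/
def tanLine (f : MvPolynomial (Fin 2) ℂ) (z : ℂ × ℂ) : Set (ℂ × ℂ) :=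
  lineThrough z (ev[z.1, z.2] (pderiv 1 f), -ev[z.1, z.2] (pderiv 0 f))

/-- The point with parameter `τ` on the tangent line at `z`. -/
def tanPoint (f : MvPolynomial (Fin 2) ℂ) (z : ℂ × ℂ) (τ : ℂ) : ℂ × ℂ :=
  (z.1 + ev[z.1, z.2] (pderiv 1 f) * τ, z.2 + -ev[z.1, z.2] (pderiv 0 f) * τ)

lemma Good.isBit_partner (h : Good c d A) {z : ℂ × ℂ} {τ : ℂ}
    (hz : IsBit (bi c d A) z.1 z.2 τ) :
    (∃ σ, IsBit (bi c d A) (tanPoint (bi c d A) z τ).1 (tanPoint (bi c d A) z τ).2 σ) ∧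
      tanLine (bi c d A) (tanPoint (bi c d A) z τ) = tanLine (bi c d A) z ∧
      tanPoint (bi c d A) z τ ≠ z := by
  obtain ⟨h1, h2, h3, h4, h5⟩ := (isBit_iff _ _ _ _).1 hz
  obtain ⟨s, hs, hu, hw, hb⟩ := h.isBit_of_tanAt (t := -τ) (Or.inl h3) (neg_ne_zero.2 h4) h5
    (by
      have := tanAt_grad h1
      convert this using 1 <;> ring)
  refine ⟨⟨_, hb⟩, ?_, ?_⟩
  · rw [tanLine, tanLine, ← lineThrough_add_smul z _ τ (inv_ne_zero hs)]
    simp only [tanPoint]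
    congr 2
    · exact (eq_inv_mul_iff_mul_eq₀ hs).2 hu.symm
    · exact (eq_inv_mul_iff_mul_eq₀ hs).2 hw.symm
  · intro he
    have := congrArg Prod.fst he
    simp only [tanPoint, add_eq_left] at this
    exact mul_ne_zero h3 h4 this

lemma Good.tanLine_fiber (h : Good c d A) {z z' : ℂ × ℂ} {τ τ' : ℂ}
    (hz : IsBit (bi c d A) z.1 z.2 τ) (hz' : IsBit (bi c d A) z'.1 z'.2 τ')
    (hl : tanLine (bi c d A) z' = tanLine (bi c d A) z) :
    z' = z ∨ z' = tanPoint (bi c d A) z τ := by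
  obtain ⟨h1, h2, h3, h4, h5⟩ := (isBit_iff _ _ _ _).1 hz
  have hm : z' ∈ tanLine (bi c d A) z := hl ▸ ⟨0, by simp⟩
  obtain ⟨t, ht⟩ := hm
  have hm' : (z'.1 + ev[z'.1, z'.2] (pderiv 1 (bi c d A)),
      z'.2 + -ev[z'.1, z'.2] (pderiv 0 (bi c d A))) ∈ tanLine (bi c d A) z :=
    hl ▸ ⟨1, by simp⟩
  obtain ⟨t', ht'⟩ := hm'
  have hT := tanAt_grad hz'.mem
  have hq' := hz'.dy
  simp only [Prod.ext_iff] at ht ht'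
  obtain ⟨ht1, ht2⟩ := ht
  obtain ⟨ht1', ht2'⟩ := ht'
  have e1 : ev[z'.1, z'.2] (pderiv 1 (bi c d A))
      = (t' - t) * ev[z.1, z.2] (pderiv 1 (bi c d A)) := by
    linear_combination ht1' - ht1
  have e2 : -ev[z'.1, z'.2] (pderiv 0 (bi c d A))
      = (t' - t) * -ev[z.1, z.2] (pderiv 0 (bi c d A)) := by
    linear_combination ht2' - ht2
  have hs : t' - t ≠ 0 := fun h0 => hq' (by rw [e1, h0, zero_mul])
  rw [e1, e2] at hT
  have hT2 := hT.smul (t' - t)⁻¹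
  rw [inv_mul_cancel_left₀ hs, inv_mul_cancel_left₀ hs] at hT2
  by_cases h0 : t = 0
  · left; ext
    · rw [ht1, h0]; ring
    · rw [ht2, h0]; ring
  by_cases hτ : t = τ
  · right; ext
    · simp only [tanPoint]; rw [ht1, hτ]; ring
    · simp only [tanPoint]; rw [ht2, hτ]; ring
  exfalso
  refine h.line222 (a := z.1) (b := z.2) (Or.inl h3) 0 τ t (w := -ev[z.1, z.2] (pderiv 0 (bi c d A))) ?_
  have hT3 : TanAt (bi c d A) (z.1 + ev[z.1, z.2] (pderiv 1 (bi c d A)) * t)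
      (z.2 + -ev[z.1, z.2] (pderiv 0 (bi c d A)) * t) (ev[z.1, z.2] (pderiv 1 (bi c d A)))
      (-ev[z.1, z.2] (pderiv 0 (bi c d A))) := by
    rw [ht1, ht2] at hT2
    convert hT2 using 1 <;> ring
  rw [trip]
  refine IsCoprime.mul_dvd (IsCoprime.mul_left ?_ ?_)
    (sq_mul_sq_dvd h4.symm (tanAt_grad h1).dvd_zero h5.dvd) hT3.dvd
  · exact (Polynomial.isCoprime_X_sub_C_of_isUnit_sub (sub_ne_zero.2 (Ne.symm h0)).isUnit).pow
  · exact (Polynomial.isCoprime_X_sub_C_of_isUnit_sub (sub_ne_zero.2 (Ne.symm hτ)).isUnit).pow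

lemma Good.isBit_mem_torus (h : Good c d A) {z : ℂ × ℂ} {τ : ℂ}
    (hz : IsBit (bi c d A) z.1 z.2 τ) : z ∈ Torus := by
  obtain ⟨a, b⟩ := z
  have h5 := (isBit_iff _ _ _ _).1 hz
  have hd := sq_mul_sq_dvd hz.ne.symm (tanAt_grad hz.mem).dvd_zero h5.2.2.2.2.dvd
  refine ⟨?_, ?_⟩
  · rintro (rfl : a = 0)
    refine h.axis22 hz.dy τ (b := b) (w := -ev[0, b] (pderiv 0 (bi c d A))) ?_
    simpa only [trip, pow_zero, mul_one] using hd
  · rintro (rfl : b = 0)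
    refine h.swap.axis22 (neg_ne_zero.2 hz.dx) τ (b := a) (w := ev[a, 0] (pderiv 1 (bi c d A))) ?_
    rw [lineRes_tr]
    simpa only [trip, pow_zero, mul_one] using hd

lemma tanPoint_mem (f : MvPolynomial (Fin 2) ℂ) (z : ℂ × ℂ) (τ : ℂ) :
    tanPoint f z τ ∈ tanLine f z :=
  ⟨τ, by simp only [tanPoint]; ext <;> ring⟩

lemma Good.bitangentLines_eq (h : Good c d A) :
    bitangentLines (bi c d A) =
      tanLine (bi c d A) '' {z : ℂ × ℂ | ∃ τ, IsBit (bi c d A) z.1 z.2 τ} := by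
  have two : ∀ p w : ℂ × ℂ, (2 : ℕ∞) ≤ interMult (bi c d A) p w ↔
      TanAt (bi c d A) p.1 p.2 w.1 w.2 := fun p w => by
    rw [tanAt_iff]; exact_mod_cast le_interMult_iff (bi c d A) p w 2
  ext l
  constructor
  · rintro ⟨p, w, q₁, q₂, hw, rfl, ⟨⟨t₁, rfl⟩, hq₁⟩, ⟨⟨t₂, rfl⟩, hq₂⟩, hne, h1, h2⟩
    rw [two] at h1 h2
    have hw' : w.1 ≠ 0 ∨ w.2 ≠ 0 := by
      by_contra hcon
      push Not at hcon
      exact hw (Prod.ext hcon.1 hcon.2)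
    have ht : t₂ - t₁ ≠ 0 := by
      intro h0
      rw [sub_eq_zero] at h0
      subst h0
      exact hne rfl
    obtain ⟨s, hs, hu, hw2, hb⟩ := h.isBit_of_tanAt hw' ht h1
      (by convert h2 using 1 <;> simp <;> ring)
    refine ⟨_, ⟨_, hb⟩, ?_⟩
    rw [tanLine, ← lineThrough_add_smul p w t₁ (inv_ne_zero hs)]
    congr 1
    · ext <;> simp <;> ring
    · ext
      · exact (eq_inv_mul_iff_mul_eq₀ hs).2 hu.symm
      · exact (eq_inv_mul_iff_mul_eq₀ hs).2 hw2.symm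
  · rintro ⟨z, ⟨τ, hz⟩, rfl⟩
    obtain ⟨⟨σ, h1⟩, h2, h3⟩ := h.isBit_partner hz
    refine ⟨z, _, z, tanPoint (bi c d A) z τ, ?_, rfl, ⟨⟨0, by simp⟩, h.isBit_mem_torus hz⟩,
      ⟨tanPoint_mem _ _ _, h.isBit_mem_torus h1⟩, h3.symm, ?_, ?_⟩
    · intro h0
      exact hz.dy (congrArg Prod.fst h0)
    · rw [two]; exact tanAt_grad hz.mem
    · rw [two]; exact ((isBit_iff _ _ _ _).1 hz).2.2.2.2

lemma Good.inflPts_eq (h : Good c d A) :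
    inflPts (bi c d A) =
      {z : ℂ × ℂ | ev[z.1, z.2] (bi c d A) = 0 ∧ ev[z.1, z.2] (hess (bi c d A)) = 0} := by
  have three : ∀ p w : ℂ × ℂ, (3 : ℕ∞) ≤ interMult (bi c d A) p w ↔
      Polynomial.X ^ 3 ∣ lineRes (bi c d A) p.1 p.2 w.1 w.2 := fun p w => by
    exact_mod_cast le_interMult_iff (bi c d A) p w 3
  ext z
  constructor
  · rintro ⟨hT, hf, w, hw, h3⟩
    rw [evalP_eq] at hf
    refine ⟨hf, ?_⟩
    rw [three] at h3
    have hw' : w.1 ≠ 0 ∨ w.2 ≠ 0 := by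
      by_contra hcon
      push Not at hcon
      exact hw (Prod.ext hcon.1 hcon.2)
    obtain ⟨s, hs, hu, hw2⟩ := h.exists_scale hw'
      ((tanAt_iff _ _ _ _ _).2 ((pow_dvd_pow _ (by norm_num)).trans h3))
    have hc := lineRes_comp (bi c d A) z.1 z.2 (ev[z.1, z.2] (pderiv 1 (bi c d A)))
      (-ev[z.1, z.2] (pderiv 0 (bi c d A))) 0 s
    rw [mul_zero, mul_zero, add_zero, add_zero, mul_comm _ s, mul_comm _ s, ← hu, ← hw2,
      map_zero, zero_add] at hc
    rw [← hc, X_pow_three_dvd_iff] at h3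
    have h4 := h3.2.2
    rw [Polynomial.comp_C_mul_X_coeff] at h4
    rw [ev_hess, (mul_eq_zero.1 h4).resolve_right (pow_ne_zero _ hs), mul_zero]
  · rintro ⟨hf, hH⟩
    have hX : Polynomial.X ^ 3 ∣ lineRes (bi c d A) z.1 z.2 (ev[z.1, z.2] (pderiv 1 (bi c d A)))
        (-ev[z.1, z.2] (pderiv 0 (bi c d A))) := by
      rw [X_pow_three_dvd_iff]
      rw [ev_hess] at hH
      exact ⟨(tanRes_coeff_zero _ _ _).trans hf, tanRes_coeff_one _ _ _, by simpa using hH⟩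
    have hq := h.flex_pderiv hf hH
    obtain ⟨a, b⟩ := z
    refine ⟨⟨?_, ?_⟩, (evalP_eq _ _).trans hf, (_, _), ?_, (three _ _).2 hX⟩
    · rintro (rfl : a = 0)
      refine h.axis3 hq (b := b) (w := -ev[0, b] (pderiv 0 (bi c d A))) ?_
      simpa only [trip, pow_zero, mul_one, map_zero, sub_zero] using hX
    · rintro (rfl : b = 0)
      have hp : ev[a, 0] (pderiv 0 (bi c d A)) ≠ 0 := by
        rw [← bi_tr_pderiv_one]
        exact h.swap.flex_pderiv (by rw [bi_tr]; exact hf) (by rw [bi_tr_hess]; exact hH)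
      refine h.swap.axis3 (neg_ne_zero.2 hp) (b := a) (w := ev[a, 0] (pderiv 1 (bi c d A))) ?_
      rw [lineRes_tr]
      simpa only [trip, pow_zero, mul_one, map_zero, sub_zero] using hX
    · intro h0
      exact hq (congrArg Prod.fst h0)

lemma ncard_eq_two_mul_of_fibers {α β : Type*} {Z : Set α} (hZ : Z.Finite) (φ : α → β)
    (H : ∀ z ∈ Z, ∃ z' ∈ Z, z' ≠ z ∧ φ z' = φ z ∧ ∀ y ∈ Z, φ y = φ z → y = z ∨ y = z') :
    Z.ncard = 2 * (φ '' Z).ncard := by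
  classical
  lift Z to Finset α using hZ
  rw [← Finset.coe_image, Set.ncard_coe_finset, Set.ncard_coe_finset, mul_comm]
  rw [Finset.card_eq_sum_card_image φ Z]
  refine Finset.sum_const_nat fun b hb => ?_
  obtain ⟨z, hz, rfl⟩ := Finset.mem_image.1 hb
  obtain ⟨z', hz', hne, he, hall⟩ := H z hz
  rw [Finset.card_eq_two]
  refine ⟨z, z', hne.symm, ?_⟩
  ext y
  simp only [Finset.mem_filter, Finset.mem_insert, Finset.mem_singleton]
  constructor
  · rintro ⟨hy, hyz⟩
    exact hall y hy hyz
  · rintro (rfl | rfl)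
    · exact ⟨hz, rfl⟩
    · exact ⟨hz', he⟩

theorem Good.counts (h : Good c d A) (hc : 5 ≤ c) (hd : 5 ≤ d) :
    (inflPts (bi c d A)).Finite ∧ ((inflPts (bi c d A)).ncard : ℤ) = 6 * c * d - 3 * c - 3 * d ∧
    (bitangentLines (bi c d A)).Finite ∧ ((bitangentLines (bi c d A)).ncard : ℤ)
      = 2 * c ^ 2 * d ^ 2 - 10 * c * d + 4 * c + 4 * d := by
  obtain ⟨f1, f2⟩ := h.flex_count (by omega) (by omega)
  obtain ⟨b1, b2⟩ := h.bit_count hc hd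
  rw [h.inflPts_eq, h.bitangentLines_eq]
  refine ⟨f1, f2, b1.image _, ?_⟩
  rw [ncard_eq_two_mul_of_fibers b1 (tanLine (bi c d A))] at b2
  · push_cast at b2; linarith
  · rintro z ⟨τ, hz⟩
    obtain ⟨h1, h2, h3⟩ := h.isBit_partner hz
    exact ⟨_, h1, h3, h2, fun y ⟨τ', hy⟩ hyz => h.tanLine_fiber hz hy hyz⟩

end

noncomputable section

lemma exists_relation_of_card_lt {σ ι : Type} [Fintype σ] [Fintype ι] (h : Fintype.card σ < Fintype.card ι)
    (P : ι → MvPolynomial σ ℂ) : ∃ D : MvPolynomial ι ℂ, D ≠ 0 ∧ aeval P D = 0 := by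
  by_contra hcon
  have hP : AlgebraicIndependent ℂ P := by
    rw [algebraicIndependent_iff]
    intro D hD
    by_contra h0
    exact hcon ⟨D, h0, hD⟩
  have h1 := hP.cardinalMk_le_trdeg
  rw [MvPolynomial.trdeg_of_isDomain] at h1
  simp at h1
  omega

/-- Coefficient vectors annihilated, for some value of `k` parameters, by `k + 1` linear forms which
are independent on a fixed set of `k + 1` coordinates, satisfy a fixed polynomial equation. -/
lemma exists_vanishing {k : ℕ} {ι : Type} [Fintype ι] [DecidableEq ι]
    (Λ : Fin (k + 1) → ι → MvPolynomial (Fin k) ℂ) (j : Fin (k + 1) → ι)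
    (hj : Function.Injective j) :
    ∃ D : MvPolynomial ι ℂ, D ≠ 0 ∧ ∀ (t : Fin k → ℂ) (a : ι → ℂ),
      (∀ b : Fin (k + 1) → ℂ, (∀ i, ∑ l, eval t (Λ i (j l)) * b l = 0) → b = 0) →
      (∀ i, ∑ s, eval t (Λ i s) * a s = 0) → eval a D = 0 := by
  classical
  let N := {s : ι // s ∉ Set.range j}
  let M : Matrix (Fin (k + 1)) (Fin (k + 1)) (MvPolynomial (Fin k) ℂ) :=
    Matrix.of fun i l => Λ i (j l)
  let inl : MvPolynomial (Fin k) ℂ →ₐ[ℂ] MvPolynomial (Fin k ⊕ N) ℂ := rename Sum.inl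
  let P : ι → MvPolynomial (Fin k ⊕ N) ℂ := fun s =>
    if h : ∃ l, j l = s then
      -∑ i, inl (M.adjugate h.choose i) * ∑ n : N, inl (Λ i n.1) * X (Sum.inr n)
    else inl M.det * X (Sum.inr ⟨s, h⟩)
  have hcard : Fintype.card (Fin k ⊕ N) < Fintype.card ι := by
    have h1 : Fintype.card ι = Fintype.card (Set.range j) + Fintype.card N :=
      (Fintype.card_congr (Equiv.sumCompl (· ∈ Set.range j)).symm).trans Fintype.card_sum
    have h2 := Set.card_range_of_injective hj
    rw [Fintype.card_fin] at h2
    rw [Fintype.card_sum, Fintype.card_fin]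
    omega
  obtain ⟨D, hD, hrel⟩ := exists_relation_of_card_lt hcard P
  refine ⟨D, hD, fun t a hinj ha => ?_⟩
  let Mt : Matrix (Fin (k + 1)) (Fin (k + 1)) ℂ := (eval t).mapMatrix M
  have hMt : ∀ i l, Mt i l = eval t (Λ i (j l)) := fun i l => rfl
  have hdet : Mt.det ≠ 0 := by
    intro h0
    obtain ⟨b, hb, hb'⟩ := Matrix.exists_mulVec_eq_zero_iff.2 h0
    exact hb (hinj b fun i => congrFun hb' i)
  have key : ∀ a : ι → ℂ, (∀ i, ∑ s, eval t (Λ i s) * a s = 0) →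
      eval (fun s => Mt.det * a s) D = 0 := by
    intro a ha
    let e : Fin k ⊕ N → ℂ := Sum.elim t fun n => a n.1
    have hinl : ∀ p, eval e (inl p) = eval t p := fun p => eval_rename _ _ _
    have hdt : Mt.det = eval t M.det := (RingHom.map_det _ _).symm
    have hadj : ∀ l i, eval t (M.adjugate l i) = Mt.adjugate l i := fun l i => by
      have := congrFun (congrFun ((eval t).map_adjugate M) l) i
      exact this
    have hP : ∀ s, eval e (P s) = Mt.det * a s := by
      intro s
      by_cases h : ∃ l, j l = s
      · simp only [P, dif_pos h, map_neg, map_sum, map_mul, hinl, eval_X, hadj]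
        have hl := h.choose_spec
        set l := h.choose
        have h1 : ∀ i, ∑ n : N, eval t (Λ i n.1) * e (Sum.inr n)
            = - Mt.mulVec (fun l => a (j l)) i := by
          intro i
          have h2 : ∑ s : {s // s ∈ Set.range j}, eval t (Λ i s.1) * a s.1
              + ∑ n : N, eval t (Λ i n.1) * a n.1 = 0 := by
            have := ha i
            rw [← Fintype.sum_subtype_add_sum_subtype (· ∈ Set.range j)] at this
            convert this
          have h3 : ∑ s : {s // s ∈ Set.range j}, eval t (Λ i s.1) * a s.1
              = Mt.mulVec (fun l => a (j l)) i :=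
            (Equiv.sum_comp (Equiv.ofInjective j hj) _).symm
          rw [h3] at h2
          exact eq_neg_of_add_eq_zero_right h2
        simp only [h1, mul_neg, Finset.sum_neg_distrib, neg_neg]
        have h4 := congrFun (congrArg (fun Q => Q.mulVec fun l => a (j l)) (Matrix.adjugate_mul Mt)) l
        rw [← Matrix.mulVec_mulVec, Matrix.smul_mulVec, Matrix.one_mulVec] at h4
        rw [← hl]
        exact h4
      · simp only [P, dif_neg h, map_mul, hinl, eval_X, hdt]
        rfl
    have := congrArg (eval e) hrel
    rw [map_zero, ← MvPolynomial.aeval_eq_eval, ← AlgHom.comp_apply,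
      MvPolynomial.comp_aeval, MvPolynomial.aeval_eq_eval] at this
    rw [← this]
    congr 2
    funext s
    exact (hP s).symm
  have := key (fun s => Mt.det⁻¹ * a s) fun i => by
    simp only [mul_left_comm _ (Mt.det⁻¹), ← Finset.mul_sum, ha i, mul_zero]
  simpa only [mul_inv_cancel_left₀ hdet] using this

/-- A property of coefficient arrays which holds outside a proper algebraic hypersurface. -/
def Gen (c d : ℕ) (Q : (ℕ → ℕ → ℂ) → Prop) : Prop :=
  ∃ D : MvPolynomial (Fin (c + 1) × Fin (d + 1)) ℂ, D ≠ 0 ∧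
    ∀ A : ℕ → ℕ → ℂ, eval (fun s => A s.1 s.2) D ≠ 0 → Q A

variable {c d : ℕ}

lemma Gen.mono {Q R : (ℕ → ℕ → ℂ) → Prop} (h : Gen c d Q) (hQR : ∀ A, Q A → R A) : Gen c d R := by
  obtain ⟨D, hD, h⟩ := h
  exact ⟨D, hD, fun A hA => hQR A (h A hA)⟩

lemma Gen.and {Q R : (ℕ → ℕ → ℂ) → Prop} (h₁ : Gen c d Q) (h₂ : Gen c d R) :
    Gen c d fun A => Q A ∧ R A := by
  obtain ⟨D, hD, h⟩ := h₁
  obtain ⟨E, hE, h'⟩ := h₂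
  refine ⟨D * E, mul_ne_zero hD hE, fun A hA => ?_⟩
  rw [map_mul] at hA
  exact ⟨h A (left_ne_zero_of_mul hA), h' A (right_ne_zero_of_mul hA)⟩

lemma Gen.tr {Q : (ℕ → ℕ → ℂ) → Prop} (h : Gen c d Q) : Gen d c fun A => Q (tr A) := by
  obtain ⟨D, hD, h⟩ := h
  refine ⟨rename Prod.swap D, ?_, fun A hA => h _ ?_⟩
  · rwa [Ne, map_eq_zero_iff _ (rename_injective _ Prod.swap_injective)]
  · rwa [eval_rename] at hA

lemma gen_of_linear {k : ℕ} (Λ : Fin (k + 1) → ℕ → ℕ → MvPolynomial (Fin k) ℂ)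
    (j : Fin (k + 1) → Fin (c + 1) × Fin (d + 1)) (hj : Function.Injective j)
    (hinj : ∀ (t : Fin k → ℂ) (b : Fin (k + 1) → ℂ),
      (∀ i, ∑ l, eval t (Λ i (j l).1 (j l).2) * b l = 0) → b = 0) :
    Gen c d fun A => ∀ t : Fin k → ℂ, ¬ ∀ i, ∑ p ∈ Finset.range (c + 1),
      ∑ q ∈ Finset.range (d + 1), A p q * eval t (Λ i p q) = 0 := by
  obtain ⟨D, hD, h⟩ := exists_vanishing (fun i s => Λ i s.1 s.2) j hj
  refine ⟨D, hD, fun A hA t ht => hA (h t _ (hinj t) fun i => ?_)⟩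
  rw [← ht i, Fintype.sum_prod_type, Finset.sum_range]
  refine Finset.sum_congr rfl fun p _ => ?_
  rw [Finset.sum_range]
  exact Finset.sum_congr rfl fun q _ => mul_comm _ _

lemma gen_line {k : ℕ} (hk : k ≤ c) (M : Polynomial (MvPolynomial (Fin k) ℂ)) (hM : M.Monic)
    (hdeg : M.natDegree = k + 1) (β μ : MvPolynomial (Fin k) ℂ) :
    Gen c d fun A => ∀ t : Fin k → ℂ,
      ¬ M.map (eval t) ∣ lineRes (bi c d A) 0 (eval t β) 1 (eval t μ) := by
  let Λ : Fin (k + 1) → ℕ → ℕ → MvPolynomial (Fin k) ℂ := fun i p q =>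
    ((Polynomial.X ^ p * (Polynomial.C β + Polynomial.C μ * Polynomial.X) ^ q) %ₘ M).coeff i
  have hΛ : ∀ t i p q, eval t (Λ i p q) = ((Polynomial.X ^ p * (Polynomial.C (eval t β)
      + Polynomial.C (eval t μ) * Polynomial.X) ^ q) %ₘ M.map (eval t)).coeff i := by
    intro t i p q
    simp only [Λ]
    rw [← Polynomial.coeff_map, Polynomial.map_modByMonic _ hM]
    simp
  refine (gen_of_linear (c := c) (d := d) Λ (fun l => (⟨l, by omega⟩, 0)) ?_ ?_).mono ?_
  · intro l l' h
    simp only [Prod.mk.injEq, Fin.mk.injEq, and_true] at h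
    exact Fin.ext h
  · intro t b hb
    funext i
    have h1 := hb i
    have h2 : ∀ l : Fin (k + 1), eval t (Λ i l 0) = if i = l then 1 else 0 := by
      intro l
      rw [hΛ, pow_zero, mul_one, (Polynomial.modByMonic_eq_self_iff (hM.map _)).2,
        Polynomial.coeff_X_pow]
      · simp only [Fin.ext_iff]
      · rw [Polynomial.degree_X_pow, Polynomial.degree_eq_natDegree (hM.map _).ne_zero,
          hM.natDegree_map, hdeg]
        exact_mod_cast l.2
    simpa [h2] using h1
  · intro A hA t hdvd
    refine hA t fun i => ?_
    rw [← Polynomial.modByMonic_eq_zero_iff_dvd (hM.map _)] at hdvd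
    rw [lineRes_bi] at hdvd
    have h1 := congrArg (fun P => Polynomial.coeff P i) hdvd
    simp only [Polynomial.coeff_zero] at h1
    rw [← h1]
    simp only [← Polynomial.modByMonicHom_apply, map_sum, Polynomial.finsetSum_coeff]
    refine Finset.sum_congr rfl fun p _ => Finset.sum_congr rfl fun q _ => ?_
    rw [hΛ, map_zero, zero_add, map_one, one_mul, mul_assoc, Algebra.algebraMap_self_apply,
      ← Polynomial.smul_eq_C_mul (A p q), map_smul, Polynomial.coeff_smul, smul_eq_mul,
      Polynomial.modByMonicHom_apply]

end

noncomputable section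

variable {c d : ℕ}

lemma gen_trip {k : ℕ} (hk : k ≤ c) (r s u β μ : MvPolynomial (Fin k) ℂ) {i j l : ℕ}
    (hdeg : i + j + l = k + 1) :
    Gen c d fun A => ∀ t : Fin k → ℂ, ¬ trip (eval t r) (eval t s) (eval t u) i j l ∣
      lineRes (bi c d A) 0 (eval t β) 1 (eval t μ) := by
  have hm : ∀ (v : MvPolynomial (Fin k) ℂ) (n : ℕ),
      ((Polynomial.X - Polynomial.C v) ^ n).Monic := fun v n => (Polynomial.monic_X_sub_C v).pow n
  refine (gen_line hk ((Polynomial.X - Polynomial.C r) ^ i * (Polynomial.X - Polynomial.C s) ^ j *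
    (Polynomial.X - Polynomial.C u) ^ l) (((hm _ _).mul (hm _ _)).mul (hm _ _)) ?_ β μ).mono ?_
  · rw [((hm _ _).mul (hm _ _)).natDegree_mul (hm _ _), (hm _ _).natDegree_mul (hm _ _)]
    simp only [Polynomial.natDegree_pow, Polynomial.natDegree_X_sub_C, mul_one, hdeg]
  · intro A h t
    have := h t
    simpa only [trip, Polynomial.map_mul, Polynomial.map_pow, Polynomial.map_sub, Polynomial.map_X,
      Polynomial.map_C] using this

lemma gen_top : Gen c d fun A => A c d ≠ 0 :=
  ⟨X (Fin.last c, Fin.last d), X_ne_zero _, fun A hA => by simpa using hA⟩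

lemma gen_smooth (hc : 1 ≤ c) (hd : 1 ≤ d) : Gen c d fun A => ∀ a b : ℂ,
    ev[a, b] (bi c d A) = 0 → ev[a, b] (pderiv 0 (bi c d A)) = 0 →
      ev[a, b] (pderiv 1 (bi c d A)) ≠ 0 := by
  let Λ : Fin 3 → ℕ → ℕ → MvPolynomial (Fin 2) ℂ := ![fun p q => X 0 ^ p * X 1 ^ q,
    fun p q => C (p : ℂ) * X 0 ^ (p - 1) * X 1 ^ q, fun p q => X 0 ^ p * (C (q : ℂ) * X 1 ^ (q - 1))]
  refine (gen_of_linear (c := c) (d := d) Λ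
    ![(⟨0, by omega⟩, ⟨0, by omega⟩), (⟨1, by omega⟩, ⟨0, by omega⟩),
      (⟨0, by omega⟩, ⟨1, by omega⟩)] ?_ ?_).mono ?_
  · intro i j; fin_cases i <;> fin_cases j <;> simp
  · intro t b h
    have h0 := h 0
    have h1 := h 1
    have h2 := h 2
    simp [Fin.sum_univ_succ, Λ] at h0 h1 h2
    rw [h1, h2] at h0
    funext i
    fin_cases i
    · simpa using h0
    · exact h1
    · exact h2
  · intro A h a b h0 h1 h2
    refine h ![a, b] fun i => ?_
    rw [ev_bi] at h0
    rw [pderiv_bi_zero] at h1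
    rw [pderiv_bi_one] at h2
    fin_cases i
    · rw [← h0]; simp [Λ, mul_assoc]
    · rw [← h1]; simp [Λ, mul_assoc]
    · rw [← h2]; simp [Λ, mul_assoc]

lemma gen_edge_next (hc : 1 ≤ c) : Gen c d fun A => ∀ b : ℂ,
    ∑ j ∈ Finset.range (d + 1), A c j * b ^ j = 0 →
      ∑ j ∈ Finset.range (d + 1), A (c - 1) j * b ^ j ≠ 0 := by
  let Λ : Fin 2 → ℕ → ℕ → MvPolynomial (Fin 1) ℂ :=
    ![fun p q => if p = c then X 0 ^ q else 0, fun p q => if p = c - 1 then X 0 ^ q else 0]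
  refine (gen_of_linear (c := c) (d := d) Λ
    ![(⟨c, by omega⟩, ⟨0, by omega⟩), (⟨c - 1, by omega⟩, ⟨0, by omega⟩)] ?_ ?_).mono ?_
  · intro i j; fin_cases i <;> fin_cases j <;> simp <;> omega
  · intro t b h
    have h0 := h 0
    have h1 := h 1
    have e1 : c - 1 ≠ c := by omega
    simp [Fin.sum_univ_succ, Λ, e1, e1.symm] at h0 h1
    funext i
    fin_cases i
    · exact h0
    · exact h1
  · intro A h b h0 h1
    refine h ![b] fun i => ?_
    fin_cases i
    · rw [← h0, Finset.sum_eq_single_of_mem c (by simp)]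
      · simp [Λ]
      · intro p _ hp; simp [Λ, hp]
    · rw [← h1, Finset.sum_eq_single_of_mem (c - 1) (by simp)]
      · simp [Λ]
      · intro p _ hp; simp [Λ, hp]

lemma gen_edge_simple (hd : 1 ≤ d) : Gen c d fun A => ∀ b : ℂ,
    ∑ j ∈ Finset.range (d + 1), A c j * b ^ j = 0 →
      ∑ j ∈ Finset.range (d + 1), A c j * (j * b ^ (j - 1)) ≠ 0 := by
  let Λ : Fin 2 → ℕ → ℕ → MvPolynomial (Fin 1) ℂ :=
    ![fun p q => if p = c then X 0 ^ q else 0, fun p q => if p = c then C (q : ℂ) * X 0 ^ (q - 1) else 0]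
  refine (gen_of_linear (c := c) (d := d) Λ
    ![(⟨c, by omega⟩, ⟨0, by omega⟩), (⟨c, by omega⟩, ⟨1, by omega⟩)] ?_ ?_).mono ?_
  · intro i j; fin_cases i <;> fin_cases j <;> simp
  · intro t b h
    have h0 := h 0
    have h1 := h 1
    simp [Fin.sum_univ_succ, Λ] at h0 h1
    rw [h1] at h0
    funext i
    fin_cases i
    · simpa using h0
    · exact h1
  · intro A h b h0 h1
    refine h ![b] fun i => ?_
    fin_cases i
    · rw [← h0, Finset.sum_eq_single_of_mem c (by simp)]
      · simp [Λ]
      · intro p _ hp; simp [Λ, hp]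
    · rw [← h1, Finset.sum_eq_single_of_mem c (by simp)]
      · simp [Λ]
      · intro p _ hp; simp [Λ, hp]

lemma gen_edge_hor (hc : 2 ≤ c) : Gen c d fun A => ∀ a b : ℂ,
    ∑ j ∈ Finset.range (d + 1), A c j * b ^ j = 0 →
      ev[a, b] (bi c d A) = 0 → ev[a, b] (pderiv 0 (bi c d A)) ≠ 0 := by
  let Λ : Fin 3 → ℕ → ℕ → MvPolynomial (Fin 2) ℂ :=
    ![fun p q => if p = c then X 1 ^ q else 0, fun p q => X 0 ^ p * X 1 ^ q,
      fun p q => C (p : ℂ) * X 0 ^ (p - 1) * X 1 ^ q]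
  refine (gen_of_linear (c := c) (d := d) Λ
    ![(⟨c, by omega⟩, ⟨0, by omega⟩), (⟨0, by omega⟩, ⟨0, by omega⟩),
      (⟨1, by omega⟩, ⟨0, by omega⟩)] ?_ ?_).mono ?_
  · intro i j; fin_cases i <;> fin_cases j <;> simp <;> omega
  · intro t b h
    have h0 := h 0
    have h1 := h 1
    have h2 := h 2
    have e1 : 0 ≠ c := by omega
    have e2 : 1 ≠ c := by omega
    simp [Fin.sum_univ_succ, Λ, e1, e2] at h0 h1 h2
    rw [h0] at h1 h2
    simp at h1 h2
    rw [h2] at h1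
    funext i
    fin_cases i
    · exact h0
    · simpa using h1
    · exact h2
  · intro A h a b h0 h1 h2
    refine h ![a, b] fun i => ?_
    rw [ev_bi] at h1
    rw [pderiv_bi_zero] at h2
    fin_cases i
    · rw [← h0, Finset.sum_eq_single_of_mem c (by simp)]
      · simp [Λ]
      · intro p _ hp; simp [Λ, hp]
    · rw [← h1]; simp [Λ, mul_assoc]
    · rw [← h2]; simp [Λ, mul_assoc]

lemma gen_halfGood (hc : 5 ≤ c) (hd : 1 ≤ d) : Gen c d (HalfGood c d) := by
  have l4 := gen_trip (d := d) (k := 3) (by omega : 3 ≤ c) (X 2) (X 2) (X 2) (X 1) (X 0)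
    (show 4 + 0 + 0 = 4 from rfl)
  have l32 := gen_trip (d := d) (k := 4) (by omega : 4 ≤ c) (X 2) (X 3) (X 3) (X 1) (X 0)
    (show 3 + 2 + 0 = 5 from rfl)
  have l222 := gen_trip (d := d) (k := 5) hc (X 2) (X 3) (X 4) (X 1) (X 0)
    (show 2 + 2 + 2 = 6 from rfl)
  have h3 := gen_trip (d := d) (k := 2) (by omega : 2 ≤ c) (X 1) (X 1) (X 1) (X 0) 0
    (show 3 + 0 + 0 = 3 from rfl)
  have h22 := gen_trip (d := d) (k := 3) (by omega : 3 ≤ c) (X 1) (X 2) (X 2) (X 0) 0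
    (show 2 + 2 + 0 = 4 from rfl)
  have a3 := gen_trip (d := d) (k := 2) (by omega : 2 ≤ c) 0 0 0 (X 1) (X 0)
    (show 3 + 0 + 0 = 3 from rfl)
  have a22 := gen_trip (d := d) (k := 3) (by omega : 3 ≤ c) 0 (X 2) (X 2) (X 1) (X 0)
    (show 2 + 2 + 0 = 4 from rfl)
  simp only [eval_X, map_zero] at l4 l32 l222 h3 h22 a3 a22
  refine ((gen_top (c := c) (d := d)).and ((gen_smooth (by omega : 1 ≤ c) hd).and (l4.and (l32.and
    (l222.and (h3.and (h22.and (a3.and (a22.and ((gen_edge_next (by omega)).and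
      ((gen_edge_simple hd).and (gen_edge_hor (by omega))))))))))))).mono ?_
  rintro A ⟨h1, h2, l4, l32, l222, h3, h22, a3, a22, e1, e2, e3⟩
  exact
  { top := h1
    smooth := h2
    line4 := fun m b r => l4 ![m, b, r]
    line32 := fun m b r s => l32 ![m, b, r, s]
    line222 := fun m b r s t => l222 ![m, b, r, s, t]
    hor3 := fun b r => h3 ![b, r]
    hor22 := fun b r s => h22 ![b, r, s]
    axis3 := fun m b => a3 ![m, b]
    axis22 := fun m b r => a22 ![m, b, r]
    edge_next := e1
    edge_simple := e2
    edge_hor := e3 }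

lemma gen_good (hc : 5 ≤ c) (hd : 5 ≤ d) : Gen c d (Good c d) :=
  ((gen_halfGood hc (by omega)).and (gen_halfGood hd (by omega)).tr).mono
    fun _ h => ⟨h.1, h.2⟩

lemma eq_bi_of_suppIn {f : MvPolynomial (Fin 2) ℂ}
    (hf : SuppIn f {k : ℤ × ℤ | 0 ≤ k.1 ∧ k.1 ≤ c ∧ 0 ≤ k.2 ∧ k.2 ≤ d}) :
    f = bi c d fun i j => coeffAt f (i, j) := by
  have hmon : ∀ (m : Fin 2 →₀ ℕ) (i j : ℕ) (a : ℂ),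
      coeff m (C a * X 0 ^ i * X 1 ^ j : MvPolynomial (Fin 2) ℂ)
        = if i = m 0 ∧ j = m 1 then a else 0 := by
    intro m i j a
    have h1 : (C a * X 0 ^ i * X 1 ^ j : MvPolynomial (Fin 2) ℂ)
        = monomial (Finsupp.single 0 i + Finsupp.single 1 j) a := by
      rw [mul_assoc, X_pow_eq_monomial, X_pow_eq_monomial, monomial_mul, C_mul_monomial,
        one_mul, mul_one]
    rw [h1, coeff_monomial]
    congr 1
    rw [Finsupp.ext_iff, Fin.forall_fin_two]
    simp
  have hA : ∀ m : Fin 2 →₀ ℕ, coeffAt f (m 0, m 1) = coeff m f := by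
    intro m
    simp only [coeffAt, Nat.cast_nonneg, and_self, if_true, Int.toNat_natCast]
    congr 1
    ext i
    fin_cases i <;> simp
  ext m
  rw [bi]
  simp only [coeff_sum, hmon]
  by_cases hm : m 0 < c + 1 ∧ m 1 < d + 1
  · rw [Finset.sum_eq_single_of_mem (m 0) (Finset.mem_range.2 hm.1),
      Finset.sum_eq_single_of_mem (m 1) (Finset.mem_range.2 hm.2), if_pos ⟨rfl, rfl⟩, hA]
    · intro j _ hj; rw [if_neg fun h => hj h.2]
    · intro i _ hi
      exact Finset.sum_eq_zero fun j _ => if_neg fun h => hi h.1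
  · rw [Finset.sum_eq_zero fun i hi => Finset.sum_eq_zero fun j hj => if_neg ?_]
    · by_contra h0
      have := hf m (mem_support_iff.2 h0)
      simp only [Set.mem_ofPred_eq] at this
      omega
    · rw [Finset.mem_range] at hi hj
      omega

lemma genericOn_of_gen {Q : MvPolynomial (Fin 2) ℂ → Prop}
    (h : Gen c d fun A => Q (bi c d A)) :
    GenericOn {k : ℤ × ℤ | 0 ≤ k.1 ∧ k.1 ≤ c ∧ 0 ≤ k.2 ∧ k.2 ≤ d} Q := by
  obtain ⟨D, hD, h⟩ := h
  let e : Fin (c + 1) × Fin (d + 1) → {k : ℤ × ℤ | 0 ≤ k.1 ∧ k.1 ≤ c ∧ 0 ≤ k.2 ∧ k.2 ≤ d} :=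
    fun s => ⟨(s.1, s.2), by have := s.1.2; have := s.2.2; simp; omega⟩
  have he : Function.Injective e := by
    rintro ⟨i, j⟩ ⟨i', j'⟩ h
    simp only [e, Subtype.mk.injEq, Prod.mk.injEq, Nat.cast_inj] at h
    exact Prod.ext (Fin.ext h.1) (Fin.ext h.2)
  refine ⟨rename e D, ?_, fun f hf hDf => ?_⟩
  · rwa [Ne, map_eq_zero_iff _ (rename_injective _ he)]
  · rw [eval_rename] at hDf
    rw [eq_bi_of_suppIn hf]
    exact h _ hDf

end

theorem bidegree_count (c d : ℕ) (hc : 5 ≤ c) (hd : 5 ≤ d) :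
    GenericOn {k : ℤ × ℤ | 0 ≤ k.1 ∧ k.1 ≤ (c : ℤ) ∧ 0 ≤ k.2 ∧ k.2 ≤ (d : ℤ)} (fun f =>
      (inflPts f).Finite ∧
      ((inflPts f).ncard : ℤ) = 6 * c * d - 3 * c - 3 * d ∧
      (bitangentLines f).Finite ∧
      ((bitangentLines f).ncard : ℤ)
        = 2 * c ^ 2 * d ^ 2 - 10 * c * d + 4 * c + 4 * d) :=
  genericOn_of_gen ((gen_good hc hd).mono fun _ h => h.counts hc hd)

end
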